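/- Assume GCH. Let κ be the least cardinal λ > ℵ₀ such that there exists a λ-free abelian group of cardinality λ which is a Whitehead group but is not free (assuming such a cardinal exists). If, moreover, every κ-free abelian group of cardinality κ is a Whitehead group, then κ is strongly inaccessible. -/

import Mathlib

universe u

/-- An abelian group is free if it is a free `ℤ`-module. -/
def IsFreeAbelian (G : Type u) [AddCommGroup G] : Prop :=
  Module.Free ℤ G

/-- `G` is `κ`-free: every subgroup of cardinality `< κ` is free. -/
def IsKappaFree (κ : Cardinal.{u}) (G : Type u) [AddCommGroup G] : Prop :=
  ∀ H : AddSubgroup G, Cardinal.mk H < κ → IsFreeAbelian H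

/-- `G` is a Whitehead group. -/
def IsWhitehead (G : Type u) [AddCommGroup G] : Prop :=
  ∀ (H : Type u) [AddCommGroup H] (π : H →+ G),
    Function.Surjective π → Nonempty (π.ker ≃+ ℤ) →
      ∃ s : G →+ H, π.comp s = AddMonoidHom.id G

/-- strongly κ-free -/
def IsStronglyKappaFree (κ : Cardinal.{u}) (G : Type u) [AddCommGroup G] : Prop :=
  IsKappaFree κ G ∧
    ∀ H : AddSubgroup G, Cardinal.mk H < κ →
      ∃ K : AddSubgroup G, H ≤ K ∧ Cardinal.mk K < κ ∧ IsKappaFree κ (G ⧸ K)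

/-- There is a λ-free abelian group of cardinality λ which is Whitehead but not free. -/
def ExistsKappaFreeWhiteheadNonfree (lam : Cardinal.{u}) : Prop :=
  ∃ (G : Type u) (inst : AddCommGroup G),
    Cardinal.mk G = lam ∧ @IsKappaFree lam G inst ∧ @IsWhitehead G inst ∧
      ¬ @IsFreeAbelian G inst

open Cardinal

section RelFree

variable {A : Type*} [AddCommGroup A]

/-- `M` is free over `N`: the image of `M` in `A ⧸ N` is a free abelian group. -/
def RelFree (N M : Submodule ℤ A) : Prop :=
  Module.Free ℤ (M.map N.mkQ)

theorem relFree_of_hom {P : Type*} [AddCommGroup P] {N M : Submodule ℤ A} (f : M →ₗ[ℤ] P)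
    (hf : Module.Free ℤ (LinearMap.range f)) (h : ∀ x : M, f x = 0 ↔ (x : A) ∈ N) :
    RelFree N M := by
  have hk : LinearMap.ker f = LinearMap.ker (N.mkQ ∘ₗ M.subtype) := by
    ext x; simp [h]
  have hr : LinearMap.range (N.mkQ ∘ₗ M.subtype) = M.map N.mkQ := by
    rw [LinearMap.range_comp, Submodule.range_subtype]
  unfold RelFree
  rw [← hr]
  exact Module.Free.of_equiv (f.quotKerEquivRange.symm ≪≫ₗ Submodule.quotEquivOfEq _ _ hk ≪≫ₗ
    (N.mkQ ∘ₗ M.subtype).quotKerEquivRange)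

theorem RelFree.exists_compl {N M : Submodule ℤ A} (h : RelFree N M) :
    ∃ C ≤ M, Module.Free ℤ C ∧ Disjoint N C ∧ N ⊔ C = N ⊔ M := by
  unfold RelFree at h
  have hs : Function.Surjective (N.mkQ.submoduleMap M) := N.mkQ.submoduleMap_surjective M
  obtain ⟨s, hs'⟩ := Module.projective_lifting_property (N.mkQ.submoduleMap M) LinearMap.id hs
  have hs2 : ∀ y, N.mkQ.submoduleMap M (s y) = y := fun y => LinearMap.congr_fun hs' y
  have hinj : Function.Injective (M.subtype ∘ₗ s) := by
    intro a b hab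
    have : s a = s b := Subtype.ext hab
    rw [← hs2 a, ← hs2 b, this]
  refine ⟨LinearMap.range (M.subtype ∘ₗ s), ?_, ?_, ?_, ?_⟩
  · rintro _ ⟨y, rfl⟩; exact (s y).2
  · exact Module.Free.of_equiv (LinearEquiv.ofInjective _ hinj)
  · rw [Submodule.disjoint_def]
    rintro _ hx ⟨y, rfl⟩
    have h1 : N.mkQ.submoduleMap M (s y) = 0 := by
      apply Subtype.ext
      simpa using hx
    rw [hs2] at h1
    simp [h1]
  · apply le_antisymm
    · refine sup_le le_sup_left (le_sup_of_le_right ?_)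
      rintro _ ⟨y, rfl⟩; exact (s y).2
    · refine sup_le le_sup_left ?_
      intro x hx
      have h1 : x - (s (N.mkQ.submoduleMap M ⟨x, hx⟩) : A) ∈ N := by
        have := congrArg Subtype.val (hs2 (N.mkQ.submoduleMap M ⟨x, hx⟩))
        simp only [LinearMap.submoduleMap_coe_apply, Submodule.mkQ_apply] at this
        rw [← Submodule.Quotient.mk_eq_zero, Submodule.Quotient.mk_sub, this, sub_self]
      rw [← sub_add_cancel x (s (N.mkQ.submoduleMap M ⟨x, hx⟩) : A)]
      exact Submodule.add_mem_sup h1 ⟨_, rfl⟩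

theorem relFree_congr {N M M' : Submodule ℤ A} (h : N ⊔ M = N ⊔ M') :
    RelFree N M ↔ RelFree N M' := by
  have h1 : M.map N.mkQ = M'.map N.mkQ := by
    have := congrArg (Submodule.map N.mkQ) h
    simpa [Submodule.map_sup] using this
  unfold RelFree; rw [h1]

theorem relFree_of_disjoint {N C : Submodule ℤ A} (hC : Module.Free ℤ C) (hd : Disjoint N C) :
    RelFree N C := by
  refine relFree_of_hom (P := C) LinearMap.id ?_ ?_
  · rw [LinearMap.range_id]; exact Module.Free.of_equiv Submodule.topEquiv.symm
  · intro x
    rw [Submodule.disjoint_def] at hd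
    constructor
    · rintro h; rw [LinearMap.id_apply] at h; rw [h]; exact N.zero_mem
    · intro h; exact Subtype.ext (hd x h x.2)

theorem relFree_of_compl {N C M : Submodule ℤ A} (hC : Module.Free ℤ C) (hd : Disjoint N C)
    (h : N ⊔ C = N ⊔ M) : RelFree N M :=
  (relFree_congr h).1 (relFree_of_disjoint hC hd)

theorem relFree_bot_iff {M : Submodule ℤ A} : RelFree ⊥ M ↔ Module.Free ℤ M := by
  constructor
  · intro h
    obtain ⟨C, -, h1, -, h2⟩ := h.exists_compl
    simp only [bot_sup_eq] at h2
    exact h2 ▸ h1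
  · intro h
    exact relFree_of_disjoint h disjoint_bot_left

theorem relFree_of_le {N M : Submodule ℤ A} (h : M ≤ N) : RelFree N M :=
  relFree_of_compl (C := ⊥) inferInstance disjoint_bot_right (by simp [h])

/-- A family of submodules indexed by a linear order is independent as soon as each member is
disjoint from the span of the previous ones. -/
theorem iSupIndep_of_disjoint_lt {J : Type*} [LinearOrder J] (C : J → Submodule ℤ A)
    (h : ∀ j, Disjoint (⨆ i, ⨆ (_ : i < j), C i) (C j)) : iSupIndep C := by
  classical
  rw [iSupIndep_iff_finsetSum_eq_zero_imp_eq_zero]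
  intro s v hv hsum
  by_contra hne
  push Not at hne
  obtain ⟨i0, hi0, hi0'⟩ := hne
  let t := s.filter (fun i => v i ≠ 0)
  have ht : t.Nonempty := ⟨i0, by simp [t, hi0, hi0']⟩
  let j := t.max' ht
  have hj : j ∈ t := t.max'_mem ht
  have hjs : j ∈ s ∧ v j ≠ 0 := by simpa [t] using hj
  have hs2 : ∑ i ∈ t, v i = 0 := by
    rw [← hsum, Finset.sum_filter_ne_zero]
  rw [← Finset.add_sum_erase t _ hj] at hs2
  have h2 : ∑ i ∈ t.erase j, v i ∈ ⨆ i, ⨆ (_ : i < j), C i := by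
    refine Submodule.sum_mem _ fun i hi => ?_
    have hi' := Finset.mem_erase.1 hi
    have hlt : i < j := lt_of_le_of_ne (t.le_max' _ hi'.2) hi'.1
    have : v i ∈ C i := hv i ((Finset.mem_filter.1 hi'.2).1)
    exact (le_iSup₂_of_le (f := fun i (_ : i < j) => C i) i hlt le_rfl) this
  have h3 : v j = - ∑ i ∈ t.erase j, v i := eq_neg_of_add_eq_zero_left hs2
  have h4 := Submodule.disjoint_def.1 (h j) (v j) (by rw [h3]; exact neg_mem h2) (hv j hjs.1)
  exact hjs.2 h4

theorem iSupIndep.exists_equiv {J : Type*} {C : J → Submodule ℤ A} (hi : iSupIndep C) :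
    ∃ e : (Π₀ j, C j) ≃ₗ[ℤ] (⨆ j, C j : Submodule ℤ A), ∀ f, (e f : A) = by
      classical exact DFinsupp.lsum ℕ (fun j => (C j).subtype) f := by
  classical
  refine ⟨(LinearEquiv.ofInjective _ hi.dfinsupp_lsum_injective) ≪≫ₗ
    LinearEquiv.ofEq _ _ (Submodule.iSup_eq_range_dfinsupp_lsum C).symm, fun f => ?_⟩
  simp

theorem free_iSup_of_iSupIndep {J : Type*} {C : J → Submodule ℤ A} (hi : iSupIndep C)
    (hf : ∀ j, Module.Free ℤ (C j)) : Module.Free ℤ (⨆ j, C j : Submodule ℤ A) := by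
  classical
  obtain ⟨e, -⟩ := hi.exists_equiv
  exact Module.Free.of_equiv e

/-- Gluing homomorphisms along an independent family. -/
theorem iSupIndep.exists_hom {J : Type*} {C : J → Submodule ℤ A} (hi : iSupIndep C)
    {P : Type*} [AddCommGroup P] (φ : ∀ j, C j →ₗ[ℤ] P) :
    ∃ f : (⨆ j, C j : Submodule ℤ A) →ₗ[ℤ] P,
      ∀ j (x : A) (hx : x ∈ C j), f ⟨x, le_iSup C j hx⟩ = φ j ⟨x, hx⟩ := by
  classical
  obtain ⟨e, he⟩ := hi.exists_equiv
  refine ⟨(DFinsupp.lsum ℕ φ) ∘ₗ e.symm.toLinearMap, fun j x hx => ?_⟩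
  have : e (DFinsupp.single j ⟨x, hx⟩) = ⟨x, le_iSup C j hx⟩ := by
    apply Subtype.ext; rw [he]; simp
  rw [← this]
  simp

/-- Complements along a chain. -/
theorem exists_compl_chain {J : Type*} [LinearOrder J] [WellFoundedLT J] (M : J → Submodule ℤ A)
    (h : ∀ j, RelFree (⨆ i, ⨆ (_ : i < j), M i) (M j)) :
    ∃ C : J → Submodule ℤ A, (∀ j, C j ≤ M j) ∧ (∀ j, Module.Free ℤ (C j)) ∧ iSupIndep C ∧
      (∀ j, Disjoint (⨆ i, ⨆ (_ : i < j), M i) (C j)) ∧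
      (∀ j, M j ≤ (⨆ i, ⨆ (_ : i < j), M i) ⊔ C j) ∧
      ∀ j, (⨆ i, ⨆ (_ : i ≤ j), C i) = ⨆ i, ⨆ (_ : i ≤ j), M i := by
  choose C hle hfree hd hs using fun j => (h j).exists_compl
  refine ⟨C, hle, hfree, ?_, hd, ?_, ?_⟩
  · refine iSupIndep_of_disjoint_lt C fun j => (hd j).mono_left ?_
    exact iSup₂_mono fun i _ => hle i
  · intro j; rw [hs j]; exact le_sup_right
  · intro j
    apply le_antisymm (iSup₂_mono fun i _ => hle i)
    have key : ∀ j, M j ≤ ⨆ i, ⨆ (_ : i ≤ j), C i := by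
      intro j
      induction j using WellFoundedLT.induction with
      | ind j ih =>
        refine (le_sup_right.trans (hs j).ge).trans (sup_le ?_ ?_)
        · refine iSup₂_le fun i hi => (ih i hi).trans ?_
          exact iSup₂_le fun k hk => le_iSup₂_of_le k (hk.trans hi.le) le_rfl
        · exact le_iSup₂_of_le j le_rfl le_rfl
    refine iSup₂_le fun i hi => (key i).trans ?_
    exact iSup₂_le fun k hk => le_iSup₂_of_le k (hk.trans hi) le_rfl

theorem free_iSup_chain {J : Type*} [LinearOrder J] [WellFoundedLT J] (M : J → Submodule ℤ A)
    (h : ∀ j, RelFree (⨆ i, ⨆ (_ : i < j), M i) (M j)) :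
    Module.Free ℤ (⨆ j, M j : Submodule ℤ A) := by
  obtain ⟨C, h1, h2, h3, -, -, h4⟩ := exists_compl_chain M h
  have : ⨆ j, M j = ⨆ j, C j := by
    apply le_antisymm
    · refine iSup_le fun j => ?_
      have : M j ≤ ⨆ i, ⨆ (_ : i ≤ j), M i := le_iSup₂_of_le j le_rfl le_rfl
      rw [← h4] at this
      exact this.trans (iSup₂_le fun i _ => le_iSup C i)
    · exact iSup_mono h1
  rw [this]
  exact free_iSup_of_iSupIndep h3 h2

/-- Subgroups of free abelian groups are free. -/
theorem free_submodule [Module.Free ℤ A] (S : Submodule ℤ A) : Module.Free ℤ S := by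
  classical
  let b := Module.Free.chooseBasis ℤ A
  let ι := Module.Free.ChooseBasisIndex ℤ A
  let _ : LinearOrder ι := IsWellOrder.linearOrder WellOrderingRel
  have : WellFoundedLT ι := ⟨WellOrderingRel.isWellOrder.wf⟩
  let P : Set ι → Submodule ℤ A := fun s => S ⊓ (Finsupp.supported ℤ ℤ s).comap b.repr.toLinearMap
  have hP : ∀ s x, x ∈ P s ↔ x ∈ S ∧ ∀ i ∉ s, b.repr x i = 0 := by
    intro s x
    simp only [P, Submodule.mem_inf, Submodule.mem_comap, Finsupp.mem_supported']
    rfl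
  have hlt : ∀ j, (⨆ i, ⨆ (_ : i < j), P (Set.Iic i)) = P (Set.Iio j) ∨
      ∀ x ∈ P (Set.Iio j), x = 0 := by
    intro j
    by_cases hj : ∃ i, i < j
    swap
    · right
      intro x hx
      apply b.repr.injective
      ext i
      simpa using ((hP _ _).1 hx).2 i (fun hi => hj ⟨i, hi⟩)
    left
    apply le_antisymm
    · refine iSup₂_le fun i hi x hx => ?_
      rw [hP] at hx ⊢
      exact ⟨hx.1, fun k hk => hx.2 k (fun h => hk (lt_of_le_of_lt h hi))⟩
    · intro x hx
      obtain ⟨i0, hi0⟩ := hj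
      have hx' := (hP _ _).1 hx
      have : ∃ i < j, ∀ k ∈ (b.repr x).support, k ≤ i := by
        by_cases hn : (b.repr x).support.Nonempty
        · refine ⟨Finset.max' _ hn, ?_, fun k hk => Finset.le_max' _ k hk⟩
          by_contra hc
          exact (Finsupp.mem_support_iff.1 (Finset.max'_mem _ hn)) (hx'.2 _ hc)
        · rw [Finset.not_nonempty_iff_eq_empty] at hn
          exact ⟨i0, hi0, by simp [hn]⟩
      obtain ⟨i, hi, hk⟩ := this
      refine (le_iSup₂_of_le (f := fun i (_ : i < j) => P (Set.Iic i)) i hi le_rfl) ?_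
      rw [hP]
      refine ⟨hx'.1, fun k hk' => ?_⟩
      by_contra hc
      exact hk' (hk k (Finsupp.mem_support_iff.2 hc))
  have htop : S = ⨆ j, P (Set.Iic j) := by
    apply le_antisymm
    · intro x hx
      by_cases hn : (b.repr x).support.Nonempty
      · refine le_iSup (fun j => P (Set.Iic j)) (Finset.max' _ hn) ?_
        rw [hP]
        refine ⟨hx, fun k hk => ?_⟩
        by_contra hc
        exact hk (Finset.le_max' _ k (Finsupp.mem_support_iff.2 hc))
      · rw [Finset.not_nonempty_iff_eq_empty, Finsupp.support_eq_empty] at hn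
        have : x = 0 := b.repr.injective (by simpa using hn)
        rw [this]; exact zero_mem _
    · exact iSup_le fun j => inf_le_left
  rw [htop]
  refine free_iSup_chain _ fun j => ?_
  refine relFree_of_hom (P := ℤ) ((b.coord j) ∘ₗ (P (Set.Iic j)).subtype) inferInstance ?_
  intro x
  have hx := (hP _ _).1 x.2
  have h1 : (x : A) ∈ P (Set.Iio j) ↔ b.repr x j = 0 := by
    rw [hP]
    constructor
    · intro h; exact h.2 j (by simp)
    · intro h
      refine ⟨hx.1, fun i hi => ?_⟩
      rcases eq_or_ne i j with rfl | hne
      · exact h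
      · exact hx.2 i (fun h' => hi (lt_of_le_of_ne h' hne))
  have h2 : ((b.coord j) ∘ₗ (P (Set.Iic j)).subtype) x = b.repr x j := rfl
  rw [h2, ← h1]
  rcases hlt j with h | h
  · rw [h]
  · constructor
    · intro hx; rw [h _ hx]; exact zero_mem _
    · have : (⨆ i, ⨆ (_ : i < j), P (Set.Iic i)) ≤ P (Set.Iio j) := by
        refine iSup₂_le fun i hi x hx => ?_
        rw [hP] at hx ⊢
        exact ⟨hx.1, fun k hk => hx.2 k (fun h => hk (lt_of_le_of_lt h hi))⟩
      intro hx; exact this hx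

theorem free_of_le {N M : Submodule ℤ A} (h : N ≤ M) (hM : Module.Free ℤ M) :
    Module.Free ℤ N := by
  have := hM
  have := free_submodule (N.comap M.subtype)
  exact Module.Free.of_equiv (Submodule.comapSubtypeEquivOfLe h)

theorem free_of_injective {P : Type*} [AddCommGroup P] [Module.Free ℤ P] (f : A →ₗ[ℤ] P)
    (hf : Function.Injective f) : Module.Free ℤ A :=
  haveI := free_submodule (LinearMap.range f)
  Module.Free.of_equiv (LinearEquiv.ofInjective f hf).symm

theorem RelFree.mono {N M M' : Submodule ℤ A} (h : RelFree N M) (hM : M' ≤ N ⊔ M) :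
    RelFree N M' := by
  unfold RelFree at *
  refine free_of_le ?_ h
  have := Submodule.map_mono (f := N.mkQ) hM
  simpa [Submodule.map_sup] using this

theorem relFree_of_hom_free {P : Type*} [AddCommGroup P] [Module.Free ℤ P] {N M : Submodule ℤ A}
    (f : M →ₗ[ℤ] P) (h : ∀ x : M, f x = 0 ↔ (x : A) ∈ N) : RelFree N M :=
  relFree_of_hom f (free_submodule _) h

theorem RelFree.trans {N M P : Submodule ℤ A} (h1 : RelFree N M) (h2 : RelFree (N ⊔ M) P) :
    RelFree N (M ⊔ P) := by
  obtain ⟨C, -, hC1, hC2, hC3⟩ := h1.exists_compl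
  obtain ⟨D, -, hD1, hD2, hD3⟩ := h2.exists_compl
  have hCD : Disjoint C D := hD2.mono_left (le_sup_right.trans hC3.le)
  refine relFree_of_compl (C := C ⊔ D) ?_ ?_ ?_
  · have : Module.Free ℤ (C × D) := inferInstance
    have e : LinearMap.range (C.subtype.coprod D.subtype) = C ⊔ D := by
      rw [LinearMap.range_coprod]; simp
    rw [← e]
    refine Module.Free.of_equiv (LinearEquiv.ofInjective (C.subtype.coprod D.subtype) ?_)
    rw [← LinearMap.ker_eq_bot, LinearMap.ker_coprod_of_disjoint_range]
    · simp
    · simpa using hCD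
  · rw [← hC3] at hD2
    rw [sup_comm C D]
    exact (hC2.symm.disjoint_sup_left_of_disjoint_sup_right (by
      simpa [sup_comm] using hD2.symm)).symm
  · rw [← sup_assoc, hC3, hD3, sup_assoc]

/-- Chains of relatively free submodules over a base. -/
theorem relFree_iSup_chain {J : Type*} [LinearOrder J] [WellFoundedLT J] (N : Submodule ℤ A)
    (M : J → Submodule ℤ A) (h : ∀ j, RelFree (N ⊔ ⨆ i, ⨆ (_ : i < j), M i) (M j)) :
    RelFree N (⨆ j, M j) := by
  unfold RelFree
  rw [Submodule.map_iSup]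
  refine free_iSup_chain _ fun j => ?_
  have e : (⨆ i, ⨆ (_ : i < j), (M i).map N.mkQ) = (⨆ i, ⨆ (_ : i < j), M i).map N.mkQ := by
    simp only [Submodule.map_iSup]
  obtain ⟨C, -, hC, hd, hs⟩ := (h j).exists_compl
  rw [e]
  refine relFree_of_compl (C := C.map N.mkQ) ?_ ?_ ?_
  · have : Function.Injective (N.mkQ ∘ₗ C.subtype) := by
      rw [← LinearMap.ker_eq_bot, LinearMap.ker_eq_bot']
      intro x hx
      have : (x : A) ∈ N := by simpa using hx
      exact Subtype.ext (Submodule.disjoint_def.1 hd x (Submodule.mem_sup_left this) x.2)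
    have e2 : LinearMap.range (N.mkQ ∘ₗ C.subtype) = C.map N.mkQ := by
      rw [LinearMap.range_comp, Submodule.range_subtype]
    rw [← e2]
    exact Module.Free.of_equiv (LinearEquiv.ofInjective _ this)
  · rw [Submodule.disjoint_def]
    rintro _ ⟨x, hx, hx'⟩ ⟨y, hy, rfl⟩
    have h1 : x - y ∈ N := by
      rw [Submodule.mkQ_apply, Submodule.mkQ_apply] at hx'
      exact (Submodule.Quotient.eq N).1 hx'
    have : y ∈ N ⊔ ⨆ i, ⨆ (_ : i < j), M i := by
      have : y = -(x - y) + x := by abel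
      rw [this]
      exact Submodule.add_mem_sup (neg_mem h1) hx
    rw [Submodule.disjoint_def.1 hd y this hy]; simp
  · have := congrArg (Submodule.map N.mkQ) hs
    simpa [Submodule.map_sup] using this


end RelFree

section Whitehead

theorem IsWhitehead.exists_extension {G F : Type u} [AddCommGroup G] [AddCommGroup F]
    (hG : IsWhitehead G) (π : F →ₗ[ℤ] G) (hπ : Function.Surjective π)
    (φ : LinearMap.ker π →ₗ[ℤ] ℤ) : ∃ ψ : F →ₗ[ℤ] ℤ, ∀ x : LinearMap.ker π, ψ x = φ x := by
  let R : Submodule ℤ (F × ULift.{u} ℤ) := LinearMap.range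
    ((LinearMap.ker π).subtype.prod (-(ULift.moduleEquiv.symm.toLinearMap ∘ₗ φ)))
  let p0 : (F × ULift.{u} ℤ) →ₗ[ℤ] G := π ∘ₗ LinearMap.fst ℤ F (ULift.{u} ℤ)
  let p : (F × ULift.{u} ℤ) ⧸ R →ₗ[ℤ] G := R.liftQ p0 (by
    rintro _ ⟨k, rfl⟩
    simp [p0])
  have hp : ∀ x z, p (R.mkQ (x, z)) = π x := fun x z => rfl
  have hsurj : Function.Surjective p := by
    intro g
    obtain ⟨x, rfl⟩ := hπ g
    exact ⟨R.mkQ (x, 0), hp _ _⟩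
  let j0 : ℤ →ₗ[ℤ] (F × ULift.{u} ℤ) ⧸ R :=
    R.mkQ ∘ₗ LinearMap.inr ℤ F (ULift.{u} ℤ) ∘ₗ ULift.moduleEquiv.symm.toLinearMap
  have hj0 : ∀ z, j0 z = R.mkQ (0, ULift.up z) := fun z => rfl
  have hmem : ∀ x z, (x, ULift.up z) ∈ R ↔ ∃ h : x ∈ LinearMap.ker π, φ ⟨x, h⟩ = -z := by
    intro x z
    constructor
    · rintro ⟨k, hk⟩
      have h1 : (k : F) = x := congrArg Prod.fst hk
      have h2 := congrArg Prod.snd hk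
      subst h1
      refine ⟨k.2, ?_⟩
      have := congrArg ULift.down h2
      simp at this
      simp [← this]
    · rintro ⟨h, hz⟩
      refine ⟨⟨x, h⟩, ?_⟩
      refine Prod.ext rfl ?_
      apply ULift.ext
      simp [hz]
  have hj0inj : Function.Injective j0 := by
    rw [← LinearMap.ker_eq_bot, LinearMap.ker_eq_bot']
    intro z hz
    rw [hj0, Submodule.mkQ_apply, Submodule.Quotient.mk_eq_zero, hmem] at hz
    obtain ⟨h, hz⟩ := hz
    have : (⟨0, h⟩ : LinearMap.ker π) = 0 := rfl
    rw [this, map_zero] at hz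
    omega
  have hker : ∀ y, p y = 0 ↔ y ∈ LinearMap.range j0 := by
    intro y
    obtain ⟨⟨x, z⟩, rfl⟩ := R.mkQ_surjective y
    rw [hp]
    constructor
    · intro hx
      refine ⟨φ ⟨x, hx⟩ + z.down, ?_⟩
      rw [hj0, ← sub_eq_zero, ← map_sub, Submodule.mkQ_apply, Submodule.Quotient.mk_eq_zero]
      have e : ((0 : F), ULift.up (φ ⟨x, hx⟩ + z.down)) - (x, z)
          = -(x, ULift.up (-φ ⟨x, hx⟩)) := by
        apply Prod.ext
        · simp
        · apply ULift.ext; simp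
      rw [e]
      exact neg_mem ((hmem _ _).2 ⟨hx, by simp⟩)
    · rintro ⟨w, hw⟩
      have := congrArg p hw
      rw [hj0, hp, hp] at this
      simpa using this.symm
  let ej : ℤ ≃ₗ[ℤ] LinearMap.range j0 := LinearEquiv.ofInjective j0 hj0inj
  have hek : Nonempty ((p.toAddMonoidHom).ker ≃+ ℤ) := by
    refine ⟨(AddEquiv.trans ?_ ej.symm.toAddEquiv)⟩
    exact
      { toFun := fun y => ⟨y.1, (hker _).1 y.2⟩
        invFun := fun y => ⟨y.1, (hker _).2 y.2⟩
        left_inv := fun _ => rfl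
        right_inv := fun _ => rfl
        map_add' := fun _ _ => rfl }
  obtain ⟨s, hs⟩ := hG _ p.toAddMonoidHom hsurj hek
  have hs' : ∀ g, p (s g) = g := fun g => DFunLike.congr_fun hs g
  let r0 : (F × ULift.{u} ℤ) ⧸ R →ₗ[ℤ] LinearMap.range j0 :=
    LinearMap.codRestrict _ (LinearMap.id - s.toIntLinearMap ∘ₗ p) (by
      intro c
      rw [← hker]
      simp [hs'])
  have hr0 : ∀ c, ((r0 c : _) : (F × ULift.{u} ℤ) ⧸ R) = c - s (p c) := fun c => rfl
  refine ⟨ej.symm.toLinearMap ∘ₗ r0 ∘ₗ R.mkQ ∘ₗ LinearMap.inl ℤ F (ULift.{u} ℤ), ?_⟩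
  intro x
  have h1 : R.mkQ ((x : F), (0 : ULift.{u} ℤ)) = j0 (φ x) := by
    rw [hj0, ← sub_eq_zero, ← map_sub, Submodule.mkQ_apply, Submodule.Quotient.mk_eq_zero]
    have e : (((x : F), (0 : ULift.{u} ℤ)) - ((0 : F), ULift.up (φ x)) : F × ULift.{u} ℤ)
        = ((x : F), ULift.up (- φ x)) := by
      apply Prod.ext
      · simp
      · apply ULift.ext; simp
    rw [e]
    exact (hmem _ _).2 ⟨x.2, by simp⟩
  have h2 : r0 (R.mkQ ((x : F), (0 : ULift.{u} ℤ))) = ej (φ x) := by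
    apply Subtype.ext
    rw [hr0, hp, LinearMap.mem_ker.1 x.2, map_zero, sub_zero, h1]
    rfl
  change ej.symm (r0 (R.mkQ ((x : F), (0 : ULift.{u} ℤ)))) = φ x
  rw [h2, LinearEquiv.symm_apply_apply]

theorem isWhitehead_of_extension {G F : Type u} [AddCommGroup G] [AddCommGroup F]
    [Module.Free ℤ F] (π : F →ₗ[ℤ] G) (hπ : Function.Surjective π)
    (h : ∀ φ : LinearMap.ker π →ₗ[ℤ] ℤ, ∃ ψ : F →ₗ[ℤ] ℤ, ∀ x : LinearMap.ker π, ψ x = φ x) :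
    IsWhitehead G := by
  intro H _ p hp ⟨e⟩
  obtain ⟨l, hl⟩ := Module.projective_lifting_property p.toIntLinearMap π hp
  have hl' : ∀ x, p (l x) = π x := fun x => LinearMap.congr_fun hl x
  let φ : LinearMap.ker π →ₗ[ℤ] ℤ := (e.toAddMonoidHom.comp
    (AddMonoidHom.codRestrict (l.toAddMonoidHom.comp (LinearMap.ker π).subtype.toAddMonoidHom)
      p.ker (fun x => by
        have := x.2
        change p (l x) = 0
        rw [hl']; exact this))).toIntLinearMap
  have hφ : ∀ x (hx : l x ∈ p.ker) (hx' : x ∈ LinearMap.ker π), φ ⟨x, hx'⟩ = e ⟨l x, hx⟩ :=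
    fun x hx hx' => rfl
  obtain ⟨ψ, hψ⟩ := h φ
  let m : F →ₗ[ℤ] H := l - (p.ker.subtype.comp (e.symm.toAddMonoidHom)).toIntLinearMap ∘ₗ ψ
  have hm : ∀ x, m x = l x - (e.symm (ψ x) : H) := fun x => rfl
  have hk : LinearMap.ker π ≤ LinearMap.ker m := by
    intro x hx
    have hx' : l x ∈ p.ker := by
      change p (l x) = 0
      rw [hl']; exact hx
    rw [LinearMap.mem_ker, hm, hψ ⟨x, hx⟩, hφ x hx' hx, AddEquiv.symm_apply_apply, sub_self]
  let s : G →ₗ[ℤ] H := (LinearMap.ker π).liftQ m hk ∘ₗ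
    (π.quotKerEquivOfSurjective hπ).symm.toLinearMap
  have hs : ∀ x, s (π x) = m x := by
    intro x
    have : (π.quotKerEquivOfSurjective hπ).symm (π x) = (LinearMap.ker π).mkQ x := by
      rw [LinearEquiv.symm_apply_eq]; rfl
    change (LinearMap.ker π).liftQ m hk ((π.quotKerEquivOfSurjective hπ).symm (π x)) = m x
    rw [this]; rfl
  refine ⟨s.toAddMonoidHom, ?_⟩
  ext g
  obtain ⟨x, rfl⟩ := hπ g
  change p (s (π x)) = π x
  rw [hs, hm, map_sub, hl']
  have : p (e.symm (ψ x) : H) = 0 := (e.symm (ψ x)).2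
  rw [this, sub_zero]

theorem IsWhitehead.of_injective {G N : Type u} [AddCommGroup G] [AddCommGroup N]
    (hG : IsWhitehead G) (f : N →ₗ[ℤ] G) (hf : Function.Injective f) : IsWhitehead N := by
  let π : (G →₀ ℤ) →ₗ[ℤ] G := Finsupp.linearCombination ℤ id
  have hπ : Function.Surjective π := fun g => ⟨Finsupp.single g 1, by simp [π]⟩
  let P : Submodule ℤ (G →₀ ℤ) := (LinearMap.range f).comap π
  have : Module.Free ℤ P := free_submodule P
  let q : P →ₗ[ℤ] N := (LinearEquiv.ofInjective f hf).symm.toLinearMap ∘ₗ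
    (LinearMap.codRestrict (LinearMap.range f) (π ∘ₗ P.subtype) (fun x => x.2))
  have hq : ∀ x, f (q x) = π x := by
    intro x
    have := (LinearEquiv.ofInjective f hf).apply_symm_apply
      (LinearMap.codRestrict (LinearMap.range f) (π ∘ₗ P.subtype) (fun x => x.2) x)
    exact congrArg Subtype.val this
  refine isWhitehead_of_extension q ?_ ?_
  · intro n
    obtain ⟨x, hx⟩ := hπ (f n)
    refine ⟨⟨x, ?_⟩, ?_⟩
    · change π x ∈ LinearMap.range f
      rw [hx]; exact ⟨n, rfl⟩
    · apply hf; rw [hq]; exact hx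
  · intro φ
    have hmem : ∀ x : LinearMap.ker π, ∃ h : (x : G →₀ ℤ) ∈ P, (⟨x, h⟩ : P) ∈ LinearMap.ker q := by
      intro x
      have h0 : π x = 0 := x.2
      have h1 : (x : G →₀ ℤ) ∈ P := by
        change π x ∈ LinearMap.range f
        rw [h0]; exact zero_mem _
      refine ⟨h1, ?_⟩
      rw [LinearMap.mem_ker]
      apply hf
      rw [hq, map_zero]; exact h0
    let i : LinearMap.ker π →ₗ[ℤ] LinearMap.ker q :=
      { toFun := fun x => ⟨⟨x, (hmem x).1⟩, (hmem x).2⟩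
        map_add' := fun _ _ => rfl
        map_smul' := fun _ _ => rfl }
    obtain ⟨ψ, hψ⟩ := hG.exists_extension π hπ (φ ∘ₗ i)
    refine ⟨ψ ∘ₗ P.subtype, fun x => ?_⟩
    have hx : (x : P).1 ∈ LinearMap.ker π := by
      rw [LinearMap.mem_ker, ← hq, LinearMap.mem_ker.1 x.2, map_zero]
    exact hψ ⟨(x : P).1, hx⟩

theorem mk_span_le {A : Type u} [AddCommGroup A] (s : Set A) :
    #(Submodule.span ℤ s) ≤ max #s ℵ₀ := by
  have : #(Submodule.span ℤ s) ≤ #(s →₀ ℤ) := by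
    have h : Submodule.span ℤ s = LinearMap.range (Finsupp.linearCombination ℤ ((↑) : s → A)) := by
      rw [Finsupp.range_linearCombination]; simp
    rw [h]
    exact mk_le_of_surjective (LinearMap.surjective_rangeRestrict _)
  refine this.trans ?_
  rcases isEmpty_or_nonempty s with h | h
  · exact (le_max_of_le_right (mk_le_aleph0))
  · rw [mk_finsupp_lift_of_infinite']
    simp

theorem isWhitehead_of_kappaFree {κ : Cardinal.{u}} (hκ : ℵ₀ < κ)
    (hall : ∀ (G : Type u) (inst : AddCommGroup G),
      Cardinal.mk G = κ → @IsKappaFree κ G inst → @IsWhitehead G inst)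
    (D : Type u) [AddCommGroup D] (hD : #D ≤ κ) (hfree : IsKappaFree κ D) : IsWhitehead D := by
  obtain ⟨X, rfl⟩ : ∃ X : Type u, #X = κ := ⟨_, mk_out κ⟩
  have hinf : Infinite X := infinite_iff.2 hκ.le
  have h1 : #(D × (X →₀ ℤ)) = #X := by
    rw [mk_prod, lift_id, lift_id]
    have : #(X →₀ ℤ) = #X := by
      rw [mk_finsupp_lift_of_infinite]; simp [hκ.le]
    rw [this]
    exact mul_eq_right hκ.le hD (mk_ne_zero D)
  have h2 : IsKappaFree #X (D × (X →₀ ℤ)) := by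
    intro H hH
    let H' : Submodule ℤ (D × (X →₀ ℤ)) := AddSubgroup.toIntSubmodule H
    let H1 : Submodule ℤ D := H'.map (LinearMap.fst ℤ D (X →₀ ℤ))
    have hc : #H1 < #X := lt_of_le_of_lt
      (mk_le_of_surjective ((LinearMap.fst ℤ D (X →₀ ℤ)).submoduleMap_surjective H')) hH
    have hf1 : Module.Free ℤ H1 := hfree H1.toAddSubgroup hc
    let f : H' →ₗ[ℤ] H1 × (X →₀ ℤ) :=
      ((LinearMap.fst ℤ D (X →₀ ℤ)).submoduleMap H').prod
        (LinearMap.snd ℤ D (X →₀ ℤ) ∘ₗ H'.subtype)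
    have hf : Function.Injective f := by
      intro x y hxy
      have h1 := congrArg Prod.fst hxy
      have h2 := congrArg Prod.snd hxy
      apply Subtype.ext
      apply Prod.ext
      · exact congrArg Subtype.val h1
      · exact h2
    exact free_of_injective f hf
  exact (hall _ _ h1 h2).of_injective (LinearMap.inl ℤ D (X →₀ ℤ)) LinearMap.inl_injective

/-- A criterion for extending homomorphisms through a quotient all of whose small subgroups are
free. -/
theorem exists_extension_of_relFree {κ : Cardinal.{u}} (hκ : ℵ₀ < κ)
    (hall : ∀ (G : Type u) (inst : AddCommGroup G),
      Cardinal.mk G = κ → @IsKappaFree κ G inst → @IsWhitehead G inst)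
    {F : Type u} [AddCommGroup F] (hF : #F ≤ κ) (K : Submodule ℤ F)
    (h : ∀ P : Submodule ℤ F, #P < κ → RelFree K P) (φ : K →ₗ[ℤ] ℤ) :
    ∃ ψ : F →ₗ[ℤ] ℤ, ∀ x : K, ψ x = φ x := by
  have hW : IsWhitehead (F ⧸ K) := by
    refine isWhitehead_of_kappaFree hκ hall _ ((mk_le_of_surjective K.mkQ_surjective).trans hF) ?_
    intro H hH
    let H' : Submodule ℤ (F ⧸ K) := AddSubgroup.toIntSubmodule H
    let s : Set F := Set.range (fun y : H' => Function.surjInv K.mkQ_surjective (y : F ⧸ K))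
    have hs : #(Submodule.span ℤ s) < κ :=
      lt_of_le_of_lt (mk_span_le s) (max_lt (lt_of_le_of_lt mk_range_le hH) hκ)
    have := h _ hs
    unfold RelFree at this
    refine free_of_le (N := H') ?_ this
    intro y hy
    exact ⟨_, Submodule.subset_span ⟨⟨y, hy⟩, rfl⟩, Function.surjInv_eq K.mkQ_surjective y⟩
  let e : LinearMap.ker K.mkQ ≃ₗ[ℤ] K := LinearEquiv.ofEq _ _ K.ker_mkQ
  obtain ⟨ψ, hψ⟩ := hW.exists_extension K.mkQ K.mkQ_surjective (φ ∘ₗ e.toLinearMap)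
  refine ⟨ψ, fun x => ?_⟩
  have hx : (x : F) ∈ LinearMap.ker K.mkQ := by rw [K.ker_mkQ]; exact x.2
  exact hψ ⟨x, hx⟩

end Whitehead

section Stein

theorem finite_of_countable_character {Q : Type*} [AddCommGroup Q] [Countable Q]
    (h : Countable (CharacterModule Q)) : Module.Finite ℤ Q := by
  classical
  by_contra hfin
  obtain ⟨q, hq⟩ := exists_surjective_nat Q
  obtain ⟨χ, hχ⟩ := exists_surjective_nat (CharacterModule Q)
  have step : ∀ (n : ℕ) (s : {P : Submodule ℤ Q // P.FG} × CharacterModule Q),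
      ∃ t : {P : Submodule ℤ Q // P.FG} × CharacterModule Q,
        s.1.1 ≤ t.1.1 ∧ q n ∈ t.1.1 ∧ (∀ x ∈ s.1.1, t.2 x = s.2 x) ∧
        ∃ r ∈ t.1.1, t.2 r ≠ χ n r := by
    rintro n ⟨⟨P, hP⟩, c⟩
    have hne : P ≠ ⊤ := by
      rintro rfl; exact hfin ⟨hP⟩
    obtain ⟨r, hr⟩ : ∃ r, r ∉ P := by
      by_contra hc; push Not at hc; exact hne (eq_top_iff.2 fun x _ => hc x)
    have hr' : P.mkQ r ≠ 0 := by
      rwa [Submodule.mkQ_apply, Ne, Submodule.Quotient.mk_eq_zero]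
    obtain ⟨d, hd⟩ := CharacterModule.exists_character_apply_ne_zero_of_ne_zero hr'
    let d' : CharacterModule Q := CharacterModule.dual P.mkQ d
    have hd' : ∀ x, d' x = d (P.mkQ x) := fun x => rfl
    have hadd : ∀ x, (c + d') x = c x + d' x := fun x => rfl
    have hP' : (P ⊔ Submodule.span ℤ {r, q n}).FG :=
      hP.sup (Submodule.fg_span (by simp))
    have hrmem : r ∈ P ⊔ Submodule.span ℤ {r, q n} :=
      Submodule.mem_sup_right (Submodule.subset_span (by simp))
    have hqmem : q n ∈ P ⊔ Submodule.span ℤ {r, q n} :=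
      Submodule.mem_sup_right (Submodule.subset_span (by simp))
    by_cases hc : c r = χ n r
    · refine ⟨⟨⟨_, hP'⟩, c + d'⟩, le_sup_left, hqmem, fun x hx => ?_, r, hrmem, ?_⟩
      · have : P.mkQ x = 0 := by simpa using hx
        rw [hadd, hd', this, map_zero, add_zero]
      · rw [hadd, hd', hc]; simpa using hd
    · exact ⟨⟨⟨_, hP'⟩, c⟩, le_sup_left, hqmem, fun x hx => rfl, r, hrmem, hc⟩
  choose g hg1 hg2 hg3 hg4 using step
  let s : ℕ → {P : Submodule ℤ Q // P.FG} × CharacterModule Q :=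
    fun n => Nat.rec ⟨⟨⊥, Submodule.fg_bot⟩, 0⟩ (fun n s => g n s) n
  have hs : ∀ n, s (n + 1) = g n (s n) := fun n => rfl
  have hmono : Monotone (fun n => (s n).1.1) := monotone_nat_of_le_succ fun n => hg1 n (s n)
  have hstab : ∀ n m, n ≤ m → ∀ x ∈ (s n).1.1, (s m).2 x = (s n).2 x := by
    intro n m hnm
    induction m, hnm using Nat.le_induction with
    | base => intro x _; rfl
    | succ m hm ih =>
      intro x hx
      rw [← ih x hx]
      exact hg3 m (s m) x (hmono hm hx)
  have hex : ∀ x, ∃ n, x ∈ (s n).1.1 := by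
    intro x
    obtain ⟨n, rfl⟩ := hq x
    exact ⟨n + 1, hg2 n (s n)⟩
  choose N hN using hex
  let c : CharacterModule Q := AddMonoidHom.mk' (fun x => (s (N x)).2 x) (by
    intro x y
    let M := max (N (x + y)) (max (N x) (N y))
    have hx := hstab _ M ((le_max_left _ _).trans (le_max_right _ _)) x (hN x)
    have hy := hstab _ M ((le_max_right _ _).trans (le_max_right _ _)) y (hN y)
    have hxy := hstab _ M (le_max_left _ _) (x + y) (hN (x + y))
    change (s (N (x + y))).2 (x + y) = (s (N x)).2 x + (s (N y)).2 y
    rw [← hx, ← hy, ← hxy, map_add])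
  have hc : ∀ n x, x ∈ (s n).1.1 → c x = (s n).2 x := by
    intro n x hx
    change (s (N x)).2 x = _
    rcases le_total n (N x) with h | h
    · exact hstab _ _ h x hx
    · exact (hstab _ _ h x (hN x)).symm
  obtain ⟨n, hn⟩ := hχ c
  obtain ⟨r, hr, hr'⟩ := hg4 n (s n)
  apply hr'
  rw [hn, hc (n + 1) r hr]

theorem IsWhitehead.exists_lift_rat {G : Type u} [AddCommGroup G] (hG : IsWhitehead G)
    (χ : CharacterModule G) : ∃ f : G →ₗ[ℤ] ℚ, ∀ x, ((f x : ℚ) : AddCircle (1 : ℚ)) = χ x := by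
  let π : (G →₀ ℤ) →ₗ[ℤ] G := Finsupp.linearCombination ℤ id
  have hπ : Function.Surjective π := fun g => ⟨Finsupp.single g 1, by simp [π]⟩
  let p : ℚ →ₗ[ℤ] AddCircle (1 : ℚ) :=
    (QuotientAddGroup.mk' (AddSubgroup.zmultiples (1 : ℚ))).toIntLinearMap
  have hp : Function.Surjective p := QuotientAddGroup.mk'_surjective _
  let χ' : G →ₗ[ℤ] AddCircle (1 : ℚ) := AddMonoidHom.toIntLinearMap χ
  obtain ⟨l, hl⟩ := Module.projective_lifting_property p (χ' ∘ₗ π) hp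
  have hl' : ∀ x, p (l x) = χ (π x) := fun x => LinearMap.congr_fun hl x
  have hintg : ∀ x : LinearMap.ker π, ∃ n : ℤ, (n : ℚ) = l x := by
    intro x
    have h0 : p (l x) = 0 := by rw [hl', LinearMap.mem_ker.1 x.2, map_zero]
    have h1 : l x ∈ AddSubgroup.zmultiples (1 : ℚ) := (QuotientAddGroup.eq_zero_iff _).1 h0
    obtain ⟨n, hn⟩ := h1
    exact ⟨n, by simpa using hn⟩
  choose m hm using hintg
  let φ : LinearMap.ker π →ₗ[ℤ] ℤ := (AddMonoidHom.mk' m (by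
    intro x y
    have : ((m (x + y) : ℤ) : ℚ) = ((m x + m y : ℤ) : ℚ) := by
      push_cast; rw [hm, hm, hm]; simp
    exact_mod_cast this)).toIntLinearMap
  obtain ⟨ψ, hψ⟩ := hG.exists_extension π hπ φ
  let ι : ℤ →ₗ[ℤ] ℚ := (Int.castAddHom ℚ).toIntLinearMap
  let d : (G →₀ ℤ) →ₗ[ℤ] ℚ := l - ι ∘ₗ ψ
  have hd : ∀ x, d x = l x - (ψ x : ℚ) := fun x => rfl
  have hk : LinearMap.ker π ≤ LinearMap.ker d := by
    intro x hx
    rw [LinearMap.mem_ker, hd, hψ ⟨x, hx⟩]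
    change l x - ((m ⟨x, hx⟩ : ℤ) : ℚ) = 0
    rw [hm, sub_self]
  refine ⟨(LinearMap.ker π).liftQ d hk ∘ₗ (π.quotKerEquivOfSurjective hπ).symm.toLinearMap, ?_⟩
  intro g
  obtain ⟨x, rfl⟩ := hπ g
  have : (π.quotKerEquivOfSurjective hπ).symm (π x) = (LinearMap.ker π).mkQ x := by
    rw [LinearEquiv.symm_apply_eq]; rfl
  change p ((LinearMap.ker π).liftQ d hk ((π.quotKerEquivOfSurjective hπ).symm (π x))) = _
  rw [this]
  change p (d x) = _
  rw [hd, map_sub, hl']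
  have : p (ψ x : ℚ) = 0 := (QuotientAddGroup.eq_zero_iff _).2 ⟨ψ x, by simp⟩
  rw [this, sub_zero]

/-- Elements with a nonzero multiple in `B`. -/
def pureClosure {G : Type*} [AddCommGroup G] (B : Submodule ℤ G) : Submodule ℤ G where
  carrier := {g | ∃ m : ℤ, m ≠ 0 ∧ m • g ∈ B}
  add_mem' := by
    rintro a b ⟨m, hm, ha⟩ ⟨n, hn, hb⟩
    refine ⟨m * n, mul_ne_zero hm hn, ?_⟩
    rw [smul_add]
    refine add_mem ?_ ?_
    · rw [mul_comm, mul_smul]; exact B.smul_mem _ ha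
    · rw [mul_smul]; exact B.smul_mem _ hb
  zero_mem' := ⟨1, one_ne_zero, by simp⟩
  smul_mem' := by
    rintro c x ⟨m, hm, hx⟩
    exact ⟨m, hm, by rw [smul_comm]; exact B.smul_mem _ hx⟩

theorem IsWhitehead.fg_pureClosure {G : Type u} [AddCommGroup G] [Countable G]
    (hG : IsWhitehead G) {B : Submodule ℤ G} (hB : B.FG) : (pureClosure B).FG := by
  have hA : IsWhitehead (pureClosure B) := hG.of_injective (pureClosure B).subtype
    (Submodule.injective_subtype _)
  obtain ⟨S, rfl⟩ := hB
  set A := pureClosure (Submodule.span ℤ (S : Set G)) with hAdef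
  have hle : Submodule.span ℤ (S : Set G) ≤ A := fun x hx => ⟨1, one_ne_zero, by simpa using hx⟩
  let B' : Submodule ℤ A := (Submodule.span ℤ (S : Set G)).comap A.subtype
  have hcount : Countable (CharacterModule (A ⧸ B')) := by
    choose f hf using fun χ : CharacterModule (A ⧸ B') =>
      hA.exists_lift_rat (CharacterModule.dual B'.mkQ χ)
    let Φ : CharacterModule (A ⧸ B') → (S → ℚ) :=
      fun χ s => f χ ⟨s, hle (Submodule.subset_span s.2)⟩
    refine (Function.Injective.countable (f := Φ) ?_)
    intro χ χ' h
    have h1 : ∀ x (hx : x ∈ Submodule.span ℤ (S : Set G)),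
        f χ ⟨x, hle hx⟩ = f χ' ⟨x, hle hx⟩ := by
      intro x hx
      induction hx using Submodule.span_induction with
      | mem x hx => exact congrFun h ⟨x, hx⟩
      | zero =>
        have : (⟨0, hle (zero_mem _)⟩ : A) = 0 := rfl
        rw [this, map_zero, map_zero]
      | add x y hx hy hx' hy' =>
        have : (⟨x + y, hle (add_mem hx hy)⟩ : A) = ⟨x, hle hx⟩ + ⟨y, hle hy⟩ := rfl
        rw [this, map_add, map_add, hx', hy']
      | smul a x hx hx' =>
        have : (⟨a • x, hle (Submodule.smul_mem _ a hx)⟩ : A) = a • ⟨x, hle hx⟩ := rfl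
        rw [this, map_smul, map_smul, hx']
    have h2 : ∀ a : A, f χ a = f χ' a := by
      rintro ⟨a, m, hm, ha⟩
      have h3 := h1 _ ha
      have e : ∀ hh, (⟨m • a, hh⟩ : A) = m • ⟨a, m, hm, ha⟩ := fun _ => rfl
      rw [e, map_smul, map_smul, zsmul_eq_mul, zsmul_eq_mul] at h3
      exact mul_left_cancel₀ (by exact_mod_cast hm) h3
    apply CharacterModule.ext
    intro y
    obtain ⟨a, rfl⟩ := B'.mkQ_surjective y
    have e1 := hf χ a
    have e2 := hf χ' a
    rw [h2 a, e2] at e1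
    exact e1.symm
  have : Countable (A ⧸ B') := B'.mkQ_surjective.countable
  have hfin : Module.Finite ℤ (A ⧸ B') := finite_of_countable_character hcount
  have hB' : B'.FG := by
    have : (B'.map A.subtype).FG := by
      rw [Submodule.map_comap_subtype, inf_eq_right.2 hle]
      exact Submodule.fg_span (Finset.finite_toSet S)
    exact Submodule.fg_of_fg_map_injective A.subtype (Submodule.injective_subtype _) this
  have : (⊤ : Submodule ℤ A).FG := Submodule.fg_of_fg_map_of_fg_inf_ker B'.mkQ
    (by rw [Submodule.map_top, Submodule.range_mkQ]; exact hfin.1) (by simpa using hB')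
  have h3 := this.map A.subtype
  simpa using h3

theorem IsWhitehead.eq_zero_of_smul {G : Type u} [AddCommGroup G]
    (hG : IsWhitehead G) {m : ℤ} (hm : m ≠ 0) {x : G} (hx : m • x = 0) : x = 0 := by
  have hN : IsWhitehead (Submodule.span ℤ {x}) :=
    hG.of_injective (Submodule.subtype _) (Submodule.injective_subtype _)
  have : (⟨x, Submodule.mem_span_singleton_self x⟩ : Submodule.span ℤ {x}) = 0 := by
    apply CharacterModule.eq_zero_of_character_apply
    intro c
    obtain ⟨f, hf⟩ := hN.exists_lift_rat c
    rw [← hf]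
    have h1 : m • f ⟨x, Submodule.mem_span_singleton_self x⟩ = 0 := by
      rw [← map_smul]
      have : m • (⟨x, Submodule.mem_span_singleton_self x⟩ : Submodule.span ℤ {x}) = 0 :=
        Subtype.ext hx
      rw [this, map_zero]
    have h2 : f ⟨x, Submodule.mem_span_singleton_self x⟩ = 0 := by
      rw [zsmul_eq_mul] at h1
      exact (mul_eq_zero.1 h1).resolve_left (by exact_mod_cast hm)
    rw [h2]; rfl
  exact congrArg Subtype.val this

/-- Countable Whitehead groups are free. -/
theorem IsWhitehead.free_of_countable {G : Type u} [AddCommGroup G] [Countable G]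
    (hG : IsWhitehead G) : Module.Free ℤ G := by
  obtain ⟨x, hx⟩ := exists_surjective_nat G
  let B : ℕ → Submodule ℤ G := fun n => Submodule.span ℤ (x '' Set.Iio n)
  let P : ℕ → Submodule ℤ G := fun n => pureClosure (B n)
  have hP : Monotone P := by
    rintro n m hnm g ⟨k, hk, hg⟩
    exact ⟨k, hk, Submodule.span_mono (Set.image_mono (Set.Iio_subset_Iio hnm)) hg⟩
  have hfg : ∀ n, (P n).FG := fun n => hG.fg_pureClosure
    (Submodule.fg_span ((Set.finite_Iio n).image x))
  have htop : ⨆ n, P n = ⊤ := by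
    refine eq_top_iff.2 fun g _ => ?_
    obtain ⟨n, rfl⟩ := hx g
    exact le_iSup P (n + 1) ⟨1, one_ne_zero, by
      rw [one_smul]; exact Submodule.subset_span ⟨n, by simp, rfl⟩⟩
  have hfree : Module.Free ℤ (⨆ n, P n : Submodule ℤ G) := by
    refine free_iSup_chain P fun n => ?_
    cases n with
    | zero =>
      refine relFree_of_le ?_
      rintro g ⟨m, hm, hg⟩
      have : m • g = 0 := by simpa [B] using hg
      rw [hG.eq_zero_of_smul hm this]; exact zero_mem _
    | succ n =>
      have e : (⨆ i, ⨆ (_ : i < n + 1), P i) = P n :=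
        le_antisymm (iSup₂_le fun i hi => hP (Nat.lt_succ_iff.1 hi))
          (le_iSup₂_of_le n (Nat.lt_succ_self n) le_rfl)
      rw [e]
      unfold RelFree
      have hfin : Module.Finite ℤ ((P (n + 1)).map (P n).mkQ) :=
        Module.Finite.iff_fg.2 ((hfg (n + 1)).map _)
      have htf : Module.IsTorsionFree ℤ ((P (n + 1)).map (P n).mkQ) := by
        refine Module.isTorsionFree_iff_smul_eq_zero.2 ?_
        rintro m ⟨y, hy⟩ h
        obtain ⟨g, hg, rfl⟩ := hy
        rw [or_iff_not_imp_left]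
        intro hm
        have h' : m • (P n).mkQ g = 0 := congrArg Subtype.val h
        rw [← map_smul, Submodule.mkQ_apply, Submodule.Quotient.mk_eq_zero] at h'
        obtain ⟨k, hk, hkg⟩ := h'
        apply Subtype.ext
        change (P n).mkQ g = 0
        refine (Submodule.Quotient.mk_eq_zero _).2 ⟨k * m, mul_ne_zero hk hm, ?_⟩
        rwa [mul_smul]
      exact Module.free_of_finite_type_torsion_free'
  rw [htop] at hfree
  exact Module.Free.of_equiv Submodule.topEquiv

end Stein

section Small

theorem IsWhitehead.free_of_lt {κ : Cardinal.{u}}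
    (hleast : ∀ lam : Cardinal.{u}, ℵ₀ < lam ∧ ExistsKappaFreeWhiteheadNonfree lam → κ ≤ lam) :
    ∀ (c : Cardinal.{u}) (N : Type u) [AddCommGroup N], #N = c → c < κ → IsWhitehead N →
      Module.Free ℤ N := by
  intro c
  induction c using WellFoundedLT.induction with
  | ind c ih =>
    intro N _ hc hlt hN
    by_cases hcount : #N ≤ ℵ₀
    · have : Countable N := Cardinal.mk_le_aleph0_iff.1 hcount
      exact hN.free_of_countable
    · by_contra hfree
      refine hlt.not_ge (hleast c ⟨hc ▸ not_le.1 hcount, N, inferInstance, hc, ?_, hN, hfree⟩)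
      intro H hH
      exact ih _ hH H rfl (hH.trans hlt)
        (hN.of_injective H.subtype.toIntLinearMap H.subtype_injective)

theorem exists_not_extending {κ : Cardinal.{u}}
    (hleast : ∀ lam : Cardinal.{u}, ℵ₀ < lam ∧ ExistsKappaFreeWhiteheadNonfree lam → κ ≤ lam)
    {A : Type u} [AddCommGroup A] {L H : Submodule ℤ A} (hLH : L ≤ H) (hH : Module.Free ℤ H)
    (hlt : #H < κ) (hnot : ¬ RelFree L H) :
    ∃ φ : L →ₗ[ℤ] ℤ, ∀ ψ : H →ₗ[ℤ] ℤ, ¬ ∀ x (hx : x ∈ L), ψ ⟨x, hLH hx⟩ = φ ⟨x, hx⟩ := by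
  by_contra! hcon
  apply hnot
  let π : H →ₗ[ℤ] H.map L.mkQ := L.mkQ.submoduleMap H
  have hπ : Function.Surjective π := LinearMap.submoduleMap_surjective _ _
  have hmem : ∀ x : H, x ∈ LinearMap.ker π ↔ (x : A) ∈ L := by
    intro x
    rw [LinearMap.mem_ker, ← Subtype.coe_inj]
    exact Submodule.Quotient.mk_eq_zero L
  have hW : IsWhitehead (H.map L.mkQ) := by
    refine isWhitehead_of_extension π hπ fun φ => ?_
    let j : L →ₗ[ℤ] LinearMap.ker π :=
      (Submodule.inclusion hLH).codRestrict (LinearMap.ker π) fun x => (hmem _).2 x.2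
    obtain ⟨ψ, hψ⟩ := hcon (φ ∘ₗ j)
    exact ⟨ψ, fun x => hψ _ ((hmem x).1 x.2)⟩
  exact IsWhitehead.free_of_lt hleast _ _ rfl ((Cardinal.mk_le_of_surjective hπ).trans_lt hlt) hW

end Small

section Filtration

/-- A well-order all of whose initial segments have size at most `μ` and in which sets of
size at most `μ` are bounded. -/
structure IsSuccOrderType (O : Type u) [LinearOrder O] (μ : Cardinal.{u}) : Prop where
  mk_Iio_le : ∀ a : O, #(Set.Iio a) ≤ μ
  exists_gt : ∀ s : Set O, #s ≤ μ → ∃ a, ∀ b ∈ s, b < a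

theorem isSuccOrderType_ord {μ : Cardinal.{u}} (hμ : ℵ₀ ≤ μ) :
    IsSuccOrderType (Order.succ μ).ord.ToType μ where
  mk_Iio_le a := Order.lt_succ_iff.1 ((Cardinal.mk_Iio_lt a (by simp)).trans_eq (Cardinal.mk_ord_toType _))
  exists_gt s hs := by
    have hreg : (Order.succ μ).IsRegular := Cardinal.isRegular_succ hμ
    have h : ¬ IsCofinal s := by
      intro hc
      have h1 := Order.cof_le hc
      rw [Ordinal.cof_toType, hreg.cof_ord] at h1
      exact (Order.lt_succ μ).not_ge (h1.trans hs)
    rw [IsCofinal] at h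
    push Not at h
    exact h

namespace IsSuccOrderType

variable {O : Type u} [LinearOrder O] {μ : Cardinal.{u}}

theorem exists_gt_elem (h : IsSuccOrderType O μ) (hμ : ℵ₀ ≤ μ) (a : O) : ∃ b, a < b := by
  obtain ⟨b, hb⟩ := h.exists_gt {a} (by simpa using Cardinal.one_le_aleph0.trans hμ)
  exact ⟨b, hb a rfl⟩

theorem nonempty (h : IsSuccOrderType O μ) : Nonempty O := by
  obtain ⟨b, _⟩ := h.exists_gt ∅ (by simp)
  exact ⟨b⟩

variable [WellFoundedLT O]

/-- Every function on `O` has arbitrarily large limit points closed under it. -/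
theorem exists_closed (h : IsSuccOrderType O μ) (hμ : ℵ₀ ≤ μ) (E : O → O) (a : O) :
    ∃ δ, a < δ ∧ (∀ b < δ, ∃ c < δ, b < c) ∧ ∀ b < δ, E b < δ := by
  have hstep : ∀ a : O, ∃ b, a < b ∧ ∀ c < a, E c < b := by
    intro a
    obtain ⟨b, hb⟩ := h.exists_gt (insert a (E '' Set.Iio a)) (by
      refine (Cardinal.mk_insert_le).trans ?_
      refine add_le_of_le hμ (Cardinal.mk_image_le.trans (h.mk_Iio_le a))
        (Cardinal.one_le_aleph0.trans hμ))
    exact ⟨b, hb _ (Set.mem_insert _ _),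
      fun c hc => hb _ (Set.mem_insert_of_mem _ ⟨c, hc, rfl⟩)⟩
  choose f hf1 hf2 using hstep
  let s : ℕ → O := fun n => Nat.rec a (fun _ x => f x) n
  have hs : ∀ n, s (n + 1) = f (s n) := fun _ => rfl
  obtain ⟨d, hd⟩ := h.exists_gt (Set.range s)
    ((Cardinal.mk_le_aleph0_iff.2 (Set.countable_range s).to_subtype).trans hμ)
  let P : Set O := {x | ∀ n, s n < x}
  have hP : P.Nonempty := ⟨d, fun n => hd _ ⟨n, rfl⟩⟩
  let δ := wellFounded_lt.min P hP
  have hδ : ∀ n, s n < δ := wellFounded_lt.min_mem P hP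
  have hlt : ∀ b < δ, ∃ n, b ≤ s n := by
    intro b hb
    by_contra hc
    push Not at hc
    exact wellFounded_lt.not_lt_min P hc hb
  refine ⟨δ, hδ 0, fun b hb => ?_, fun b hb => ?_⟩
  · obtain ⟨n, hn⟩ := hlt b hb
    exact ⟨s (n + 1), hδ (n + 1), hn.trans_lt (hf1 _)⟩
  · obtain ⟨n, hn⟩ := hlt b hb
    have : b < s (n + 1) := hn.trans_lt (hf1 _)
    exact (hf2 (s (n + 1)) b this).trans (hδ (n + 2))

end IsSuccOrderType

theorem mk_iSup_submodule_le {A : Type u} [AddCommGroup A] {ι : Type u} (M : ι → Submodule ℤ A)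
    {μ : Cardinal.{u}} (hμ : ℵ₀ ≤ μ) (hι : #ι ≤ μ) (hM : ∀ i, #(M i) ≤ μ) :
    #(⨆ i, M i : Submodule ℤ A) ≤ μ := by
  rw [Submodule.iSup_eq_span]
  refine (mk_span_le _).trans (max_le ?_ hμ)
  refine (Cardinal.mk_iUnion_le _).trans ?_
  exact (mul_le_mul' hι (ciSup_le' hM)).trans (Cardinal.mul_eq_self hμ).le

theorem mk_sup_submodule_le {A : Type u} [AddCommGroup A] (M N : Submodule ℤ A)
    {μ : Cardinal.{u}} (hμ : ℵ₀ ≤ μ) (hM : #M ≤ μ) (hN : #N ≤ μ) :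
    #(M ⊔ N : Submodule ℤ A) ≤ μ := by
  have : Submodule.span ℤ ((M : Set A) ∪ N) = M ⊔ N := by
    rw [Submodule.span_union, Submodule.span_eq, Submodule.span_eq]
  rw [← this]
  refine (mk_span_le _).trans (max_le ?_ hμ)
  exact (Cardinal.mk_union_le _ _).trans (add_le_of_le hμ hM hN)

theorem exists_filtration {G : Type u} [AddCommGroup G] {μ : Cardinal.{u}} (hμ : ℵ₀ ≤ μ)
    {O : Type u} [LinearOrder O] [WellFoundedLT O] (hO : ∀ a : O, #(Set.Iio a) ≤ μ) (g : O → G)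
    (X : Submodule ℤ G) (hX : #X ≤ μ) :
    ∃ N : O → Submodule ℤ G, Monotone N ∧ (∀ a, X ≤ N a) ∧ (∀ a, #(N a) ≤ μ) ∧
      (∀ b a, b < a → g b ∈ N a) ∧
      (∀ a, (∀ b < a, ∃ c < a, b < c) → N a ≤ X ⊔ ⨆ b, ⨆ (_ : b < a), N b) ∧
      ∀ a, (∀ N', N a ≤ N' → #N' ≤ μ → RelFree (N a) N') ∨ ∀ b, a < b → ¬ RelFree (N a) (N b) := by
  have hnext : ∀ N : Submodule ℤ G, ∃ N', N ≤ N' ∧ (#N ≤ μ → #N' ≤ μ) ∧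
      ((∀ N', N ≤ N' → #N' ≤ μ → RelFree N N') ∨ ¬ RelFree N N') := by
    intro N
    by_cases h : ∀ N', N ≤ N' → #N' ≤ μ → RelFree N N'
    · exact ⟨N, le_rfl, id, Or.inl h⟩
    · push Not at h
      obtain ⟨N', h1, h2, h3⟩ := h
      exact ⟨N', h1, fun _ => h2, Or.inr h3⟩
  choose next hle hcard hdich using hnext
  let N : O → Submodule ℤ G := wellFounded_lt.fix fun a N =>
    X ⊔ ⨆ b : Set.Iio a, (next (N b b.2) ⊔ Submodule.span ℤ {g b})
  have hN : ∀ a, N a = X ⊔ ⨆ b : Set.Iio a, (next (N b) ⊔ Submodule.span ℤ {g b}) :=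
    fun a => wellFounded_lt.fix_eq _ a
  have hsub : ∀ b a, b < a → next (N b) ⊔ Submodule.span ℤ {g b} ≤ N a := by
    intro b a hba
    rw [hN a]
    exact (le_iSup (fun b : Set.Iio a => next (N b) ⊔ Submodule.span ℤ {g b}) ⟨b, hba⟩).trans
      le_sup_right
  have hlt : ∀ b a, b < a → next (N b) ≤ N a := fun b a hba => le_sup_left.trans (hsub b a hba)
  refine ⟨N, ?_, ?_, ?_, ?_, ?_, ?_⟩
  · intro b a hba
    rcases hba.eq_or_lt with rfl | hba
    · exact le_rfl
    · exact (hle _).trans (hlt b a hba)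
  · intro a; rw [hN a]; exact le_sup_left
  · intro a
    induction a using WellFoundedLT.induction with
    | ind a ih =>
      rw [hN a]
      refine mk_sup_submodule_le _ _ hμ hX (mk_iSup_submodule_le _ hμ (hO a) fun b => ?_)
      refine mk_sup_submodule_le _ _ hμ (hcard _ (ih b b.2)) ?_
      exact (mk_span_le _).trans (max_le (by simpa using Cardinal.one_le_aleph0.trans hμ) hμ)
  · intro b a hba
    exact hsub b a hba (Submodule.mem_sup_right (Submodule.mem_span_singleton_self _))
  · intro a ha
    conv_lhs => rw [hN a]
    refine sup_le_sup_left (iSup_le fun b => ?_) _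
    obtain ⟨c, hc, hbc⟩ := ha b b.2
    exact (hsub b c hbc).trans (le_iSup₂_of_le c hc le_rfl)
  · intro a
    refine (hdich (N a)).imp_right fun h b hab hfree => h ?_
    exact hfree.mono ((hlt a b hab).trans le_sup_right)

end Filtration

section BasisSets

variable {A : Type*} [AddCommGroup A]

theorem exists_basis_set {M : Submodule ℤ A} (hM : Module.Free ℤ M) :
    ∃ B : Set A, LinearIndepOn ℤ id B ∧ Submodule.span ℤ B = M := by
  let b := Module.Free.chooseBasis ℤ M
  have h := b.linearIndependent.map' M.subtype (Submodule.ker_subtype M)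
  refine ⟨Set.range (M.subtype ∘ b), h.linearIndepOn_id, ?_⟩
  rw [Set.range_comp, Submodule.span_image, b.span_eq, Submodule.map_top, Submodule.range_subtype]

theorem free_span_of_linearIndepOn {B : Set A} (hB : LinearIndepOn ℤ id B) :
    Module.Free ℤ (Submodule.span ℤ B) := by
  have h := Module.Basis.span (v := fun b : B => (b : A)) hB
  have e : Set.range (fun b : B => (b : A)) = B := Subtype.range_coe
  rw [e] at h
  exact Module.Free.of_basis h

theorem LinearIndepOn.disjoint_span {B J K : Set A} (hB : LinearIndepOn ℤ id B) (hJ : J ⊆ B)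
    (hK : K ⊆ B) (hd : Disjoint J K) : Disjoint (Submodule.span ℤ J) (Submodule.span ℤ K) := by
  have h : LinearIndependent ℤ (fun b : B => (b : A)) := hB
  have := h.disjoint_span_image (hd.preimage (Subtype.val : B → A))
  rwa [Subtype.image_preimage_coe, Subtype.image_preimage_coe, Set.inter_eq_right.2 hJ,
    Set.inter_eq_right.2 hK] at this

theorem relFree_span_of_closed {B : Set A} (hB : LinearIndepOn ℤ id B) (N : Submodule ℤ A)
    (h : ∀ x ∈ N, x ∈ Submodule.span ℤ B → ∃ s ⊆ B, s ⊆ (N : Set A) ∧ x ∈ Submodule.span ℤ s) :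
    RelFree N (Submodule.span ℤ B) := by
  have hfree := free_span_of_linearIndepOn (hB.mono (Set.sdiff_subset (s := B) (t := (N : Set A))))
  refine relFree_of_compl (C := Submodule.span ℤ (B \ N)) hfree ?_ ?_
  · rw [Submodule.disjoint_def]
    intro x hx hx'
    obtain ⟨s, hs, hsN, hxs⟩ := h x hx (Submodule.span_mono Set.sdiff_subset hx')
    refine Submodule.disjoint_def.1 (hB.disjoint_span hs Set.sdiff_subset ?_) x hxs hx'
    exact Set.disjoint_left.2 fun y hy hy' => hy'.2 (hsN hy)
  · apply le_antisymm (sup_le_sup_left (Submodule.span_mono Set.sdiff_subset) _)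
    refine sup_le le_sup_left (Submodule.span_le.2 fun b hb => ?_)
    by_cases hbN : b ∈ N
    · exact Submodule.mem_sup_left hbN
    · exact Submodule.mem_sup_right (Submodule.subset_span ⟨hb, hbN⟩)

end BasisSets

section SingularCompactness

/-- Below `κ`, every small submodule lies in one over which all small extensions are free. -/
theorem exists_relFree_extensions {G : Type u} [AddCommGroup G] {κ χ : Cardinal.{u}}
    (hfree : ∀ M : Submodule ℤ G, #M < κ → Module.Free ℤ M) (hχ : ℵ₀ ≤ χ)
    (hχκ : Order.succ χ < κ) (X : Submodule ℤ G) (hX : #X ≤ χ) :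
    ∃ N, X ≤ N ∧ #N ≤ χ ∧ ∀ N', N ≤ N' → #N' ≤ χ → RelFree N N' := by
  let O := (Order.succ χ).ord.ToType
  have hO : IsSuccOrderType O χ := isSuccOrderType_ord hχ
  obtain ⟨N, hmono, hXN, hN, -, hlim, hdich⟩ := exists_filtration hχ hO.mk_Iio_le (fun _ => (0 : G))
    X hX
  by_contra! hcon
  have hbad : ∀ a b, a < b → ¬ RelFree (N a) (N b) := by
    intro a
    refine (hdich a).resolve_left fun h => ?_
    obtain ⟨N', h1, h2, h3⟩ := hcon (N a) (hXN a) (hN a)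
    exact h3 (h N' h1 h2)
  have hM : #(⨆ a, N a : Submodule ℤ G) < κ := by
    refine lt_of_le_of_lt ?_ hχκ
    refine mk_iSup_submodule_le N (hχ.trans (Order.le_succ χ)) ?_ fun a =>
      (hN a).trans (Order.le_succ χ)
    rw [Cardinal.mk_ord_toType]
  obtain ⟨B, hB, hBM⟩ := exists_basis_set (hfree _ hM)
  have hNB : ∀ a, N a ≤ Submodule.span ℤ B := fun a => hBM ▸ le_iSup N a
  have hdir : Directed (· ≤ ·) N := hmono.directed_le
  have : Nonempty O := hO.nonempty
  have hc : ∀ b : B, ∃ c, (b : G) ∈ N c := fun b =>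
    (Submodule.mem_iSup_of_directed N hdir).1 (hBM ▸ Submodule.subset_span b.2)
  choose c hc using hc
  have hs : ∀ a (x : N a), ∃ s : Finset G, (s : Set G) ⊆ B ∧ (x : G) ∈ Submodule.span ℤ (s : Set G) :=
    fun a x => Submodule.mem_span_finite_of_mem_span (hNB a x.2)
  choose s hsB hs using hs
  have hE : ∀ a, ∃ e, ∀ (x : N a) b (hb : b ∈ s a x), c ⟨b, hsB a x hb⟩ < e := by
    intro a
    obtain ⟨e, he⟩ := hO.exists_gt
      (⋃ x : N a, Set.range fun b : s a x => c ⟨b, hsB a x b.2⟩) (by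
        refine (Cardinal.mk_iUnion_le _).trans ?_
        refine (mul_le_mul' (hN a) (ciSup_le' (a := ℵ₀) fun x => ?_)).trans ?_
        · exact Cardinal.mk_le_aleph0_iff.2 (Set.countable_range _).to_subtype
        · exact (mul_le_mul' le_rfl hχ).trans (Cardinal.mul_eq_self hχ).le)
    exact ⟨e, fun x b hb => he _ (Set.mem_iUnion.2 ⟨x, ⟨b, hb⟩, rfl⟩)⟩
  choose E hE using hE
  obtain ⟨δ, hδ0, hδ1, hδ2⟩ := hO.exists_closed hχ E (Classical.arbitrary O)
  obtain ⟨b, hb⟩ := hO.exists_gt_elem hχ δ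
  have hδ : N δ ≤ ⨆ a : Set.Iio δ, N a := by
    refine (hlim δ hδ1).trans (sup_le ?_ (iSup₂_le fun a ha => ?_))
    · exact (hXN _).trans (le_iSup (fun a : Set.Iio δ => N a) ⟨_, hδ0⟩)
    · exact le_iSup (fun a : Set.Iio δ => N a) ⟨a, ha⟩
  have : Nonempty (Set.Iio δ) := ⟨⟨_, hδ0⟩⟩
  refine hbad δ b hb (RelFree.mono (relFree_span_of_closed hB (N δ) ?_)
    ((hNB b).trans le_sup_right))
  intro x hx _
  obtain ⟨⟨a, ha⟩, hxa⟩ := (Submodule.mem_iSup_of_directed (fun a : Set.Iio δ => N a)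
    (Monotone.directed_le fun a b hab => hmono hab)).1 (hδ hx)
  refine ⟨s a ⟨x, hxa⟩, hsB _ _, fun y hy => ?_, hs _ _⟩
  exact hmono ((hE a ⟨x, hxa⟩ y hy).trans (hδ2 a ha)).le (hc _)

/-- Singular compactness for abelian groups. -/
theorem free_of_singular {G : Type u} [AddCommGroup G] {κ : Cardinal.{u}} (hκ : ℵ₀ < κ)
    (hG : #G = κ) (hfree : ∀ M : Submodule ℤ G, #M < κ → Module.Free ℤ M)
    (hsing : κ.ord.cof < κ) : Module.Free ℤ G := by
  classical
  have hsucc : ∀ χ, ℵ₀ ≤ χ → χ < κ → Order.succ χ < κ := by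
    intro χ h1 h2
    refine lt_of_le_of_ne (Order.succ_le_of_lt h2) ?_
    rintro rfl
    rw [(Cardinal.isRegular_succ h1).cof_ord] at hsing
    exact hsing.false
  obtain ⟨Λ, hΛ, hΛc⟩ := Order.exists_cof_eq κ.ord.ToType
  rw [Ordinal.cof_toType] at hΛc
  have hΛκ : #Λ < κ := hΛc ▸ hsing
  let k : Λ → Cardinal.{u} := fun ν => max (max ℵ₀ #Λ) #(Set.Iio (ν : κ.ord.ToType))
  have hk0 : ∀ ν, ℵ₀ ≤ k ν := fun ν => (le_max_left _ _).trans (le_max_left _ _)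
  have hkΛ : ∀ ν, #Λ ≤ k ν := fun ν => (le_max_right _ _).trans (le_max_left _ _)
  have hkκ : ∀ ν, k ν < κ := fun ν => max_lt (max_lt hκ hΛκ)
    ((Cardinal.mk_Iio_lt _ (by simp)).trans_eq (Cardinal.mk_ord_toType _))
  have hkmono : Monotone k := fun ν ν' h =>
    max_le_max le_rfl (Cardinal.mk_le_mk_of_subset (Set.Iio_subset_Iio h))
  obtain ⟨e⟩ : Nonempty (κ.ord.ToType ≃ G) := Cardinal.eq.1 (by rw [Cardinal.mk_ord_toType, hG])
  have : NoMaxOrder κ.ord.ToType := Cardinal.noMaxOrder hκ.le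
  have hcover : ∀ g, ∃ ν : Λ, g ∈ e '' Set.Iio (ν : κ.ord.ToType) := by
    intro g
    obtain ⟨y, hy⟩ := exists_gt (e.symm g)
    obtain ⟨ν, hν, hyν⟩ := hΛ y
    exact ⟨⟨ν, hν⟩, e.symm g, hy.trans_le hyν, by simp⟩
  let P : Λ → Set G → Prop := fun ν B => LinearIndepOn ℤ id B ∧
    #(Submodule.span ℤ B) ≤ k ν ∧
    ∀ N', Submodule.span ℤ B ≤ N' → #N' ≤ k ν → RelFree (Submodule.span ℤ B) N'
  have hinit : ∀ ν, ∃ B, P ν B := by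
    intro ν
    obtain ⟨N, -, h1, h2⟩ := exists_relFree_extensions hfree (hk0 ν) (hsucc _ (hk0 ν) (hkκ ν)) ⊥
      (by simpa using Cardinal.one_le_aleph0.trans (hk0 ν))
    obtain ⟨B, hB, rfl⟩ := exists_basis_set (hfree N (h1.trans_lt (hkκ ν)))
    exact ⟨B, hB, h1, h2⟩
  have hstep : ∀ ν B, P ν B → ∀ X : Set G, #X ≤ k ν →
      ∃ B', P ν B' ∧ B ⊆ B' ∧ X ⊆ Submodule.span ℤ B' := by
    rintro ν B ⟨hB, hB1, hB2⟩ X hX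
    obtain ⟨N, hle, h1, h2⟩ := exists_relFree_extensions hfree (hk0 ν)
      (hsucc _ (hk0 ν) (hkκ ν)) (Submodule.span ℤ B ⊔ Submodule.span ℤ X)
      (mk_sup_submodule_le _ _ (hk0 ν) hB1 ((mk_span_le _).trans (max_le hX (hk0 ν))))
    obtain ⟨C, hCN, hC, hd, hs⟩ := (hB2 N (le_sup_left.trans hle) h1).exists_compl
    obtain ⟨B', hB', rfl⟩ := exists_basis_set hC
    have hspan : Submodule.span ℤ (B ∪ B') = N := by
      rw [Submodule.span_union, hs, sup_eq_right]; exact le_sup_left.trans hle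
    refine ⟨B ∪ B', ⟨hB.id_union hB' hd, ?_, ?_⟩, Set.subset_union_left, ?_⟩
    · rwa [hspan]
    · rwa [hspan]
    · rw [hspan]
      exact fun x hx => hle (Submodule.mem_sup_right (Submodule.subset_span hx))
  have hsupp : ∀ (B : Set G) (x : G), ∃ s : Finset G, (s : Set G) ⊆ B ∧
      (x ∈ Submodule.span ℤ B → x ∈ Submodule.span ℤ (s : Set G)) := by
    intro B x
    by_cases hx : x ∈ Submodule.span ℤ B
    · obtain ⟨s, h1, h2⟩ := Submodule.mem_span_finite_of_mem_span hx
      exact ⟨s, h1, fun _ => h2⟩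
    · exact ⟨∅, by simp, fun h => absurd h hx⟩
  choose supp hsupp1 hsupp2 using hsupp
  let X : (∀ ν, {B // P ν B}) → Λ → Set G := fun 𝔅 ν =>
    (e '' Set.Iio (ν : κ.ord.ToType) ∪ ⋃ ν' : Set.Iio ν, (Submodule.span ℤ (𝔅 ν').1 : Set G)) ∪
      ⋃ p : Λ × Submodule.span ℤ (𝔅 ν).1, (supp (𝔅 p.1).1 p.2 : Set G)
  have hX : ∀ 𝔅 ν, #(X 𝔅 ν) ≤ k ν := by
    intro 𝔅 ν
    refine (Cardinal.mk_union_le _ _).trans (add_le_of_le (hk0 ν)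
      ((Cardinal.mk_union_le _ _).trans (add_le_of_le (hk0 ν) ?_ ?_)) ?_)
    · exact Cardinal.mk_image_le.trans (le_max_right _ _)
    · refine (Cardinal.mk_iUnion_le _).trans ?_
      refine (mul_le_mul' ((Cardinal.mk_subtype_le _).trans (hkΛ ν))
        (ciSup_le' (a := k ν) fun ν' => ?_)).trans (Cardinal.mul_eq_self (hk0 ν)).le
      exact (𝔅 ν').2.2.1.trans (hkmono (le_of_lt ν'.2))
    · refine (Cardinal.mk_iUnion_le _).trans ?_
      rw [Cardinal.mk_prod, Cardinal.lift_id, Cardinal.lift_id]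
      refine (mul_le_mul' ((mul_le_mul' (hkΛ ν) (𝔅 ν).2.2.1).trans
        (Cardinal.mul_eq_self (hk0 ν)).le)
        (ciSup_le' (a := k ν) fun p => ?_)).trans (Cardinal.mul_eq_self (hk0 ν)).le
      exact (Cardinal.mk_le_aleph0_iff.2 (Finset.countable_toSet _).to_subtype).trans (hk0 ν)
  choose B0 hB0 using hinit
  choose nx hnx1 hnx2 hnx3 using fun (𝔅 : ∀ ν, {B // P ν B}) ν =>
    hstep ν (𝔅 ν).1 (𝔅 ν).2 (X 𝔅 ν) (hX 𝔅 ν)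
  let 𝔅 : ℕ → ∀ ν, {B // P ν B} := fun n =>
    Nat.rec (fun ν => ⟨B0 ν, hB0 ν⟩) (fun _ 𝔅 ν => ⟨nx 𝔅 ν, hnx1 𝔅 ν⟩) n
  have hmono : ∀ ν, Monotone fun n => (𝔅 n ν).1 := fun ν =>
    monotone_nat_of_le_succ fun n => hnx2 (𝔅 n) ν
  have hXn : ∀ n ν, X (𝔅 n) ν ⊆ Submodule.span ℤ (𝔅 (n + 1) ν).1 := fun n ν => hnx3 (𝔅 n) ν
  let B : Λ → Set G := fun ν => ⋃ n, (𝔅 n ν).1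
  have hB : ∀ ν, LinearIndepOn ℤ id (B ν) := fun ν =>
    linearIndepOn_iUnion_of_directed (hmono ν).directed_le fun n => (𝔅 n ν).2.1
  have hspan : ∀ ν x, x ∈ Submodule.span ℤ (B ν) → ∃ n, x ∈ Submodule.span ℤ (𝔅 n ν).1 := by
    intro ν x hx
    change x ∈ Submodule.span ℤ (⋃ n, (𝔅 n ν).1) at hx
    rw [Submodule.span_iUnion] at hx
    exact (Submodule.mem_iSup_of_directed _
      (Monotone.directed_le fun n m h => Submodule.span_mono (hmono ν h))).1 hx
  have hsub : ∀ n ν, Submodule.span ℤ (𝔅 n ν).1 ≤ Submodule.span ℤ (B ν) := fun n ν =>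
    Submodule.span_mono (Set.subset_iUnion (fun n => (𝔅 n ν).1) n)
  have hBmono : Monotone fun ν => Submodule.span ℤ (B ν) := by
    intro ν' ν h
    rcases h.eq_or_lt with rfl | h
    · exact le_rfl
    intro x hx
    obtain ⟨n, hn⟩ := hspan ν' x hx
    exact hsub (n + 1) ν (hXn n ν (Or.inl (Or.inr (Set.mem_iUnion.2 ⟨⟨ν', h⟩, hn⟩))))
  have htop : ⨆ ν, Submodule.span ℤ (B ν) = ⊤ := by
    refine eq_top_iff.2 fun g _ => ?_
    obtain ⟨ν, hν⟩ := hcover g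
    exact le_iSup (fun ν => Submodule.span ℤ (B ν)) ν
      (hsub 1 ν (hXn 0 ν (Or.inl (Or.inl hν))))
  have hfin : Module.Free ℤ (⨆ ν, Submodule.span ℤ (B ν) : Submodule ℤ G) := by
    refine free_iSup_chain _ fun ν => relFree_span_of_closed (hB ν) _ fun x hx hxν => ?_
    obtain ⟨n, hn⟩ := hspan ν x hxν
    rcases isEmpty_or_nonempty (Set.Iio ν) with he | hne
    · have h0 : (⨆ i, ⨆ (_ : i < ν), Submodule.span ℤ (B i)) = ⊥ := by
        refine le_bot_iff.1 (iSup₂_le fun i hi => (he.false ⟨i, hi⟩).elim)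
      rw [h0, Submodule.mem_bot] at hx
      exact ⟨∅, by simp, by simp, by simp [hx]⟩
    · have hx' : x ∈ ⨆ i : Set.Iio ν, Submodule.span ℤ (B i) := by
        rwa [iSup_subtype]
      obtain ⟨⟨ν', hν'⟩, hxν'⟩ := (Submodule.mem_iSup_of_directed
        (fun i : Set.Iio ν => Submodule.span ℤ (B i))
        (Monotone.directed_le fun a b h => hBmono h)).1 hx'
      obtain ⟨m, hm⟩ := hspan ν' x hxν'
      let l := max n m
      have hl : x ∈ Submodule.span ℤ (𝔅 l ν).1 :=
        Submodule.span_mono (hmono ν (le_max_left n m)) hn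
      have hl' : x ∈ Submodule.span ℤ (𝔅 l ν').1 :=
        Submodule.span_mono (hmono ν' (le_max_right n m)) hm
      refine ⟨supp (𝔅 l ν).1 x, (hsupp1 _ _).trans (Set.subset_iUnion (fun n => (𝔅 n ν).1) l), ?_,
        hsupp2 _ _ hl⟩
      intro y hy
      refine le_iSup₂_of_le (f := fun i (_ : i < ν) => Submodule.span ℤ (B i)) ν' hν' le_rfl ?_
      exact hsub (l + 1) ν' (hXn l ν' (Or.inr (Set.mem_iUnion.2 ⟨⟨ν, x, hl'⟩, hy⟩)))
  rw [htop] at hfin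
  exact Module.Free.of_equiv Submodule.topEquiv

end SingularCompactness

section GoodFiltration

/-- Points without an immediate predecessor. -/
def IsLim {O : Type*} [LinearOrder O] (a : O) : Prop :=
  ∀ b < a, ∃ c < a, b < c

theorem relFree_iff_of_hom {A P : Type*} [AddCommGroup A] [AddCommGroup P] {N M : Submodule ℤ A}
    (f : M →ₗ[ℤ] P) (h : ∀ x : M, f x = 0 ↔ (x : A) ∈ N) :
    RelFree N M ↔ Module.Free ℤ (LinearMap.range f) := by
  refine ⟨fun hf => ?_, fun hf => relFree_of_hom f hf h⟩
  let g : M →ₗ[ℤ] M.map N.mkQ := N.mkQ.submoduleMap M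
  have hg : Function.Surjective g := LinearMap.submoduleMap_surjective _ _
  have hk : LinearMap.ker f = LinearMap.ker g := by
    ext x
    rw [LinearMap.mem_ker, h, LinearMap.mem_ker, ← Subtype.coe_inj]
    exact (Submodule.Quotient.mk_eq_zero N).symm
  unfold RelFree at hf
  exact Module.Free.of_equiv ((g.quotKerEquivOfSurjective hg).symm ≪≫ₗ
    (Submodule.quotEquivOfEq _ _ hk).symm ≪≫ₗ f.quotKerEquivRange)

/-- Filtrations of a group by submodules of size at most `μ`, where `T` is the set of indices over
which all small extensions are free, and the complement of `T` is stationary. -/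
structure IsGoodFiltration {G O : Type u} [AddCommGroup G] [LinearOrder O] (μ : Cardinal.{u})
    (N : O → Submodule ℤ G) (T : Set O) : Prop where
  free : ∀ M : Submodule ℤ G, #M ≤ μ → Module.Free ℤ M
  mono : Monotone N
  card : ∀ a, #(N a) ≤ μ
  cover : ∀ g, ∃ a, g ∈ N a
  lim : ∀ a, IsLim a → N a ≤ ⨆ b, ⨆ (_ : b < a), N b
  relFree : ∀ a ∈ T, ∀ M : Submodule ℤ G, #M ≤ μ → RelFree (N a) M
  not_relFree : ∀ a ∉ T, ∀ b, a < b → ¬ RelFree (N a) (N b)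
  stationary : ∀ E : O → O, ∃ δ ∉ T, IsLim δ ∧ ∀ b < δ, E b < δ

theorem exists_succ_fun {O : Type*} [LinearOrder O] [WellFoundedLT O] (h : ∀ a : O, ∃ b, a < b) :
    ∃ s : O → O, ∀ a b, a < b ↔ s a ≤ b := by
  refine ⟨fun a => wellFounded_lt.min (Set.Ioi a) (h a), fun a b => ⟨fun hab => ?_, fun hab => ?_⟩⟩
  · exact wellFounded_lt.min_le hab
  · exact lt_of_lt_of_le (wellFounded_lt.min_mem (Set.Ioi a) (h a)) hab

theorem exists_goodFiltration {G : Type u} [AddCommGroup G] {μ : Cardinal.{u}} (hμ : ℵ₀ ≤ μ)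
    {O : Type u} [LinearOrder O] [WellFoundedLT O] (hO : IsSuccOrderType O μ)
    (g : O → G) (hg : Function.Surjective g)
    (hfree : ∀ M : Submodule ℤ G, #M ≤ μ → Module.Free ℤ M) (hG : ¬ Module.Free ℤ G) :
    ∃ N : O → Submodule ℤ G, ∃ T, IsGoodFiltration μ N T := by
  obtain ⟨N, hmono, -, hN, hgN, hlim, hdich⟩ := exists_filtration hμ hO.mk_Iio_le g ⊥
    (by simpa using Cardinal.one_le_aleph0.trans hμ)
  simp only [bot_sup_eq] at hlim
  have hT : ∀ a, (∀ b, a < b → ¬ RelFree (N a) (N b)) ∨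
      ∀ M : Submodule ℤ G, #M ≤ μ → RelFree (N a) M := by
    intro a
    refine (hdich a).symm.imp_right fun h M hM => ?_
    exact (h (N a ⊔ M) le_sup_left (mk_sup_submodule_le _ _ hμ (hN a) hM)).mono
      (le_sup_right.trans le_sup_right)
  have hcov : ∀ x, ∃ a, x ∈ N a := by
    intro x
    obtain ⟨b, rfl⟩ := hg x
    obtain ⟨a, ha⟩ := hO.exists_gt_elem hμ b
    exact ⟨a, hgN b a ha⟩
  refine ⟨N, {a | ∀ M : Submodule ℤ G, #M ≤ μ → RelFree (N a) M}, hfree, hmono, hN, hcov, hlim,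
    fun a ha => ha, fun a ha => (hT a).resolve_right ha, ?_⟩
  by_contra! hcon
  obtain ⟨E, hE⟩ := hcon
  apply hG
  let C : Set O := {δ | IsLim δ ∧ ∀ b < δ, E b < δ}
  have hCT : ∀ δ ∈ C, ∀ M : Submodule ℤ G, #M ≤ μ → RelFree (N δ) M := by
    intro δ hδ
    by_contra hc
    obtain ⟨b, h1, h2⟩ := hE δ hc hδ.1
    exact h2.not_gt (hδ.2 b h1)
  have hbot : ∀ a, (∀ b, ¬ b < a) → a ∈ C := fun a ha =>
    ⟨fun b hb => (ha b hb).elim, fun b hb => (ha b hb).elim⟩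
  have hne : ∀ a, {δ | a < δ ∧ δ ∈ C}.Nonempty := fun a => by
    obtain ⟨δ, h1, h2, h3⟩ := hO.exists_closed hμ E a
    exact ⟨δ, h1, h2, h3⟩
  let nx : O → O := fun a => wellFounded_lt.min _ (hne a)
  have hnx : ∀ a, a < nx a ∧ nx a ∈ C := fun a => wellFounded_lt.min_mem _ (hne a)
  have hmin : ∀ a δ, a < δ → δ ∈ C → nx a ≤ δ := fun a δ h1 h2 =>
    wellFounded_lt.min_le (s := {δ | a < δ ∧ δ ∈ C}) ⟨h1, h2⟩
  have key : Module.Free ℤ (⨆ a, N (nx a) : Submodule ℤ G) := by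
    refine free_iSup_chain _ fun a => ?_
    by_cases h : ∃ b < a, a < nx b
    · obtain ⟨b, hb, hab⟩ := h
      have : nx a ≤ nx b := hmin a _ hab (hnx b).2
      exact relFree_of_le ((hmono this).trans (le_iSup₂_of_le b hb le_rfl))
    · push Not at h
      have haC : a ∈ C := by
        by_cases h' : ∃ b < a, nx b = a
        · obtain ⟨b, -, rfl⟩ := h'
          exact (hnx b).2
        · push Not at h'
          have hlt : ∀ b < a, nx b < a := fun b hb => lt_of_le_of_ne (h b hb) (h' b hb)
          exact ⟨fun b hb => ⟨nx b, hlt b hb, (hnx b).1⟩,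
            fun b hb => ((hnx b).2.2 b (hnx b).1).trans (hlt b hb)⟩
      have e : (⨆ b, ⨆ (_ : b < a), N (nx b)) = N a := by
        apply le_antisymm (iSup₂_le fun b hb => hmono (h b hb))
        exact (hlim a haC.1).trans (iSup₂_mono fun b _ => hmono (hnx b).1.le)
      rw [e]
      exact hCT a haC _ (hN _)
  have htop : (⨆ a, N (nx a)) = ⊤ := by
    refine eq_top_iff.2 fun x _ => ?_
    obtain ⟨a, ha⟩ := hcov x
    exact le_iSup (fun a => N (nx a)) a (hmono (hnx a).1.le ha)
  rw [htop] at key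
  exact Module.Free.of_equiv Submodule.topEquiv

namespace IsGoodFiltration

variable {G O : Type u} [AddCommGroup G] [LinearOrder O] {μ : Cardinal.{u}}
  {N : O → Submodule ℤ G} {T : Set O}

theorem exists_mem_of_lim (h : IsGoodFiltration μ N T) {a b : O} (ha : IsLim a) (hb : b < a)
    {x : G} (hx : x ∈ N a) : ∃ c < a, x ∈ N c := by
  have h1 := h.lim a ha hx
  rw [iSup_subtype' (p := fun b => b < a) (f := fun b _ => N b)] at h1
  have : Nonempty {c // c < a} := ⟨⟨b, hb⟩⟩
  obtain ⟨⟨c, hc⟩, hxc⟩ := (Submodule.mem_iSup_of_directed (fun c : {c // c < a} => N c)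
    (Monotone.directed_le fun c d hcd => h.mono hcd)).1 h1
  exact ⟨c, hc, hxc⟩

theorem exists_subset_of_lim (h : IsGoodFiltration μ N T) {a b : O} (ha : IsLim a) (hb : b < a)
    (t : Finset G) (ht : (t : Set G) ⊆ N a) : ∃ c < a, (t : Set G) ⊆ N c := by
  classical
  induction t using Finset.induction_on with
  | empty => exact ⟨b, hb, by simp⟩
  | insert g t _ ih =>
    rw [Finset.coe_insert] at ht
    obtain ⟨c, hc, htc⟩ := ih ((Set.subset_insert _ _).trans ht)
    obtain ⟨d, hd, hgd⟩ := h.exists_mem_of_lim ha hb (ht (Set.mem_insert _ _))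
    refine ⟨max c d, max_lt hc hd, ?_⟩
    rw [Finset.coe_insert]
    exact Set.insert_subset (h.mono (le_max_right c d) hgd)
      (htc.trans (h.mono (le_max_left c d)))

theorem eq_bot_of_isMin (h : IsGoodFiltration μ N T) {a : O} (ha : ∀ b, ¬ b < a) : N a = ⊥ := by
  refine le_bot_iff.1 ((h.lim a fun b hb => (ha b hb).elim).trans ?_)
  exact iSup₂_le fun b hb => (ha b hb).elim

theorem mem_of_isMin (h : IsGoodFiltration μ N T) {a b : O} (ha : ∀ b, ¬ b < a) (hab : a < b) :
    a ∈ T := by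
  by_contra hT
  refine h.not_relFree a hT b hab ?_
  rw [h.eq_bot_of_isMin ha, relFree_bot_iff]
  exact h.free _ (h.card b)

theorem exists_piece (h : IsGoodFiltration μ N T) {κ : Cardinal.{u}} (hμ : ℵ₀ ≤ μ) (hμκ : μ < κ)
    (hleast : ∀ lam : Cardinal.{u}, ℵ₀ < lam ∧ ExistsKappaFreeWhiteheadNonfree lam → κ ≤ lam)
    {a b : O} (hab : a < b) (C : Submodule ℤ (G →₀ ℤ)) (haT : a ∉ T)
    (hC : C ≤ LinearMap.ker (Finsupp.linearCombination ℤ (id : G → G)) ⊓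
      Finsupp.supported ℤ ℤ (N b : Set G))
    (hsup : LinearMap.ker (Finsupp.linearCombination ℤ (id : G → G)) ⊓
      Finsupp.supported ℤ ℤ (N b : Set G) ≤
      (LinearMap.ker (Finsupp.linearCombination ℤ (id : G → G)) ⊓
      Finsupp.supported ℤ ℤ (N a : Set G)) ⊔ C) :
    ∃ φ : C →ₗ[ℤ] ℤ, ∀ g : (G →₀ ℤ) →ₗ[ℤ] ℤ,
      (∀ x ∈ Finsupp.supported ℤ ℤ (N a : Set G), g x = 0) → ¬ ∀ x : C, g x = φ x := by
  classical
  set π := Finsupp.linearCombination ℤ (id : G → G)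
  set Fa := Finsupp.supported ℤ ℤ (N a : Set G)
  set Fb := Finsupp.supported ℤ ℤ (N b : Set G)
  have hFab : Fa ≤ Fb := Finsupp.supported_mono (h.mono hab.le)
  have hπN : ∀ c x, x ∈ Finsupp.supported ℤ ℤ (N c : Set G) → π x ∈ N c := by
    intro c x hx
    have := (Finsupp.mem_span_image_iff_linearCombination ℤ (v := (id : G → G))).2 ⟨x, hx, rfl⟩
    rwa [Set.image_id, Submodule.span_eq] at this
  have hL : C ⊔ Fa ≤ Fb := sup_le (hC.trans inf_le_right) hFab
  have hker : ∀ x ∈ Fb, (N a).mkQ (π x) = 0 ↔ x ∈ C ⊔ Fa := by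
    intro x hx
    rw [Submodule.mkQ_apply, Submodule.Quotient.mk_eq_zero]
    constructor
    · intro hxa
      have hs : Finsupp.single (π x) (1 : ℤ) ∈ Fa := Finsupp.single_mem_supported ℤ 1 hxa
      have h1 : x - Finsupp.single (π x) 1 ∈ LinearMap.ker π ⊓ Fb := by
        refine ⟨?_, sub_mem hx (hFab hs)⟩
        simp [π]
      have h2 : LinearMap.ker π ⊓ Fa ⊔ C ≤ C ⊔ Fa :=
        sup_le (inf_le_right.trans le_sup_right) le_sup_left
      have := add_mem (h2 (hsup h1)) (Submodule.mem_sup_right (S := C) hs)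
      rwa [sub_add_cancel] at this
    · intro hx
      have : C ⊔ Fa ≤ (N a).comap π := by
        refine sup_le (fun y hy => ?_) (fun y hy => hπN a y hy)
        change π y ∈ N a
        rw [LinearMap.mem_ker.1 (hC hy).1]
        exact zero_mem _
      exact this hx
  let f : Fb →ₗ[ℤ] G ⧸ N a := (N a).mkQ ∘ₗ π ∘ₗ Fb.subtype
  have hnot : ¬ RelFree (C ⊔ Fa) Fb := by
    rw [relFree_iff_of_hom f fun x => hker x x.2]
    have : LinearMap.range f = (N b).map (N a).mkQ := by
      ext y
      constructor
      · rintro ⟨x, rfl⟩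
        exact ⟨π x, hπN b x x.2, rfl⟩
      · rintro ⟨x, hx, rfl⟩
        refine ⟨⟨Finsupp.single x 1, Finsupp.single_mem_supported ℤ 1 hx⟩, ?_⟩
        simp [f, π]
    rw [this]
    exact h.not_relFree a haT b hab
  have hcard : #Fb < κ := by
    refine lt_of_le_of_lt ?_ hμκ
    rw [(Finsupp.supportedEquivFinsupp (M := ℤ) (R := ℤ) (N b : Set G)).toEquiv.cardinal_eq]
    have : Nonempty (N b : Set G) := ⟨⟨0, zero_mem (N b)⟩⟩
    rw [Cardinal.mk_finsupp_lift_of_infinite', Cardinal.lift_uzero, Cardinal.mk_int,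
      Cardinal.lift_aleph0]
    exact max_le (h.card b) hμ
  obtain ⟨φ, hφ⟩ := exists_not_extending hleast hL (free_submodule Fb) hcard hnot
  let k : (G →₀ ℤ) →ₗ[ℤ] ℤ := φ ∘ₗ Submodule.inclusion le_sup_right ∘ₗ
    Finsupp.restrictDom ℤ ℤ (N a : Set G)
  have hk : ∀ x (hx : x ∈ Fa), k x = φ ⟨x, Submodule.mem_sup_right hx⟩ := by
    intro x hx
    have : Finsupp.restrictDom ℤ ℤ (N a : Set G) x = ⟨x, hx⟩ :=
      LinearMap.congr_fun (Finsupp.restrictDom_comp_subtype (N a : Set G)) ⟨x, hx⟩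
    change φ (Submodule.inclusion le_sup_right (Finsupp.restrictDom ℤ ℤ (N a : Set G) x)) = _
    rw [this]; rfl
  refine ⟨φ ∘ₗ Submodule.inclusion le_sup_left - k ∘ₗ C.subtype, fun g hg0 hg => ?_⟩
  refine hφ ((g + k) ∘ₗ Fb.subtype) fun x hx => ?_
  obtain ⟨y, hy, z, hz, rfl⟩ := Submodule.mem_sup.1 hx
  have h1 : g y = φ ⟨y, Submodule.mem_sup_left hy⟩ - k y := hg ⟨y, hy⟩
  have h2 : φ ⟨y + z, hx⟩ = φ ⟨y, Submodule.mem_sup_left hy⟩ +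
    φ ⟨z, Submodule.mem_sup_right hz⟩ := by rw [← map_add]; rfl
  change g (y + z) + k (y + z) = _
  rw [h2, map_add, map_add, h1, hg0 z hz, hk z hz]
  ring

/-- Homomorphisms coded by colorings: solving all of them separates colorings on small pieces. -/
theorem exists_solution (h : IsGoodFiltration μ N T) {κ : Cardinal.{u}} (hμ : ℵ₀ ≤ μ) (hμκ : μ < κ)
    (hleast : ∀ lam : Cardinal.{u}, ℵ₀ < lam ∧ ExistsKappaFreeWhiteheadNonfree lam → κ ≤ lam)
    [WellFoundedLT O] (hO : ∀ a : O, ∃ b, a < b) (hG : IsWhitehead G) :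
    ∃ Sol : (O → Bool) → G → ℤ, ∀ α ∉ T, ∀ c c' : O → Bool,
      (∀ g ∈ N α, Sol c g = Sol c' g) → c α = c' α := by
  classical
  obtain ⟨s, hs⟩ := exists_succ_fun hO
  have hlt : ∀ a, a < s a := fun a => (hs a _).2 le_rfl
  let π : (G →₀ ℤ) →ₗ[ℤ] G := Finsupp.linearCombination ℤ id
  have hπ : Function.Surjective π := fun g => ⟨Finsupp.single g 1, by simp [π]⟩
  let K := LinearMap.ker π
  let F : O → Submodule ℤ (G →₀ ℤ) := fun a => Finsupp.supported ℤ ℤ (N a : Set G)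
  have hFmono : Monotone F := fun a b hab => Finsupp.supported_mono (h.mono hab)
  have hsub : ∀ a b, b < a → (⨆ i, ⨆ (_ : i < a), K ⊓ F (s i)) = K ⊓ F a := by
    intro a b hb
    apply le_antisymm
    · exact iSup₂_le fun i hi => inf_le_inf_left _ (hFmono ((hs i a).1 hi))
    · by_cases hlim : IsLim a
      · intro x hx
        obtain ⟨c, hc, hxc⟩ := h.exists_subset_of_lim hlim hb x.support
          ((Finsupp.mem_supported _ _).1 hx.2)
        exact le_iSup₂_of_le (f := fun i (_ : i < a) => K ⊓ F (s i)) c hc le_rfl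
          ⟨hx.1, hFmono (hlt c).le ((Finsupp.mem_supported _ _).2 hxc)⟩
      · rw [IsLim] at hlim
        push Not at hlim
        obtain ⟨b, hb, hba⟩ := hlim
        have : s b = a := le_antisymm ((hs b a).1 hb) (by
          by_contra hc
          exact (hba _ (not_le.1 hc)).not_gt (hlt b))
        rw [← this]
        exact le_iSup₂_of_le (f := fun i (_ : i < s b) => K ⊓ F (s i)) b (hlt b) le_rfl
  obtain ⟨C, hC1, -, hC3, -, hC5, hC6⟩ := exists_compl_chain (fun a => K ⊓ F (s a)) (by
    intro a
    by_cases ha : ∃ b, b < a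
    · obtain ⟨b, hb⟩ := ha
      rw [hsub a b hb]
      let f : (K ⊓ F (s a) : Submodule ℤ (G →₀ ℤ)) →ₗ[ℤ] ((N a : Set G)ᶜ : Set G) →₀ ℤ :=
        Finsupp.lsubtypeDomain (N a : Set G)ᶜ ∘ₗ Submodule.subtype _
      refine relFree_of_hom_free f fun x => ?_
      change Finsupp.subtypeDomain (fun g => g ∈ (N a : Set G)ᶜ) x.1 = 0 ↔ _
      rw [Finsupp.subtypeDomain_eq_zero_iff']
      refine ⟨fun hx => ⟨x.2.1, (Finsupp.mem_supported _ _).2 fun g hg => ?_⟩, fun hx g hg => ?_⟩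
      · by_contra hc
        exact Finsupp.mem_support_iff.1 hg (hx g hc)
      · by_contra hc
        exact hg ((Finsupp.mem_supported _ _).1 hx.2 (Finsupp.mem_support_iff.2 hc))
    · push Not at ha
      have : (⨆ i, ⨆ (_ : i < a), K ⊓ F (s i)) = ⊥ :=
        le_bot_iff.1 (iSup₂_le fun b hb => ((ha b).not_gt hb).elim)
      rw [this, relFree_bot_iff]
      exact free_submodule _)
  have hpiece : ∀ a, a ∉ T → ∃ φ : C a →ₗ[ℤ] ℤ, ∀ g : (G →₀ ℤ) →ₗ[ℤ] ℤ,
      (∀ x ∈ F a, g x = 0) → ¬ ∀ x : C a, g x = φ x := by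
    intro a ha
    by_cases hmin : ∀ b, ¬ b < a
    · exact (ha (h.mem_of_isMin hmin (hlt a))).elim
    · push Not at hmin
      obtain ⟨b, hb⟩ := hmin
      exact h.exists_piece hμ hμκ hleast (hlt a) (C a) ha (hC1 a) (by
        have := hC5 a
        rwa [hsub a b hb] at this)
  choose φ hφ using hpiece
  have hK : K ≤ ⨆ a, C a := by
    intro x hx
    obtain ⟨a, ha⟩ : ∃ a, (x.support : Set G) ⊆ N a := by
      induction x.support using Finset.induction_on with
      | empty => exact ⟨(h.cover 0).choose, by simp⟩
      | insert g t _ ih =>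
        obtain ⟨a, ha⟩ := ih
        obtain ⟨b, hb⟩ := h.cover g
        refine ⟨max a b, ?_⟩
        rw [Finset.coe_insert]
        exact Set.insert_subset (h.mono (le_max_right a b) hb)
          (ha.trans (h.mono (le_max_left a b)))
    have h1 : x ∈ ⨆ i, ⨆ (_ : i ≤ a), K ⊓ F (s i) :=
      le_iSup₂_of_le (f := fun i (_ : i ≤ a) => K ⊓ F (s i)) a le_rfl le_rfl
        ⟨hx, hFmono (hlt a).le ((Finsupp.mem_supported _ _).2 ha)⟩
    rw [← hC6 a] at h1
    exact (iSup₂_le fun i _ => le_iSup C i : _ ≤ ⨆ a, C a) h1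
  have hsol : ∀ c : O → Bool, ∃ ψ : (G →₀ ℤ) →ₗ[ℤ] ℤ, ∀ a (ha : a ∉ T) (x : C a),
      ψ x = if c a then φ a ha x else 0 := by
    intro c
    obtain ⟨f, hf⟩ := hC3.exists_hom (P := ℤ)
      (fun a => if ha : a ∉ T then (if c a then φ a ha else 0) else 0)
    obtain ⟨ψ, hψ⟩ := hG.exists_extension π hπ (f ∘ₗ Submodule.inclusion hK)
    refine ⟨ψ, fun a ha x => ?_⟩
    have h1 := hψ ⟨x, (hC1 a x.2).1⟩
    have h2 := hf a x x.2
    rw [dif_pos ha] at h2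
    have h3 : f (Submodule.inclusion hK ⟨x, (hC1 a x.2).1⟩) = f ⟨x, le_iSup C a x.2⟩ := rfl
    change ψ x = f (Submodule.inclusion hK ⟨x, (hC1 a x.2).1⟩) at h1
    rw [h1, h3, h2]
    split_ifs <;> rfl
  choose ψ hψ using hsol
  refine ⟨fun c g => ψ c (Finsupp.single g 1), fun a ha => ?_⟩
  have hF : ∀ c c', (∀ g ∈ N a, ψ c (Finsupp.single g 1) = ψ c' (Finsupp.single g 1)) →
      ∀ x ∈ F a, ψ c x = ψ c' x := by
    intro c c' hcc x hx
    change x ∈ Finsupp.supported ℤ ℤ (N a : Set G) at hx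
    rw [Finsupp.supported_eq_span_single] at hx
    have h1 : Set.EqOn (ψ c) (ψ c') ((fun i => Finsupp.single i (1 : ℤ)) '' (N a : Set G)) := by
      rintro _ ⟨g, hg, rfl⟩
      exact hcc g hg
    exact LinearMap.eqOn_span h1 hx
  have main : ∀ c c', (∀ g ∈ N a, ψ c (Finsupp.single g 1) = ψ c' (Finsupp.single g 1)) →
      c a = true → c' a = true := by
    intro c c' hcc hc
    by_contra hc'
    refine hφ a ha (ψ c - ψ c') (fun x hx => ?_) fun x => ?_
    · rw [LinearMap.sub_apply, hF c c' hcc x hx, sub_self]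
    · rw [LinearMap.sub_apply, hψ c a ha, hψ c' a ha, if_pos hc, if_neg hc', sub_zero]
  intro c c' hcc
  rw [Bool.eq_iff_iff]
  exact ⟨main c c' hcc, main c' c fun g hg => (hcc g hg).symm⟩

end IsGoodFiltration
end GoodFiltration

section Arithmetic

theorem power_le_of_lt_of_lt (gch : ∀ μ : Cardinal.{u}, ℵ₀ ≤ μ → (2 : Cardinal.{u}) ^ μ = Order.succ μ)
    {μ a b : Cardinal.{u}} (hμ : ℵ₀ ≤ μ) (ha : a < μ) (hb : b < μ) : a ^ b ≤ μ := by
  by_cases h : max a b < ℵ₀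
  · exact (Cardinal.power_lt_aleph0 ((le_max_left _ _).trans_lt h)
      ((le_max_right _ _).trans_lt h)).le.trans hμ
  · push Not at h
    calc a ^ b ≤ max a b ^ b := Cardinal.power_le_power_right (le_max_left _ _)
      _ ≤ max a b ^ max a b := Cardinal.power_le_power_left
          (Cardinal.aleph0_pos.trans_le h).ne' (le_max_right _ _)
      _ = 2 ^ max a b := Cardinal.power_self_eq h
      _ = Order.succ (max a b) := gch _ h
      _ ≤ μ := Order.succ_le_of_lt (max_lt ha hb)

theorem mk_fun_le_of_lt_cof (gch : ∀ μ : Cardinal.{u}, ℵ₀ ≤ μ → (2 : Cardinal.{u}) ^ μ = Order.succ μ)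
    {μ : Cardinal.{u}} (hμ : ℵ₀ ≤ μ) {X M : Type u} (hX : #X < μ.ord.cof) (hM : #M ≤ μ) :
    #(X → M) ≤ μ := by
  let Z := μ.ord.ToType
  have hZ : #Z = μ := by simp [Z]
  have e : Nonempty (M ↪ Z) := by rw [← Cardinal.le_def, hZ]; exact hM
  obtain ⟨e⟩ := e
  have hnm : NoMaxOrder Z := by
    exact Cardinal.noMaxOrder hμ
  have hb : ∀ f : X → M, ∃ z : Z, ∀ x, e (f x) < z := by
    intro f
    by_contra! hc
    have hcof : IsCofinal (Set.range fun x => e (f x)) := by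
      intro z
      obtain ⟨x, hx⟩ := hc z
      exact ⟨_, ⟨x, rfl⟩, hx⟩
    have := (Order.cof_le hcof).trans Cardinal.mk_range_le
    rw [Ordinal.cof_toType] at this
    exact this.not_gt hX
  choose b hb using hb
  have hinj : Function.Injective (fun f : X → M => (⟨b f, fun x => ⟨e (f x), hb f x⟩⟩ :
      Σ z : Z, X → Set.Iio z)) := by
    intro f g hfg
    obtain ⟨h1, h2⟩ := Sigma.mk.inj_iff.1 hfg
    funext x
    apply e.injective
    have h3 : ∀ (z z' : Z) (p : X → Set.Iio z) (p' : X → Set.Iio z'), z = z' → p ≍ p' →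
      (p x : Z) = p' x := by
      rintro z _ p p' rfl h
      rw [eq_of_heq h]
    exact h3 _ _ _ _ h1 h2
  refine (Cardinal.mk_le_of_injective hinj).trans ?_
  rw [Cardinal.mk_sigma]
  refine (Cardinal.sum_le_sum _ (fun _ => μ) fun z => ?_).trans ?_
  · rw [← Cardinal.power_def]
    refine power_le_of_lt_of_lt gch hμ ((Cardinal.mk_Iio_lt z (by simp [Z])).trans_eq hZ) (hX.trans_le ?_)
    simpa using Ordinal.cof_le_card μ.ord
  · simp only [Cardinal.sum_const, Cardinal.lift_id, hZ]
    exact (Cardinal.mul_eq_self hμ).le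

end Arithmetic

section Guessing

/-- A linear order of size at most `μ`, whose cofinality differs from that of `μ`, admits `μ` many
partial self-maps that capture every self-map on a cofinal set. -/
theorem exists_guess (gch : ∀ μ : Cardinal.{u}, ℵ₀ ≤ μ → (2 : Cardinal.{u}) ^ μ = Order.succ μ)
    {μ : Cardinal.{u}} (hμ : ℵ₀ ≤ μ) {D I : Type u} [LinearOrder D] [WellFoundedLT D]
    (hI : #I = μ) (hD : #D ≤ μ) (hcof : Order.cof D ≠ μ.ord.cof) :
    ∃ F : I → Set D × (D → D), ∀ e : D → D, ∃ i, IsCofinal (F i).1 ∧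
      ∀ x ∈ (F i).1, (F i).2 x = e x := by
  classical
  obtain ⟨W, hW, hWc⟩ := Order.exists_cof_eq D
  let Z := μ.ord.ToType
  have hZ : #Z = μ := by simp [Z]
  have φ : Nonempty (D ↪ Z) := by rw [← Cardinal.le_def, hZ]; exact hD
  obtain ⟨φ⟩ := φ
  have hnm : NoMaxOrder Z := Cardinal.noMaxOrder hμ
  obtain ⟨s, hs, hsc⟩ := Order.exists_cof_eq Z
  have hsc' : #s = μ.ord.cof := by rw [hsc, Ordinal.cof_toType]
  have hsμ : #s ≤ μ := hsc'.trans_le (by simpa using Ordinal.cof_le_card μ.ord)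
  have hWμ : #W < μ := by
    refine lt_of_le_of_ne ((Cardinal.mk_set_le _).trans hD) fun h => hcof ?_
    have h1 := Order.cof_ord_cof D
    rw [← hWc, h] at h1
    rw [← hWc, h1, h]
  let A : s → Set D := fun i => {x | φ x < i}
  have hA : ∀ i, #(A i) < μ := by
    intro i
    refine lt_of_le_of_lt ?_ ((Cardinal.mk_Iio_lt (i : Z) (by simp [Z])).trans_eq hZ)
    exact Cardinal.mk_le_of_injective (f := fun x : A i => (⟨φ x, x.2⟩ : Set.Iio (i : Z)))
      fun x y hxy => Subtype.ext (φ.injective (congrArg Subtype.val hxy))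
  let Cand := Σ i : s, W → Option (A i)
  have hCand : #Cand ≤ #I := by
    rw [Cardinal.mk_sigma, hI]
    refine (Cardinal.sum_le_sum _ (fun _ => μ) fun i => ?_).trans ?_
    · rw [← Cardinal.power_def]
      refine power_le_of_lt_of_lt gch hμ ?_ hWμ
      rw [Cardinal.mk_option]
      rcases lt_or_ge (#(A i)) ℵ₀ with h | h
      · exact (Cardinal.add_lt_aleph0 h Cardinal.one_lt_aleph0).trans_le hμ
      · rw [Cardinal.add_one_of_aleph0_le h]
        exact hA i
    · simp only [Cardinal.sum_const, Cardinal.lift_id]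
      exact (mul_le_mul_left hsμ _).trans (Cardinal.mul_eq_self hμ).le
  obtain ⟨emb⟩ : Nonempty (Cand ↪ I) := hCand
  let dec : Cand → Set D × (D → D) := fun p =>
    ({x | ∃ hx : x ∈ W, p.2 ⟨x, hx⟩ ≠ none},
      fun x => if hx : x ∈ W then (p.2 ⟨x, hx⟩).elim x (fun y => y.1) else x)
  refine ⟨fun i => if h : ∃ p, emb p = i then dec h.choose else (∅, id), fun e => ?_⟩
  have key : ∃ i : s, ∀ d : D, ∃ w ∈ W, d ≤ w ∧ e w ∈ A i := by
    by_contra! hc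
    choose d hd using hc
    have hr : ∀ x : D, ∃ i : s, e x ∈ A i := by
      intro x
      obtain ⟨z, hz⟩ := exists_gt (φ (e x))
      obtain ⟨i, hi, hzi⟩ := hs z
      exact ⟨⟨i, hi⟩, hz.trans_le hzi⟩
    choose r hr using hr
    rcases lt_trichotomy (#W) (#s) with h | h | h
    · have : ¬ IsCofinal (Set.range fun w : W => (r w : Z)) := by
        intro hcf
        have := (Order.cof_le hcf).trans Cardinal.mk_range_le
        rw [Ordinal.cof_toType, ← hsc'] at this
        exact this.not_gt h
      obtain ⟨z, hz⟩ := not_isCofinal_iff.1 this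
      obtain ⟨i, hi, hzi⟩ := hs z
      obtain ⟨w, hw, hdw⟩ := hW (d ⟨i, hi⟩)
      refine hd ⟨i, hi⟩ w hw hdw ?_
      exact lt_of_lt_of_le (hr w) ((hz _ ⟨⟨w, hw⟩, rfl⟩).le.trans hzi)
    · exact hcof (by rw [← hWc, h, hsc'])
    · have : ¬ IsCofinal (Set.range d) := by
        intro hcf
        have := (Order.cof_le hcf).trans Cardinal.mk_range_le
        rw [← hWc] at this
        exact this.not_gt h
      obtain ⟨z, hz⟩ := not_isCofinal_iff.1 this
      obtain ⟨w, hw, hzw⟩ := hW z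
      exact hd (r w) w hw ((hz _ ⟨_, rfl⟩).le.trans hzw) (hr w)
  obtain ⟨i, hi⟩ := key
  let p : Cand := ⟨i, fun w => if h : e w ∈ A i then some ⟨e w, h⟩ else none⟩
  have hp : ∃ p', emb p' = emb p := ⟨p, rfl⟩
  have hch : hp.choose = p := emb.injective hp.choose_spec
  refine ⟨emb p, ?_⟩
  beta_reduce
  rw [dif_pos hp, hch]
  constructor
  · intro x
    obtain ⟨w, hw, hxw, he⟩ := hi x
    refine ⟨w, ⟨hw, ?_⟩, hxw⟩
    simp [p, he]
  · rintro x ⟨hx, hne⟩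
    by_cases he : e x ∈ A i
    · simp [dec, p, he, hx]
    · simp [p, he] at hne

end Guessing

namespace IsSuccOrderType

variable {O : Type u} [LinearOrder O] {μ : Cardinal.{u}}

theorem not_mk_le (hO : IsSuccOrderType O μ) {s : Set O} (hs : IsCofinal s) : ¬ #s ≤ μ := by
  intro h
  obtain ⟨a, ha⟩ := hO.exists_gt s h
  obtain ⟨b, hb, hab⟩ := hs a
  exact (ha b hb).not_ge hab

theorem succ_le_mk (hO : IsSuccOrderType O μ) : Order.succ μ ≤ #O := by
  rw [Order.succ_le_iff, ← not_le, ← Cardinal.mk_univ]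
  exact hO.not_mk_le fun a => ⟨a, trivial, le_rfl⟩

end IsSuccOrderType

namespace IsGoodFiltration

variable {G O : Type u} [AddCommGroup G] [LinearOrder O] {μ : Cardinal.{u}}
  {N : O → Submodule ℤ G} {T : Set O}

theorem mk_fun_int_le (gch : ∀ μ : Cardinal.{u}, ℵ₀ ≤ μ → (2 : Cardinal.{u}) ^ μ = Order.succ μ)
    (hμ : ℵ₀ ≤ μ) {I J : Type u} (hI : #I ≤ μ) (hJ : #J ≤ μ) :
    #(I → J → ℤ) ≤ Order.succ μ := by
  have e : #(I → J → ℤ) = (ℵ₀ ^ #J) ^ #I := by simp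
  rw [e, ← gch μ hμ, ← Cardinal.power_mul, ← Cardinal.power_self_eq hμ]
  refine (Cardinal.power_le_power_right hμ).trans (Cardinal.power_le_power_left
    (Cardinal.aleph0_pos.trans_le hμ).ne' ?_)
  exact (mul_le_mul' hJ hI).trans (Cardinal.mul_eq_self hμ).le

theorem exists_mem_gt [WellFoundedLT O]
    (gch : ∀ μ : Cardinal.{u}, ℵ₀ ≤ μ → (2 : Cardinal.{u}) ^ μ = Order.succ μ) (hμ : ℵ₀ ≤ μ)
    (h : IsGoodFiltration μ N T) (hO : IsSuccOrderType O μ) (Sol : (O → Bool) → G → ℤ)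
    (hSol : ∀ α ∉ T, ∀ c c', (∀ g ∈ N α, Sol c g = Sol c' g) → c α = c' α) (a : O) :
    ∃ b ∈ T, a < b := by
  classical
  by_contra! hT
  obtain ⟨s, hs⟩ := exists_succ_fun (hO.exists_gt_elem hμ)
  have hlt : ∀ b, b < s b := fun b => (hs b (s b)).2 le_rfl
  let I := μ.ord.ToType
  have hI : #I = μ := by simp [I]
  have hcode : ∀ γ, Nonempty ((I → N γ → ℤ) ↪ (I → Bool)) := by
    intro γ
    rw [← Cardinal.le_def]
    refine (mk_fun_int_le gch hμ hI.le (h.card γ)).trans ?_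
    rw [← gch μ hμ]
    simp [hI]
  let code : ∀ γ, (I → N γ → ℤ) ↪ (I → Bool) := fun γ => (hcode γ).some
  let nx : (O → I → Bool) → O → I → Bool := fun x γ =>
    code (s γ) fun i g => Sol (fun a => x a i) g
  have step : ∀ x y : O → I → Bool, (∀ n : ℕ, ∀ i, ∀ g ∈ N (s a),
      Sol (fun a => nx^[n] x a i) g = Sol (fun a => nx^[n] y a i) g) →
      ∀ γ, s a ≤ γ → x γ = y γ := by
    intro x y hxy
    have hsol : ∀ γ, s a ≤ γ → (∀ n : ℕ, ∀ i, ∀ g ∈ N γ,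
        Sol (fun a => nx^[n] x a i) g = Sol (fun a => nx^[n] y a i) g) →
        ∀ n : ℕ, nx^[n] x γ = nx^[n] y γ := by
      intro γ hγ h1 n
      funext i
      exact hSol γ (fun hc => (hT γ hc).not_gt ((hlt a).trans_le hγ)) _ _ (h1 n i)
    have key : ∀ γ, s a ≤ γ → ∀ n : ℕ, ∀ i, ∀ g ∈ N γ,
        Sol (fun a => nx^[n] x a i) g = Sol (fun a => nx^[n] y a i) g := by
      intro γ
      induction γ using WellFoundedLT.induction with
      | ind γ ih =>
        intro hγ n i g hg
        rcases hγ.eq_or_lt with rfl | hγ'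
        · exact hxy n i g hg
        have hsucc : ∀ b < γ, s a ≤ b → ∀ n : ℕ, ∀ i, ∀ g ∈ N (s b),
            Sol (fun a => nx^[n] x a i) g = Sol (fun a => nx^[n] y a i) g := by
          intro b hb hab n i g hg
          have h1 := hsol b hab (ih b hb hab) (n + 1)
          rw [Function.iterate_succ_apply', Function.iterate_succ_apply'] at h1
          have h2 := (code (s b)).injective h1
          exact congrFun (congrFun h2 i) ⟨g, hg⟩
        by_cases hl : IsLim γ
        · obtain ⟨c, hc, hgc⟩ := h.exists_mem_of_lim hl hγ' hg
          refine hsucc (max (s a) c) (max_lt hγ' hc) (le_max_left _ _) n i g ?_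
          exact h.mono ((le_max_right _ _).trans (hlt _).le) hgc
        · unfold IsLim at hl
          push Not at hl
          obtain ⟨b, hb, hbc⟩ := hl
          have hsb : s b = γ := by
            refine le_antisymm ((hs _ _).1 hb) (not_lt.1 fun hc => ?_)
            exact (hbc _ hc).not_gt (hlt b)
          have hab : s a ≤ b := hbc _ hγ'
          exact hsucc b hb hab n i g (hsb ▸ hg)
    intro γ hγ
    exact hsol γ hγ (key γ hγ) 0
  let O' := Set.Ici (s a)
  let x0 : (O' → Bool) → O → I → Bool := fun z γ _ => if hγ : s a ≤ γ then z ⟨γ, hγ⟩ else false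
  have hIne : Nonempty I := by
    rw [← Cardinal.mk_ne_zero_iff, hI]
    exact (Cardinal.aleph0_pos.trans_le hμ).ne'
  have hinj : Function.Injective (fun z : O' → Bool => fun (p : ULift.{u} ℕ × I) (g : N (s a)) =>
      Sol (fun a => nx^[p.1.down] (x0 z) a p.2) g) := by
    intro z z' hzz
    funext γ
    have h1 := step (x0 z) (x0 z') (fun n i g hg =>
      congrFun (congrFun hzz (⟨n⟩, i)) ⟨g, hg⟩) γ γ.2
    have h2 := congrFun h1 hIne.some
    simp only [x0, dif_pos (show s a ≤ γ from γ.2)] at h2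
    exact h2
  have h1 := (Cardinal.mk_le_of_injective hinj).trans (mk_fun_int_le gch hμ (by
    simp only [Cardinal.mk_prod, Cardinal.lift_id, Cardinal.mk_uLift, Cardinal.mk_nat, hI,
      Cardinal.lift_aleph0]
    exact (Cardinal.aleph0_mul_eq hμ).le) (h.card _))
  have h2 : Order.succ μ ≤ #O' := by
    rw [Order.succ_le_iff, ← not_le]
    exact hO.not_mk_le fun b => ⟨max (s a) b, le_max_left _ _, le_max_right _ _⟩
  have h3 := Cardinal.cantor (#O')
  have h4 : #(O' → Bool) = 2 ^ #O' := by simp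
  rw [h4] at h1
  exact (h1.trans h2).not_gt h3

/-- Almost all points where the filtration is not relatively free have the cofinality of `μ`. -/
theorem exists_fun_cof_eq [WellFoundedLT O]
    (gch : ∀ μ : Cardinal.{u}, ℵ₀ ≤ μ → (2 : Cardinal.{u}) ^ μ = Order.succ μ) (hμ : ℵ₀ ≤ μ)
    (h : IsGoodFiltration μ N T) (hO : IsSuccOrderType O μ) (Sol : (O → Bool) → G → ℤ)
    (hSol : ∀ α ∉ T, ∀ c c', (∀ g ∈ N α, Sol c g = Sol c' g) → c α = c' α) :
    ∃ E : O → O, ∀ δ ∉ T, IsLim δ → (∀ b < δ, E b < δ) →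
      Order.cof (Set.Iio δ) = μ.ord.cof := by
  classical
  let I := μ.ord.ToType
  have hI : #I = μ := by simp [I]
  have hcode : ∀ γ, Nonempty ((I → N γ → ℤ) ↪ O) := by
    intro γ
    rw [← Cardinal.le_def]
    exact (mk_fun_int_le gch hμ hI.le (h.card γ)).trans hO.succ_le_mk
  let code : ∀ γ, (I → N γ → ℤ) ↪ O := fun γ => (hcode γ).some
  let dec : ∀ γ, O → I → N γ → ℤ := fun γ => Function.invFun (code γ)
  have hdec : ∀ γ f, dec γ (code γ f) = f := fun γ f =>
    Function.leftInverse_invFun (code γ).injective f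
  let Bad : O → Prop := fun δ => δ ∉ T ∧ IsLim δ ∧ Order.cof (Set.Iio δ) ≠ μ.ord.cof
  have hF : ∀ δ, Bad δ → ∃ F : I → Set (Set.Iio δ) × (Set.Iio δ → Set.Iio δ),
      ∀ e : Set.Iio δ → Set.Iio δ, ∃ i, IsCofinal (F i).1 ∧ ∀ x ∈ (F i).1, (F i).2 x = e x :=
    fun δ hδ => exists_guess gch hμ hI (hO.mk_Iio_le δ) hδ.2.2
  choose F hF using hF
  let p : ∀ δ, Bad δ → I → G → ℤ := fun δ hδ ν g =>
    if hg : ∃ x ∈ (F δ hδ ν).1, g ∈ N x then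
      dec hg.choose ((F δ hδ ν).2 hg.choose) ν ⟨g, hg.choose_spec.2⟩ else 0
  let c : I → O → Bool := fun ν δ =>
    if hδ : Bad δ then !(decide (∃ c : O → Bool, (∀ g ∈ N δ, Sol c g = p δ hδ ν g) ∧ c δ = true))
    else false
  refine ⟨fun γ => code γ fun ν g => Sol (c ν) g, fun δ hT hl hE => ?_⟩
  by_contra hne
  have hδ : Bad δ := ⟨hT, hl, hne⟩
  obtain ⟨ν, hcof, hν⟩ := hF δ hδ fun b => ⟨_, hE b b.2⟩
  obtain ⟨b', hb'⟩ := hO.exists_gt_elem hμ δ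
  have hmin : ∃ b, b < δ := by
    by_contra! hc
    exact hT (h.mem_of_isMin (fun b => (hc b).not_gt) hb')
  obtain ⟨b, hb⟩ := hmin
  have hp : ∀ g ∈ N δ, Sol (c ν) g = p δ hδ ν g := by
    intro g hg
    obtain ⟨b, hb, hgb⟩ := h.exists_mem_of_lim hl hb hg
    obtain ⟨x, hx, hbx⟩ := hcof ⟨b, hb⟩
    have hex : ∃ x ∈ (F δ hδ ν).1, g ∈ N x := ⟨x, hx, h.mono hbx hgb⟩
    simp only [p]
    rw [dif_pos hex, hν _ hex.choose_spec.1]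
    simp only [hdec]
  have hc : c ν δ = !(decide (∃ c : O → Bool,
      (∀ g ∈ N δ, Sol c g = p δ hδ ν g) ∧ c δ = true)) := by
    simp only [c]
    rw [dif_pos hδ]
  by_cases hex : ∃ c : O → Bool, (∀ g ∈ N δ, Sol c g = p δ hδ ν g) ∧ c δ = true
  · rw [decide_eq_true hex] at hc
    obtain ⟨c', hc', h2⟩ := hex
    have := hSol δ hT (c ν) c' fun g hg => (hp g hg).trans (hc' g hg).symm
    rw [hc, h2] at this
    simp at this
  · rw [decide_eq_false hex] at hc
    exact hex ⟨c ν, hp, by simpa using hc⟩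

end IsGoodFiltration

section Ladder

/-- A ladder at `δ`, given by its successor values `s` and its continuous values `c`. -/
structure IsLadder {G O Θ : Type*} [AddCommGroup G] [LinearOrder O] [LinearOrder Θ]
    (N : O → Submodule ℤ G) (T : Set O) (δ : O) (s c : Θ → O) : Prop where
  lt : ∀ j, c j < s j
  lt_top : ∀ j, s j < δ
  le : ∀ i j, i < j → s i ≤ c j
  cofinal : ∀ b < δ, ∃ j, b < s j
  mem : ∀ j, c j ∈ T
  mem_succ : ∀ j, s j ∈ T
  le_iSup : ∀ j, N (c j) ≤ ⨆ i, ⨆ (_ : i < j), N (s i)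

theorem IsLadder.strictMono {G O Θ : Type*} [AddCommGroup G] [LinearOrder O] [LinearOrder Θ]
    {N : O → Submodule ℤ G} {T : Set O} {δ : O} {s c : Θ → O} (h : IsLadder N T δ s c) :
    StrictMono s := fun i j hij => (h.le i j hij).trans_lt (h.lt j)

theorem exists_lub_fun (O : Type*) [LinearOrder O] [WellFoundedLT O] [Nonempty O] :
    ∃ lub : Set O → O, ∀ A u, (∀ a ∈ A, a ≤ u) → (∀ a ∈ A, a ≤ lub A) ∧ lub A ≤ u := by
  classical
  refine ⟨fun A => if h : (upperBounds A).Nonempty then wellFounded_lt.min _ h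
    else Classical.arbitrary O, fun A u hu => ?_⟩
  have h : (upperBounds A).Nonempty := ⟨u, fun a ha => hu a ha⟩
  simp only [dif_pos h]
  exact ⟨fun a ha => wellFounded_lt.min_mem _ h ha, wellFounded_lt.min_le (s := upperBounds A) fun a ha => hu a ha⟩

variable {G O : Type u} [AddCommGroup G] [LinearOrder O] {μ : Cardinal.{u}}
  {N : O → Submodule ℤ G} {T : Set O}

theorem IsGoodFiltration.exists_fun_ladder [WellFoundedLT O] (hμ : ℵ₀ ≤ μ)
    (h : IsGoodFiltration μ N T) (hO : IsSuccOrderType O μ) (hT : ∀ a, ∃ b ∈ T, a < b)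
    {Θ : Type u} [LinearOrder Θ] [WellFoundedLT Θ] (hΘ : ∀ j : Θ, #(Set.Iio j) < #Θ)
    (hcof : ∃ E : O → O, ∀ δ ∉ T, IsLim δ → (∀ b < δ, E b < δ) → Order.cof (Set.Iio δ) = #Θ) :
    ∃ E : O → O, ∀ δ ∉ T, IsLim δ → (∀ b < δ, E b < δ) →
      ∃ s c : Θ → O, IsLadder N T δ s c := by
  classical
  obtain ⟨E0, hE0⟩ := hcof
  have hstep : ∀ a, ∃ b ∈ T, a < b ∧ ∀ x ≤ a, E0 x < b := by
    intro a
    obtain ⟨b, hb⟩ := hO.exists_gt (E0 '' Set.Iic a) (Cardinal.mk_image_le.trans (by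
      obtain ⟨a', ha'⟩ := hO.exists_gt_elem hμ a
      exact (Cardinal.mk_le_mk_of_subset fun x (hx : x ≤ a) => hx.trans_lt ha').trans
        (hO.mk_Iio_le a')))
    obtain ⟨c, hc, hbc⟩ := hT (max a b)
    exact ⟨c, hc, (le_max_left _ _).trans_lt hbc, fun x hx =>
      (hb _ ⟨x, hx, rfl⟩).trans ((le_max_right _ _).trans_lt hbc)⟩
  choose step hstepT hstep_lt hstepE using hstep
  refine ⟨fun b => max (E0 b) (step b), fun δ hδT hl hE => ?_⟩
  have hEs : ∀ b < δ, step b < δ := fun b hb => (le_max_right _ _).trans_lt (hE b hb)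
  have hEE : ∀ b < δ, E0 b < δ := fun b hb => (le_max_left _ _).trans_lt (hE b hb)
  have hcδ := hE0 δ hδT hl hEE
  obtain ⟨W, hW, hWc⟩ := Order.exists_cof_eq (Set.Iio δ)
  obtain ⟨q⟩ : Nonempty (Θ ≃ W) := Cardinal.eq.1 (by rw [hWc, hcδ])
  have : Nonempty O := ⟨δ⟩
  obtain ⟨lub, hlub⟩ := exists_lub_fun O
  let s : Θ → O := wellFounded_lt.fix fun j ih =>
    step (max (lub (Set.range fun i : Set.Iio j => ih i i.2)) (q j : Set.Iio δ))
  let c : Θ → O := fun j => lub (s '' Set.Iio j)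
  have hs : ∀ j, s j = step (max (c j) (q j : Set.Iio δ)) := by
    intro j
    simp only [s, c]
    rw [WellFounded.fix_eq]
    congr 3
    rw [Set.image_eq_range]
  have hbd : ∀ j, (∀ i < j, s i < δ) → ∃ b < δ, ∀ i < j, s i ≤ b := by
    intro j hj
    have : ¬ IsCofinal (Set.range fun i : Set.Iio j => (⟨s i, hj i i.2⟩ : Set.Iio δ)) := by
      intro hc
      have := (Order.cof_le hc).trans Cardinal.mk_range_le
      rw [hcδ] at this
      exact this.not_gt (hΘ j)
    obtain ⟨b, hb⟩ := not_isCofinal_iff.1 this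
    exact ⟨b, b.2, fun i hi => (hb _ ⟨⟨i, hi⟩, rfl⟩).le⟩
  have hsδ : ∀ j, s j < δ := by
    intro j
    induction j using WellFoundedLT.induction with
    | ind j ih =>
      obtain ⟨b, hb, hbj⟩ := hbd j ih
      rw [hs]
      refine hEs _ (max_lt ?_ (q j : Set.Iio δ).2)
      refine lt_of_le_of_lt (hlub _ b ?_).2 hb
      rintro _ ⟨i, hi, rfl⟩
      exact hbj i hi
  have hle : ∀ i j, i < j → s i ≤ c j := by
    intro i j hij
    refine (hlub _ δ ?_).1 _ ⟨i, hij, rfl⟩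
    rintro _ ⟨i, hi, rfl⟩
    exact (hsδ i).le
  have hcle : ∀ j u, (∀ i < j, s i ≤ u) → c j ≤ u := by
    intro j u hu
    refine (hlub _ u ?_).2
    rintro _ ⟨i, hi, rfl⟩
    exact hu i hi
  have hlt : ∀ j, c j < s j := fun j => by
    rw [hs]
    exact (le_max_left _ _).trans_lt (hstep_lt _)
  have hcases : ∀ j, (∃ i < j, c j = s i) ∨ (∀ i < j, s i < c j) := by
    intro j
    by_cases hc : ∃ i < j, c j = s i
    · exact Or.inl hc
    · push Not at hc
      exact Or.inr fun i hi => lt_of_le_of_ne (hle i j hi) (hc i hi).symm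
  have hex : ∀ j, ∀ b < c j, ∃ i < j, b < s i := by
    intro j b hb
    by_contra! hc
    exact (hcle j b hc).not_gt hb
  have hlim : ∀ j, (∀ i < j, s i < c j) → IsLim (c j) := fun j hj b hb => by
    obtain ⟨i, hi, hbi⟩ := hex j b hb
    exact ⟨s i, hj i hi, hbi⟩
  have hmono : ∀ i j, s i < s j → i < j := by
    intro i j hij
    by_contra! hc
    rcases hc.eq_or_lt with rfl | hc
    · exact lt_irrefl _ hij
    · exact ((hle j i hc).trans_lt (hlt i)).not_gt hij
  refine ⟨s, c, hlt, hsδ, hle, fun b hb => ?_, fun j => ?_, fun j => by rw [hs]; exact hstepT _,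
    fun j => ?_⟩
  · obtain ⟨w, hw, hbw⟩ := hW ⟨b, hb⟩
    refine ⟨q.symm ⟨w, hw⟩, ?_⟩
    rw [hs, q.apply_symm_apply]
    exact lt_of_le_of_lt ((show b ≤ w from hbw).trans (le_max_right _ _)) (hstep_lt _)
  · rcases hcases j with ⟨i, hi, he⟩ | hc
    · rw [he, hs]
      exact hstepT _
    · by_contra hcT
      have hclosed : ∀ b < c j, E0 b < c j := by
        intro b hb
        obtain ⟨i, hi, hbi⟩ := hex j b hb
        obtain ⟨i', hi', hii⟩ := hex j _ (hc i hi)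
        refine lt_trans ?_ (hc i' hi')
        rw [hs i']
        refine hstepE _ _ ?_
        exact hbi.le.trans ((hle i i' (hmono _ _ hii)).trans (le_max_left _ _))
      have h1 := hE0 _ hcT (hlim j hc) hclosed
      have h2 : IsCofinal (Set.range fun i : Set.Iio j => (⟨s i, hc i i.2⟩ : Set.Iio (c j))) := by
        intro b
        obtain ⟨i, hi, hbi⟩ := hex j b b.2
        exact ⟨_, ⟨⟨i, hi⟩, rfl⟩, hbi.le⟩
      have h3 := (Order.cof_le h2).trans Cardinal.mk_range_le
      rw [h1] at h3
      exact h3.not_gt (hΘ j)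
  · rcases hcases j with ⟨i, hi, he⟩ | hc
    · rw [he]
      exact le_iSup₂_of_le i hi le_rfl
    · refine (h.lim _ (hlim j hc)).trans (iSup₂_le fun b hb => ?_)
      obtain ⟨i, hi, hbi⟩ := hex j b hb
      exact le_iSup₂_of_le i hi (h.mono hbi.le)

end Ladder

section Glue

theorem relFree_map_iff {A B : Type*} [AddCommGroup A] [AddCommGroup B] {N P : Submodule ℤ A}
    {N' : Submodule ℤ B} (ι : A →ₗ[ℤ] B) (h : ∀ p ∈ P, ι p ∈ N' ↔ p ∈ N) :
    RelFree N' (P.map ι) ↔ RelFree N P := by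
  have h1 : (P.map ι).map N'.mkQ = LinearMap.range ((N'.mkQ ∘ₗ ι) ∘ₗ P.subtype) := by
    rw [LinearMap.range_comp, Submodule.range_subtype, Submodule.map_comp]
  rw [relFree_iff_of_hom ((N'.mkQ ∘ₗ ι) ∘ₗ P.subtype) fun x => by simpa using h x x.2]
  unfold RelFree
  rw [h1]

/-- Free groups amalgamated along relations: the basis element `b r` of the copy of the group with
index `dl r` is identified with the element `w r` of a free group, living over the node `nd r`. -/
structure GlueData (R X I U G : Type*) [AddCommGroup G] where
  /-- the copy in which the relation takes place -/
  dl : R → U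
  /-- the basis element -/
  b : R → G
  /-- the node of the relation -/
  nd : R → X
  /-- the element with which the basis element is identified -/
  w : R → (X × I →₀ ℤ)
  /-- a coordinate where `w` has coefficient one -/
  lead : R → I
  indep : ∀ δ, LinearIndepOn ℤ b {r | dl r = δ}
  inj : ∀ r r', dl r = dl r' → nd r = nd r' → r = r'
  supp : ∀ r p, w r p ≠ 0 → p.1 = nd r
  coeff : ∀ r, w r (nd r, lead r) = 1

namespace GlueData

variable {R X I U G : Type*} [AddCommGroup G] (D : GlueData R X I U G)

/-- The relation vectors. -/
noncomputable def rel (r : R) : (X × I →₀ ℤ) × (U →₀ G) :=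
  (-D.w r, Finsupp.single (D.dl r) (D.b r))

/-- The subgroup of relations. -/
noncomputable def K : Submodule ℤ ((X × I →₀ ℤ) × (U →₀ G)) :=
  LinearMap.range (Finsupp.linearCombination ℤ D.rel)

/-- Elements supported on prescribed nodes and subgroups. -/
def box (Y : Set X) (Q : U → Submodule ℤ G) : Submodule ℤ ((X × I →₀ ℤ) × (U →₀ G)) where
  carrier := {p | (∀ z, p.1 z ≠ 0 → z.1 ∈ Y) ∧ ∀ δ, p.2 δ ∈ Q δ}
  add_mem' := by
    rintro p q ⟨hp, hp'⟩ ⟨hq, hq'⟩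
    refine ⟨fun z hz => ?_, fun δ => add_mem (hp' δ) (hq' δ)⟩
    by_contra hY
    have h1 : p.1 z = 0 := by_contra fun h => hY (hp z h)
    have h2 : q.1 z = 0 := by_contra fun h => hY (hq z h)
    exact hz (by simp [h1, h2])
  zero_mem' := ⟨fun z hz => (hz rfl).elim, fun δ => zero_mem _⟩
  smul_mem' := by
    rintro a p ⟨hp, hp'⟩
    refine ⟨fun z hz => hp z fun h => hz (by simp [h]), fun δ => Submodule.smul_mem _ a (hp' δ)⟩

theorem mem_box {Y : Set X} {Q : U → Submodule ℤ G} {p : (X × I →₀ ℤ) × (U →₀ G)} :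
    p ∈ box Y Q ↔ (∀ z, p.1 z ≠ 0 → z.1 ∈ Y) ∧ ∀ δ, p.2 δ ∈ Q δ := Iff.rfl

theorem box_mono {Y Y' : Set X} {Q Q' : U → Submodule ℤ G} (hY : Y ⊆ Y') (hQ : Q ≤ Q') :
    (box Y Q : Submodule ℤ ((X × I →₀ ℤ) × (U →₀ G))) ≤ box Y' Q' :=
  fun _ hp => ⟨fun z hz => hY (hp.1 z hz), fun δ => hQ δ (hp.2 δ)⟩

theorem box_le {Y : Set X} {Q : U → Submodule ℤ G} {S : Submodule ℤ ((X × I →₀ ℤ) × (U →₀ G))}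
    (h1 : ∀ n ∈ Y, ∀ i, (Finsupp.single (n, i) 1, 0) ∈ S)
    (h2 : ∀ δ, ∀ q ∈ Q δ, (0, Finsupp.single δ q) ∈ S) : box Y Q ≤ S := by
  rintro ⟨x, h⟩ ⟨hx, hh⟩
  have e : (x, h) = LinearMap.inl ℤ _ _ x + LinearMap.inr ℤ _ _ h := by simp
  rw [e]
  refine add_mem ?_ ?_
  · rw [← Finsupp.sum_single x, Finsupp.sum, map_sum]
    refine sum_mem fun z hz => ?_
    have : Finsupp.single z (x z) = x z • Finsupp.single z (1 : ℤ) := by simp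
    rw [this, map_smul]
    exact Submodule.smul_mem _ _ (h1 z.1 (hx z (Finsupp.mem_support_iff.1 hz)) z.2)
  · rw [← Finsupp.sum_single h, Finsupp.sum, map_sum]
    exact sum_mem fun δ _ => h2 δ _ (hh δ)

/-- All nodes of elements of `Q` lie in `Y`. -/
def Closed (Y : Set X) (Q : U → Submodule ℤ G) : Prop :=
  ∀ c : R →₀ ℤ, ∀ δ, (∀ r ∈ c.support, D.dl r = δ) → Finsupp.linearCombination ℤ D.b c ∈ Q δ →
    ∀ r ∈ c.support, D.nd r ∈ Y

open Classical in
theorem linearCombination_rel_snd (c : R →₀ ℤ) (δ : U) :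
    (Finsupp.linearCombination ℤ D.rel c).2 δ =
      Finsupp.linearCombination ℤ D.b (c.filter fun r => D.dl r = δ) := by
  induction c using Finsupp.induction_linear with
  | zero => rw [Finsupp.filter_zero]; simp
  | add f g hf hg => rw [map_add, Finsupp.filter_add, map_add, ← hf, ← hg]; simp
  | single r a =>
    by_cases h : D.dl r = δ
    · rw [Finsupp.filter_single_of_pos (fun r => D.dl r = δ) h]
      simp [rel, h]
    · rw [Finsupp.filter_single_of_neg (fun r => D.dl r = δ) h]
      simp [rel, h]

theorem linearCombination_rel_fst (c : R →₀ ℤ) (z : X × I) :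
    (Finsupp.linearCombination ℤ D.rel c).1 z = -∑ r ∈ c.support, c r * D.w r z := by
  rw [Finsupp.linearCombination_apply, Finsupp.sum, Prod.fst_sum, Finsupp.finsetSum_apply,
    ← Finset.sum_neg_distrib]
  refine Finset.sum_congr rfl fun r _ => ?_
  simp [rel]

theorem fst_ne_zero {Y : Set X} {c : R →₀ ℤ} (h : ∀ r ∈ c.support, D.nd r ∈ Y) {z : X × I}
    (hz : (Finsupp.linearCombination ℤ D.rel c).1 z ≠ 0) : z.1 ∈ Y := by
  rw [linearCombination_rel_fst, neg_ne_zero] at hz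
  obtain ⟨r, hr, hrz⟩ := Finset.exists_ne_zero_of_sum_ne_zero hz
  rw [D.supp r z (right_ne_zero_of_mul hrz)]
  exact h r hr

open Classical in
theorem nd_mem_of_filter {Y : Set X} {Q : U → Submodule ℤ G} (hcl : D.Closed Y Q) {c : R →₀ ℤ}
    {r : R} (hr : r ∈ c.support)
    (h : Finsupp.linearCombination ℤ D.b (c.filter fun r' => D.dl r' = D.dl r) ∈ Q (D.dl r)) :
    D.nd r ∈ Y := by
  refine hcl _ (D.dl r) (fun r' hr' => ?_) h r ?_
  · rw [Finsupp.support_filter] at hr'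
    exact (Finset.mem_filter.1 hr').2
  · rw [Finsupp.support_filter]
    exact Finset.mem_filter.2 ⟨hr, rfl⟩

open Classical in
theorem nd_mem {Y : Set X} {Q : U → Submodule ℤ G} (hcl : D.Closed Y Q) {c : R →₀ ℤ} {δ : U}
    (h1 : ∀ δ' ≠ δ, Finsupp.linearCombination ℤ D.b (c.filter fun r => D.dl r = δ') ∈ Q δ')
    (h2 : ∀ r ∈ c.support, D.dl r = δ → D.nd r ∉ Y →
      (Finsupp.linearCombination ℤ D.rel c).1 (D.nd r, D.lead r) = 0) :
    ∀ r ∈ c.support, D.nd r ∈ Y := by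
  intro r hr
  have hother : ∀ r ∈ c.support, D.dl r ≠ δ → D.nd r ∈ Y := fun r hr hδ =>
    D.nd_mem_of_filter hcl hr (h1 _ hδ)
  by_cases hδ : D.dl r = δ
  swap
  · exact hother r hr hδ
  by_contra hY
  have h3 := h2 r hr hδ hY
  rw [linearCombination_rel_fst, neg_eq_zero, Finset.sum_eq_single r, D.coeff, mul_one] at h3
  · exact (Finsupp.mem_support_iff.1 hr) h3
  · intro r' hr' hne
    by_contra hc
    have hnd := D.supp r' _ (right_ne_zero_of_mul hc)
    by_cases hδ' : D.dl r' = δ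
    · exact hne (D.inj r' r (hδ'.trans hδ.symm) hnd.symm)
    · exact hY (hnd.symm ▸ hother r' hr' hδ' : (D.nd r, D.lead r).1 ∈ Y)
  · exact fun h => (h hr).elim

theorem rel_mem (r : R) : D.rel r ∈ D.K := ⟨Finsupp.single r 1, by simp⟩

theorem single_mem_iff {Y : Set X} {Q : U → Submodule ℤ G} (hcl : D.Closed Y Q) (δ : U) (h : G) :
    (0, Finsupp.single δ h) ∈ D.K ⊔ box Y Q ↔
      h ∈ Q δ ⊔ Submodule.span ℤ (D.b '' {r | D.dl r = δ ∧ D.nd r ∈ Y}) := by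
  classical
  constructor
  · intro hm
    obtain ⟨_, ⟨c, rfl⟩, q, hq, hs⟩ := Submodule.mem_sup.1 hm
    have hs1 : ∀ z, (Finsupp.linearCombination ℤ D.rel c).1 z + q.1 z = 0 := fun z => by
      rw [← Finsupp.add_apply, ← Prod.fst_add, hs]
      rfl
    have hs2 : ∀ δ', (Finsupp.linearCombination ℤ D.rel c).2 δ' + q.2 δ' =
        Finsupp.single δ h δ' := fun z => by
      rw [← Finsupp.add_apply, ← Prod.snd_add, hs]
    simp only [linearCombination_rel_snd] at hs2
    have key := D.nd_mem hcl (c := c) (δ := δ) (fun δ' hδ' => by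
      have h1 := hs2 δ'
      rw [Finsupp.single_eq_of_ne hδ'] at h1
      rw [eq_neg_of_add_eq_zero_left h1]
      exact neg_mem (hq.2 δ')) (fun r hr _ hY => by
      have h1 := hs1 (D.nd r, D.lead r)
      have h2 : q.1 (D.nd r, D.lead r) = 0 := by_contra fun hc => hY (hq.1 _ hc)
      rwa [h2, add_zero] at h1)
    have h1 := hs2 δ
    rw [Finsupp.single_eq_same] at h1
    rw [← h1, add_comm]
    refine Submodule.add_mem_sup (hq.2 δ) ?_
    rw [Finsupp.linearCombination_apply]
    refine sum_mem fun r hr => Submodule.smul_mem _ _ (Submodule.subset_span ⟨r, ?_, rfl⟩)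
    rw [Finsupp.support_filter, Finset.mem_filter] at hr
    exact ⟨hr.2, key r hr.1⟩
  · intro hm
    let ι : G →ₗ[ℤ] (X × I →₀ ℤ) × (U →₀ G) := LinearMap.inr ℤ _ _ ∘ₗ Finsupp.lsingle δ
    have hle : Q δ ⊔ Submodule.span ℤ (D.b '' {r | D.dl r = δ ∧ D.nd r ∈ Y}) ≤
        (D.K ⊔ box Y Q).comap ι := by
      refine sup_le (fun q hq => ?_) (Submodule.span_le.2 ?_)
      · refine Submodule.mem_sup_right ⟨fun z hz => (hz rfl).elim, fun δ' => ?_⟩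
        by_cases hδ : δ' = δ
        · subst hδ; simpa [ι] using hq
        · simp [ι, Finsupp.single_eq_of_ne hδ]
      · rintro _ ⟨r, ⟨rfl, hr⟩, rfl⟩
        have e : ι (D.b r) = D.rel r + (D.w r, 0) := by simp [ι, rel]
        change ι (D.b r) ∈ D.K ⊔ box Y Q
        rw [e]
        refine Submodule.add_mem_sup (D.rel_mem r) (mem_box.2 ⟨fun z hz => ?_, fun δ' => by simp⟩)
        rw [D.supp r z hz]
        exact hr
    exact hle hm

/-- The free group on a set of coordinates. -/
noncomputable def coord (S : Set (X × I)) : Submodule ℤ ((X × I →₀ ℤ) × (U →₀ G)) :=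
  (Finsupp.supported ℤ ℤ S).map (LinearMap.inl ℤ _ _)

theorem mem_coord {S : Set (X × I)} {p : (X × I →₀ ℤ) × (U →₀ G)} :
    p ∈ coord S ↔ (∀ z, p.1 z ≠ 0 → z ∈ S) ∧ p.2 = 0 := by
  constructor
  · rintro ⟨x, hx, rfl⟩
    refine ⟨fun z hz => ?_, rfl⟩
    exact (Finsupp.mem_supported ℤ x).1 hx (Finsupp.mem_support_iff.2 hz)
  · rintro ⟨h1, h2⟩
    refine ⟨p.1, (Finsupp.mem_supported ℤ _).2 fun z hz => h1 z (Finsupp.mem_support_iff.1 hz), ?_⟩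
    ext1 <;> simp [h2]

theorem single_mem_coord {S : Set (X × I)} {z : X × I} (hz : z ∈ S) :
    ((Finsupp.single z 1, 0) : (X × I →₀ ℤ) × (U →₀ G)) ∈ coord S := by
  classical
  refine mem_coord.2 ⟨fun z' hz' => ?_, rfl⟩
  have : z' = z := by_contra fun h => hz' (Finsupp.single_eq_of_ne h)
  exact this ▸ hz

theorem relFree_coord {S : Set (X × I)} {N : Submodule ℤ ((X × I →₀ ℤ) × (U →₀ G))}
    (h : Disjoint N (coord S)) : RelFree N (coord S) := by
  refine relFree_of_disjoint ?_ h
  have : Module.Free ℤ (Finsupp.supported ℤ ℤ S) := free_submodule _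
  exact Module.Free.of_equiv (Submodule.equivMapOfInjective _ LinearMap.inl_injective _)

open Classical in
theorem mem_of_disjoint_aux {Y : Set X} {Q : U → Submodule ℤ G}
    {p : (X × I →₀ ℤ) × (U →₀ G)} (hp : p ∈ D.K ⊔ box Y Q) (hp2 : p.2 = 0) :
    ∃ c : R →₀ ℤ, (∀ δ, Finsupp.linearCombination ℤ D.b (c.filter fun r => D.dl r = δ) ∈ Q δ) ∧
      ∀ z, z.1 ∉ Y → p.1 z = (Finsupp.linearCombination ℤ D.rel c).1 z := by
  obtain ⟨_, ⟨c, rfl⟩, q, hq, rfl⟩ := Submodule.mem_sup.1 hp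
  refine ⟨c, fun δ => ?_, fun z hz => ?_⟩
  · have h1 : (Finsupp.linearCombination ℤ D.rel c).2 δ + q.2 δ = 0 := by
      rw [← Finsupp.add_apply, ← Prod.snd_add, hp2]
      rfl
    rw [← linearCombination_rel_snd, eq_neg_of_add_eq_zero_left h1]
    exact neg_mem (hq.2 δ)
  · have : q.1 z = 0 := by_contra fun hc => hz (hq.1 _ hc)
    simp [this]

theorem relFree_box_nodes {Y : Set X} {Q : U → Submodule ℤ G} (hcl : D.Closed Y Q) (Y' : Set X) :
    RelFree (D.K ⊔ box Y Q) (D.K ⊔ box Y' Q) := by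
  classical
  refine (relFree_coord (S := {z | z.1 ∈ Y' \ Y}) ?_).mono (sup_le ?_ (box_le ?_ ?_))
  · rw [Submodule.disjoint_def]
    intro p hp hp'
    rw [mem_coord] at hp'
    obtain ⟨c, hc1, hc2⟩ := D.mem_of_disjoint_aux hp hp'.2
    refine Prod.ext (Finsupp.ext fun z => ?_) hp'.2
    by_contra hz
    have h1 := (hp'.1 z hz).2
    rw [hc2 z h1] at hz
    exact h1 (D.fst_ne_zero (fun r hr => D.nd_mem_of_filter hcl hr (hc1 _)) hz)
  · exact le_sup_left.trans le_sup_left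
  · intro n hn i
    by_cases h : n ∈ Y
    · refine Submodule.mem_sup_left (Submodule.mem_sup_right ⟨fun z hz => ?_, fun δ => by simp⟩)
      have : z = (n, i) := by_contra fun h => hz (Finsupp.single_eq_of_ne h)
      rwa [this]
    · exact Submodule.mem_sup_right (single_mem_coord ⟨hn, h⟩)
  · intro δ q hq
    refine Submodule.mem_sup_left (Submodule.mem_sup_right ⟨fun z hz => (hz rfl).elim, fun δ' => ?_⟩)
    by_cases h : δ' = δ
    · subst h; simpa using hq
    · simp [Finsupp.single_eq_of_ne h]

open Classical in
theorem relFree_box_update {Y : Set X} {Q : U → Submodule ℤ G} (hcl : D.Closed Y Q) {δ : U}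
    {P : Submodule ℤ G} (hP : Q δ ≤ P)
    (hsupp : ∀ c : R →₀ ℤ, (∀ r ∈ c.support, D.dl r = δ) → Finsupp.linearCombination ℤ D.b c ∈ P →
      ∀ r ∈ c.support, D.b r ∈ P)
    (hfree : RelFree (Q δ ⊔ Submodule.span ℤ (D.b '' {r | D.dl r = δ ∧ D.nd r ∈ Y})) P) :
    RelFree (D.K ⊔ box Y Q)
      (D.K ⊔ box (Y ∪ D.nd '' {r | D.dl r = δ ∧ D.b r ∈ P}) (Function.update Q δ P)) := by
  let ι : G →ₗ[ℤ] (X × I →₀ ℤ) × (U →₀ G) := LinearMap.inr ℤ _ _ ∘ₗ Finsupp.lsingle δ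
  have hι : ∀ g, ι g = (0, Finsupp.single δ g) := fun g => rfl
  have h1 : RelFree (D.K ⊔ box Y Q) (P.map ι) :=
    (relFree_map_iff ι fun p _ => by rw [hι, D.single_mem_iff hcl]).2 hfree
  have hQ : Q ≤ Function.update Q δ P := by
    intro δ'
    by_cases h : δ' = δ
    · subst h; simpa using hP
    · rw [Function.update_of_ne h]
  have hle : box Y Q ⊔ P.map ι ≤ box Y (Function.update Q δ P) := by
    refine sup_le (box_mono le_rfl hQ) ?_
    rintro _ ⟨p, hp, rfl⟩
    refine ⟨fun z hz => (hz rfl).elim, fun δ' => ?_⟩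
    by_cases h : δ' = δ
    · subst h; simpa [hι] using hp
    · simp [hι, Finsupp.single_eq_of_ne h]
  let S : Set (X × I) := {z | ∃ r, D.dl r = δ ∧ D.b r ∈ P ∧ D.nd r = z.1 ∧ z.1 ∉ Y ∧
    z.2 ≠ D.lead r}
  have h2 : RelFree ((D.K ⊔ box Y Q) ⊔ P.map ι) (coord S) := by
    refine relFree_coord ?_
    rw [Submodule.disjoint_def]
    intro p hp hp'
    rw [sup_assoc] at hp
    replace hp := sup_le_sup_left hle _ hp
    rw [mem_coord] at hp'
    obtain ⟨c, hc1, hc2⟩ := D.mem_of_disjoint_aux hp hp'.2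
    have hnd := D.nd_mem hcl (c := c) (δ := δ) (fun δ' hδ' => by
      have := hc1 δ'
      rwa [Function.update_of_ne hδ'] at this) (fun r hr hδ hY => by
      rw [← hc2 (D.nd r, D.lead r) hY]
      by_contra hz
      obtain ⟨r', hr'1, hr'2, hr'3, hr'4, hr'5⟩ := hp'.1 _ hz
      exact hr'5 (by rw [D.inj r' r (hr'1.trans hδ.symm) hr'3]))
    refine Prod.ext (Finsupp.ext fun z => ?_) hp'.2
    by_contra hz
    obtain ⟨r', hr'1, hr'2, hr'3, hr'4, hr'5⟩ := hp'.1 _ hz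
    rw [hc2 z hr'4] at hz
    exact hr'4 (D.fst_ne_zero hnd hz)
  refine (h1.trans h2).mono (sup_le ?_ (box_le ?_ ?_))
  · exact le_sup_left.trans le_sup_left
  · intro n hn i
    have hYmem : ∀ x : X × I →₀ ℤ, (∀ z, x z ≠ 0 → z.1 ∈ Y) →
        ((x, 0) : (X × I →₀ ℤ) × (U →₀ G)) ∈ D.K ⊔ box Y Q ⊔ (P.map ι ⊔ coord S) := fun x hx =>
      Submodule.mem_sup_left (Submodule.mem_sup_right ⟨hx, fun δ => by simp⟩)
    by_cases h : n ∈ Y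
    · refine hYmem _ fun z hz => ?_
      have : z = (n, i) := by_contra fun h => hz (Finsupp.single_eq_of_ne h)
      rwa [this]
    · obtain ⟨r, ⟨hr1, hr2⟩, rfl⟩ := hn.resolve_left h
      have hcoord : ∀ i ≠ D.lead r, ((Finsupp.single (D.nd r, i) 1, 0) :
          (X × I →₀ ℤ) × (U →₀ G)) ∈ D.K ⊔ box Y Q ⊔ (P.map ι ⊔ coord S) := fun i hi =>
        Submodule.mem_sup_right (Submodule.mem_sup_right
          (single_mem_coord ⟨r, hr1, hr2, rfl, h, hi⟩))
      by_cases hi : i = D.lead r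
      swap
      · exact hcoord i hi
      subst hi
      have hw : ((D.w r, 0) : (X × I →₀ ℤ) × (U →₀ G)) ∈
          D.K ⊔ box Y Q ⊔ (P.map ι ⊔ coord S) := by
        have e : ((D.w r, 0) : (X × I →₀ ℤ) × (U →₀ G)) = ι (D.b r) - D.rel r := by
          simp [hι, rel, hr1]
        rw [e]
        exact sub_mem (Submodule.mem_sup_right (Submodule.mem_sup_left ⟨_, hr2, rfl⟩))
          (Submodule.mem_sup_left (Submodule.mem_sup_left (D.rel_mem r)))
      have hrest : ((D.w r - Finsupp.single (D.nd r, D.lead r) 1, 0) :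
          (X × I →₀ ℤ) × (U →₀ G)) ∈ D.K ⊔ box Y Q ⊔ (P.map ι ⊔ coord S) := by
        refine Submodule.mem_sup_right (Submodule.mem_sup_right (mem_coord.2 ⟨fun z hz => ?_, rfl⟩))
        by_cases hz' : z = (D.nd r, D.lead r)
        · subst hz'
          simp [D.coeff] at hz
        · simp only [Finsupp.coe_sub, Pi.sub_apply, Finsupp.single_eq_of_ne hz', sub_zero] at hz
          have hz1 := D.supp r z hz
          refine ⟨r, hr1, hr2, hz1.symm, hz1 ▸ h, fun hc => hz' (Prod.ext hz1 hc)⟩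
      have := sub_mem hw hrest
      simpa using this
  · intro δ' q hq
    by_cases h : δ' = δ
    · subst h
      rw [Function.update_self] at hq
      exact Submodule.mem_sup_right (Submodule.mem_sup_left ⟨q, hq, rfl⟩)
    · rw [Function.update_of_ne h] at hq
      refine Submodule.mem_sup_left (Submodule.mem_sup_right
        ⟨fun z hz => (hz rfl).elim, fun δ'' => ?_⟩)
      by_cases h' : δ'' = δ'
      · subst h'; simpa using hq
      · simp [Finsupp.single_eq_of_ne h']

end GlueData

end Glue

section GlueBase

namespace GlueData

variable {R X I U G : Type*} [AddCommGroup G] (D : GlueData R X I U G)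

theorem single_mem_box_left {Y : Set X} (Q : U → Submodule ℤ G) {n : X} (hn : n ∈ Y) (i : I) :
    ((Finsupp.single (n, i) 1, 0) : (X × I →₀ ℤ) × (U →₀ G)) ∈ box Y Q := by
  classical
  refine ⟨fun z hz => ?_, fun δ => by simp⟩
  have : z = (n, i) := by_contra fun h => hz (Finsupp.single_eq_of_ne h)
  rwa [this]

theorem single_mem_box_right (Y : Set X) {Q : U → Submodule ℤ G} {δ : U} {q : G} (hq : q ∈ Q δ) :
    ((0, Finsupp.single δ q) : (X × I →₀ ℤ) × (U →₀ G)) ∈ box Y Q := by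
  classical
  refine ⟨fun z hz => (hz rfl).elim, fun δ' => ?_⟩
  by_cases h : δ' = δ
  · subst h; simpa using hq
  · simp [Finsupp.single_eq_of_ne h]

/-- Adding copies of the group one at a time. -/
theorem relFree_base {J : Type*} [LinearOrder J] [WellFoundedLT J] {d : J → U}
    (hd : Function.Injective d) {Y₀ : Set X} {Q₀ Q₁ : U → Submodule ℤ G} (hcl : D.Closed Y₀ Q₀)
    (hle : Q₀ ≤ Q₁) (hoff : ∀ δ, (∀ j, d j ≠ δ) → Q₁ δ ≤ Q₀ δ)
    (hsupp : ∀ j, ∀ c : R →₀ ℤ, (∀ r ∈ c.support, D.dl r = d j) →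
      Finsupp.linearCombination ℤ D.b c ∈ Q₁ (d j) → ∀ r ∈ c.support, D.b r ∈ Q₁ (d j))
    (hfree : ∀ j, RelFree (Q₀ (d j) ⊔ Submodule.span ℤ (D.b '' {r | D.dl r = d j ∧
      (D.nd r ∈ Y₀ ∨ ∃ i < j, ∃ r', D.dl r' = d i ∧ D.b r' ∈ Q₁ (d i) ∧ D.nd r' = D.nd r)}))
      (Q₁ (d j))) (Y₁ : Set X) :
    RelFree (D.K ⊔ box Y₀ Q₀) (D.K ⊔ box Y₁ Q₁) := by
  classical
  let YY : Set J → Set X := fun A => Y₀ ∪ D.nd '' {r | ∃ i ∈ A, D.dl r = d i ∧ D.b r ∈ Q₁ (d i)}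
  let QQ : Set J → U → Submodule ℤ G := fun A δ => if ∃ i ∈ A, d i = δ then Q₁ δ else Q₀ δ
  let B : Set J → Submodule ℤ ((X × I →₀ ℤ) × (U →₀ G)) := fun A => D.K ⊔ box (YY A) (QQ A)
  have hQpos : ∀ A, ∀ i ∈ A, QQ A (d i) = Q₁ (d i) := fun A i hi => if_pos ⟨i, hi, rfl⟩
  have hQneg : ∀ A δ, (¬ ∃ i ∈ A, d i = δ) → QQ A δ = Q₀ δ := fun A δ h => if_neg h
  have hcA : ∀ A, D.Closed (YY A) (QQ A) := by
    intro A c δ hc hm r hr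
    by_cases h : ∃ i ∈ A, d i = δ
    · obtain ⟨i, hi, rfl⟩ := h
      rw [hQpos A i hi] at hm
      exact Or.inr ⟨r, ⟨i, hi, hc r hr, hsupp i c hc hm r hr⟩, rfl⟩
    · rw [hQneg A δ h] at hm
      exact Or.inl (hcl c δ hc hm r hr)
  have hYmono : ∀ A A', A ⊆ A' → YY A ⊆ YY A' := by
    intro A A' h
    refine Set.union_subset_union_right _ (Set.image_mono ?_)
    rintro r ⟨i, hi, h'⟩
    exact ⟨i, h hi, h'⟩
  have hQmono : ∀ A A', A ⊆ A' → QQ A ≤ QQ A' := by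
    intro A A' h δ
    by_cases h1 : ∃ i ∈ A, d i = δ
    · obtain ⟨i, hi, rfl⟩ := h1
      rw [hQpos A i hi, hQpos A' i (h hi)]
    · rw [hQneg A δ h1]
      by_cases h2 : ∃ i ∈ A', d i = δ
      · obtain ⟨i, hi, rfl⟩ := h2
        rw [hQpos A' i hi]
        exact hle _
      · rw [hQneg A' δ h2]
  have hBmono : ∀ A A', A ⊆ A' → B A ≤ B A' := fun A A' h =>
    sup_le_sup_left (box_mono (hYmono A A' h) (hQmono A A' h)) _
  have hBle : ∀ A, B A ≤ B ∅ ⊔ ⨆ i, ⨆ (_ : i ∈ A), B (Set.Iic i) := by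
    intro A
    have hB0 : B ∅ ≤ B ∅ ⊔ ⨆ i, ⨆ (_ : i ∈ A), B (Set.Iic i) := le_sup_left
    have hBi : ∀ i ∈ A, B (Set.Iic i) ≤ B ∅ ⊔ ⨆ i, ⨆ (_ : i ∈ A), B (Set.Iic i) := fun i hi =>
      le_sup_of_le_right (le_iSup₂_of_le i hi le_rfl)
    refine sup_le (le_sup_left.trans hB0) (box_le ?_ ?_)
    · rintro n (hn | ⟨r, ⟨i, hi, hr⟩, rfl⟩) k
      · exact hB0 (Submodule.mem_sup_right (single_mem_box_left _ (Set.mem_union_left _ hn) k))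
      · have hmem : D.nd r ∈ YY (Set.Iic i) := Or.inr ⟨r, ⟨i, le_rfl, hr⟩, rfl⟩
        exact hBi i hi (Submodule.mem_sup_right (single_mem_box_left _ hmem k))
    · intro δ q hq
      by_cases h1 : ∃ i ∈ A, d i = δ
      · obtain ⟨i, hi, rfl⟩ := h1
        rw [hQpos A i hi] at hq
        refine hBi i hi (Submodule.mem_sup_right (single_mem_box_right _ ?_))
        rwa [hQpos _ i (show i ∈ Set.Iic i from le_rfl)]
      · rw [hQneg A δ h1] at hq
        refine hB0 (Submodule.mem_sup_right (single_mem_box_right _ ?_))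
        rwa [hQneg _ δ (by simp)]
  have hBeq : ∀ A : Set J, (∀ i ∈ A, Set.Iic i ⊆ A) →
      B ∅ ⊔ ⨆ i, ⨆ (_ : i ∈ A), B (Set.Iic i) = B A := fun A hA =>
    le_antisymm (sup_le (hBmono _ _ (Set.empty_subset _))
      (iSup₂_le fun i hi => hBmono _ _ (hA i hi))) (hBle A)
  have hstep : ∀ j, RelFree (B ∅ ⊔ ⨆ i, ⨆ (_ : i < j), B (Set.Iic i)) (B (Set.Iic j)) := by
    intro j
    have e := hBeq (Set.Iio j) fun i hi k hk => lt_of_le_of_lt hk hi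
    simp only [Set.mem_Iio] at e
    rw [e]
    have hj : ¬ ∃ i ∈ Set.Iio j, d i = d j := by
      rintro ⟨i, hi, hij⟩
      exact (hd hij ▸ hi : j ∈ Set.Iio j).ne rfl
    have e1 : YY (Set.Iic j) = YY (Set.Iio j) ∪ D.nd '' {r | D.dl r = d j ∧ D.b r ∈ Q₁ (d j)} := by
      simp only [YY]
      rw [Set.union_assoc, ← Set.image_union]
      congr 2
      ext r
      constructor
      · rintro ⟨i, hi, h⟩
        rcases (show i ≤ j from hi).eq_or_lt with rfl | hi
        · exact Or.inr h
        · exact Or.inl ⟨i, hi, h⟩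
      · rintro (⟨i, hi, h⟩ | h)
        · exact ⟨i, le_of_lt hi, h⟩
        · exact ⟨j, le_rfl, h⟩
    have e2 : QQ (Set.Iic j) = Function.update (QQ (Set.Iio j)) (d j) (Q₁ (d j)) := by
      funext δ
      by_cases hδ : δ = d j
      · subst hδ
        rw [Function.update_self, hQpos _ j (show j ∈ Set.Iic j from le_rfl)]
      · rw [Function.update_of_ne hδ]
        by_cases h1 : ∃ i ∈ Set.Iio j, d i = δ
        · obtain ⟨i, hi, rfl⟩ := h1
          rw [hQpos _ i hi, hQpos _ i (Set.Iio_subset_Iic_self hi)]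
        · rw [hQneg _ _ h1, hQneg]
          rintro ⟨i, hi, rfl⟩
          exact h1 ⟨i, lt_of_le_of_ne hi fun h => hδ (h ▸ rfl), rfl⟩
    simp only [B]
    rw [e1, e2]
    refine D.relFree_box_update (hcA _) ?_ (hsupp j) ?_
    · rw [hQneg _ _ hj]
      exact hle _
    · rw [hQneg _ _ hj]
      have e3 : {r | D.dl r = d j ∧ D.nd r ∈ YY (Set.Iio j)} = {r | D.dl r = d j ∧
        (D.nd r ∈ Y₀ ∨ ∃ i < j, ∃ r', D.dl r' = d i ∧ D.b r' ∈ Q₁ (d i) ∧ D.nd r' = D.nd r)} := by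
        ext r
        refine and_congr_right fun _ => or_congr_right ?_
        constructor
        · rintro ⟨r', ⟨i, hi, h1, h2⟩, h3⟩
          exact ⟨i, hi, r', h1, h2, h3⟩
        · rintro ⟨i, hi, r', h1, h2, h3⟩
          exact ⟨r', ⟨i, hi, h1, h2⟩, h3⟩
      rw [e3]
      exact hfree j
  have h1 := relFree_iSup_chain _ _ hstep
  have e0 := hBeq Set.univ fun i _ k _ => trivial
  simp only [Set.mem_univ, iSup_pos] at e0
  have hY0 : YY ∅ = Y₀ := by simp [YY]
  have hQ0 : QQ ∅ = Q₀ := by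
    funext δ
    exact hQneg _ _ (by simp)
  have hQ1 : QQ Set.univ = Q₁ := by
    funext δ
    by_cases h : ∃ i ∈ Set.univ, d i = δ
    · obtain ⟨i, hi, rfl⟩ := h
      rw [hQpos _ i hi]
    · rw [hQneg _ _ h]
      exact le_antisymm (hle δ) (hoff δ fun j hj => h ⟨j, trivial, hj⟩)
  have h2 := D.relFree_box_nodes (hcA Set.univ) Y₁
  rw [hQ1] at h2
  have h3 := h1.trans (P := D.K ⊔ box Y₁ Q₁) (by
    rw [e0]
    simpa only [B, hQ1] using h2)
  simp only [B, hY0, hQ0] at h3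
  exact h3.mono (le_sup_right.trans le_sup_right)

end GlueData

end GlueBase

section GlueExtension

namespace GlueData

theorem linearIndependent_rel {R X I U G : Type*} [AddCommGroup G] (D : GlueData R X I U G) :
    LinearIndependent ℤ D.rel := by
  classical
  rw [linearIndependent_iff]
  intro c hc
  ext r
  by_contra hr
  have h1 : Finsupp.linearCombination ℤ D.b (c.filter fun r' => D.dl r' = D.dl r) = 0 := by
    rw [← linearCombination_rel_snd, hc]
    rfl
  have h2 := linearIndepOn_iff.1 (D.indep (D.dl r)) (c.filter fun r' => D.dl r' = D.dl r)
    ((Finsupp.mem_supported ℤ _).2 fun r' hr' => by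
      rw [Finsupp.support_filter] at hr'
      exact (Finset.mem_filter.1 hr').2) h1
  have h3 := DFunLike.congr_fun h2 r
  rw [Finsupp.filter_apply_pos (fun r' => D.dl r' = D.dl r) c rfl] at h3
  exact hr h3

/-- If the glued group is `κ`-free, then it is a Whitehead group, and one can solve the
corresponding equations. -/
theorem exists_extension {κ : Cardinal.{u}} (hκ : ℵ₀ < κ)
    (hall : ∀ (G : Type u) (inst : AddCommGroup G),
      #G = κ → @IsKappaFree κ G inst → @IsWhitehead G inst)
    {R X I U G : Type u} [AddCommGroup G] (D : GlueData R X I U G) (H : U → Submodule ℤ G)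
    (hbH : ∀ r, D.b r ∈ H (D.dl r)) (hX : #X ≤ κ) (hI : #I ≤ κ) (hU : #U ≤ κ) (hG : #G ≤ κ)
    (hfree : ∀ P ≤ box Set.univ H, #P < κ → RelFree D.K P) (φ : R → ℤ) :
    ∃ (f : (X × I →₀ ℤ) →ₗ[ℤ] ℤ) (u : ∀ δ, H δ →ₗ[ℤ] ℤ),
      ∀ r, u (D.dl r) ⟨D.b r, hbH r⟩ = φ r + f (D.w r) := by
  classical
  let F : Submodule ℤ ((X × I →₀ ℤ) × (U →₀ G)) := box Set.univ H
  have hrel : ∀ r, D.rel r ∈ F := by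
    refine fun r => ⟨fun z _ => trivial, fun δ => ?_⟩
    by_cases h : δ = D.dl r
    · subst h; simpa [rel] using hbH r
    · simp [rel, Finsupp.single_eq_of_ne h]
  have hmax : ∀ {a b : Cardinal.{u}}, a ≤ κ → b ≤ κ → max a b ≤ κ := fun h1 h2 => max_le h1 h2
  have hprod : ∀ {a b : Cardinal.{u}}, a ≤ κ → b ≤ κ → a * b ≤ κ := fun h1 h2 =>
    (mul_le_mul' h1 h2).trans (Cardinal.mul_eq_self hκ.le).le
  have hfin : ∀ (A B : Type u) [Zero B], #A ≤ κ → #B ≤ κ → #(A →₀ B) ≤ κ := by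
    intro A B _ hA hB
    refine (Cardinal.mk_le_of_injective (f := fun x : A →₀ B => x.graph)
      (Finsupp.graph_injective A B)).trans ?_
    refine (Cardinal.mk_le_of_injective (f := fun x : Finset (A × B) => x.toList)
      fun x y hxy => by rw [← x.toList_toFinset, ← y.toList_toFinset, show x.toList = _ from hxy]).trans
        ((Cardinal.mk_list_le_max _).trans (hmax hκ.le ?_))
    rw [Cardinal.mk_prod, Cardinal.lift_id, Cardinal.lift_id]
    exact hprod hA hB
  have hV : #F ≤ κ := by
    refine (Cardinal.mk_subtype_le _).trans ?_
    rw [Cardinal.mk_prod, Cardinal.lift_id', Cardinal.lift_id']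
    refine hprod ?_ (hfin _ _ hU hG)
    have e := Cardinal.mk_congr (Finsupp.mapRange.equiv (Equiv.ulift.{u}.symm : ℤ ≃ ULift.{u} ℤ)
      rfl : (X × I →₀ ℤ) ≃ (X × I →₀ ULift.{u} ℤ))
    rw [e]
    refine hfin _ _ ?_ ?_
    · rw [Cardinal.mk_prod, Cardinal.lift_id, Cardinal.lift_id]
      exact hprod hX hI
    · simpa using hκ.le
  let e := LinearEquiv.ofInjective (Finsupp.linearCombination ℤ D.rel) D.linearIndependent_rel
  let K' : Submodule ℤ F := D.K.comap F.subtype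
  let φ' : K' →ₗ[ℤ] ℤ := (Finsupp.linearCombination ℤ φ ∘ₗ e.symm.toLinearMap) ∘ₗ
    (F.subtype.restrict fun x (hx : x ∈ K') => (hx : F.subtype x ∈ D.K))
  obtain ⟨ψ, hψ⟩ := exists_extension_of_relFree hκ hall hV K' (fun P hP => by
    refine (relFree_map_iff (N' := D.K) F.subtype fun p _ => Iff.rfl).1 (hfree _ ?_ ?_)
    · rintro _ ⟨p, -, rfl⟩
      exact p.2
    · exact (Cardinal.mk_image_le (f := F.subtype) (s := (P : Set F))).trans_lt hP)
    φ'
  have hF1 : ∀ x : X × I →₀ ℤ, LinearMap.inl ℤ _ (U →₀ G) x ∈ F := fun x =>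
    ⟨fun z _ => trivial, fun δ => by simp⟩
  have hF2 : ∀ δ, ∀ h : H δ, (LinearMap.inr ℤ (X × I →₀ ℤ) _ ∘ₗ Finsupp.lsingle δ ∘ₗ
      (H δ).subtype) h ∈ F := by
    refine fun δ h => ⟨fun z _ => trivial, fun δ' => ?_⟩
    by_cases h : δ' = δ
    · subst h; simp
    · simp [Finsupp.single_eq_of_ne h]
  refine ⟨ψ ∘ₗ LinearMap.codRestrict F (LinearMap.inl ℤ _ _) hF1,
    fun δ => ψ ∘ₗ LinearMap.codRestrict F _ (hF2 δ), fun r => ?_⟩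
  have h1 := hψ ⟨⟨D.rel r, hrel r⟩, D.rel_mem r⟩
  have h2 : φ' ⟨⟨D.rel r, hrel r⟩, D.rel_mem r⟩ = φ r := by
    have : e.symm ⟨D.rel r, D.rel_mem r⟩ = Finsupp.single r 1 := by
      rw [LinearEquiv.symm_apply_eq]
      ext1
      change D.rel r = Finsupp.linearCombination ℤ D.rel (Finsupp.single r 1)
      simp
    change Finsupp.linearCombination ℤ φ (e.symm ⟨D.rel r, D.rel_mem r⟩) = φ r
    rw [this]
    simp
  rw [h2] at h1
  rw [← h1, LinearMap.comp_apply, LinearMap.comp_apply, ← map_add]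
  congr 1
  ext1
  simp [rel]

end GlueData

end GlueExtension

section RegularCase

theorem linearIndepOn_iUnion_of_iSupIndep {A J : Type*} [AddCommGroup A] {B : J → Set A}
    (hB : ∀ j, LinearIndepOn ℤ id (B j)) (h : iSupIndep fun j => Submodule.span ℤ (B j)) :
    LinearIndepOn ℤ id (⋃ j, B j) := by
  refine linearIndepOn_id_iUnion_finite hB fun i t _ hit => (h i).mono_right ?_
  exact biSup_mono fun j hj hji => hit (hji ▸ hj)

theorem IsLadder.exists_basis {G O Θ : Type u} [AddCommGroup G] [LinearOrder O] [LinearOrder Θ]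
    [WellFoundedLT Θ] {μ : Cardinal.{u}} {N : O → Submodule ℤ G} {T : Set O} {δ : O} {s c : Θ → O}
    (h : IsGoodFiltration μ N T) (hl : IsLim δ) (hlad : IsLadder N T δ s c) :
    ∃ B : Θ → Set G, LinearIndepOn ℤ id (⋃ j, B j) ∧ (∀ i j, i ≠ j → Disjoint (B i) (B j)) ∧
      Submodule.span ℤ (⋃ j, B j) = N δ ∧
      (∀ g, Submodule.span ℤ (⋃ j, ⋃ (_ : j < g), B j) = N (c g)) ∧ ∀ g, B g ⊆ N (s g) := by
  have hc : ∀ j, (⨆ i, ⨆ (_ : i < j), N (s i)) = N (c j) := fun j =>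
    le_antisymm (iSup₂_le fun i hi => h.mono (hlad.le i j hi)) (hlad.le_iSup j)
  obtain ⟨C, hCle, hCfree, hind, hdisj, hsup, hCC⟩ := exists_compl_chain (fun j => N (s j))
    (fun j => by rw [hc]; exact h.relFree _ (hlad.mem j) _ (h.card _))
  choose B hB hspan using fun j => exists_basis_set (hCfree j)
  have hBind : LinearIndepOn ℤ id (⋃ j, B j) :=
    linearIndepOn_iUnion_of_iSupIndep hB (by simpa only [hspan] using hind)
  have hBC : ∀ j, B j ⊆ C j := fun j => by rw [← hspan j]; exact Submodule.subset_span
  have hCs : ∀ j i, j ≤ i → N (s j) ≤ ⨆ k, ⨆ (_ : k ≤ i), C k := fun j i hj => by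
    rw [hCC]; exact le_iSup₂_of_le j hj le_rfl
  refine ⟨B, hBind, fun i j hij => ?_, ?_, fun g => ?_, fun g => (hBC g).trans (hCle g)⟩
  · rw [Set.disjoint_left]
    intro x hi hj
    have h0 := Submodule.disjoint_def.1 (hind.pairwiseDisjoint hij) x (hBC i hi) (hBC j hj)
    exact (hB i).ne_zero hi h0
  · rw [Submodule.span_iUnion]
    simp only [hspan]
    apply le_antisymm
    · exact iSup_le fun j => (hCle j).trans (h.mono (hlad.lt_top j).le)
    · refine (h.lim δ hl).trans (iSup₂_le fun b hb => ?_)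
      obtain ⟨j, hj⟩ := hlad.cofinal b hb
      exact (h.mono hj.le).trans ((hCs j j le_rfl).trans (iSup₂_le fun k _ => _root_.le_iSup C k))
  · rw [Submodule.span_iUnion₂]
    simp only [hspan]
    rw [← hc]
    apply le_antisymm (iSup₂_mono fun i _ => hCle i)
    refine iSup₂_le fun i hi => (hCs i i le_rfl).trans (iSup₂_le fun k hk => ?_)
    exact le_iSup₂_of_le k (hk.trans_lt hi) le_rfl

/-- A set of fewer than `#Θ` elements of a regular well-order is strictly bounded. -/
theorem exists_gt_of_mk_lt_cof {Θ : Type u} [LinearOrder Θ] {s : Set Θ} (hs : #s < Order.cof Θ) :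
    ∃ x, ∀ y ∈ s, y < x :=
  not_isCofinal_iff.1 fun h => (Order.cof_le h).not_gt hs

theorem relFree_of_basis_subset {A : Type*} [AddCommGroup A] {B J K : Set A}
    (hB : LinearIndepOn ℤ id B) (hJ : J ⊆ K) (hK : K ⊆ B) {H : Submodule ℤ A}
    (hKH : Submodule.span ℤ K ≤ H) (h : RelFree (Submodule.span ℤ K) H) :
    RelFree (Submodule.span ℤ J) H := by
  have h1 : RelFree (Submodule.span ℤ J) (Submodule.span ℤ K) := by
    refine relFree_of_compl (C := Submodule.span ℤ (K \ J))
      (free_span_of_linearIndepOn (hB.mono (Set.sdiff_subset.trans hK))) ?_ ?_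
    · exact LinearIndepOn.disjoint_span hB (hJ.trans hK) (Set.sdiff_subset.trans hK)
        Set.disjoint_sdiff_right
    · rw [← Submodule.span_union, ← Submodule.span_union, Set.union_sdiff_self]
  have h2 := h1.trans (by rwa [sup_eq_right.2 (Submodule.span_mono hJ)] :
    RelFree (Submodule.span ℤ J ⊔ Submodule.span ℤ K) H)
  rwa [sup_eq_right.2 hKH] at h2

theorem IsGoodFiltration.false_of_regular {G O : Type u} [AddCommGroup G] [LinearOrder O]
    [WellFoundedLT O] {μ : Cardinal.{u}} {N : O → Submodule ℤ G} {T : Set O}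
    (gch : ∀ μ : Cardinal.{u}, ℵ₀ ≤ μ → (2 : Cardinal.{u}) ^ μ = Order.succ μ) (hμ : ℵ₀ ≤ μ)
    (hreg : μ.ord.cof = μ)
    (hleast : ∀ lam : Cardinal.{u}, ℵ₀ < lam ∧ ExistsKappaFreeWhiteheadNonfree lam →
      Order.succ μ ≤ lam)
    (hall : ∀ (G : Type u) (inst : AddCommGroup G),
      #G = Order.succ μ → @IsKappaFree (Order.succ μ) G inst → @IsWhitehead G inst)
    (h : IsGoodFiltration μ N T) (hO : IsSuccOrderType O μ) (hT : ∀ a, ∃ b ∈ T, a < b)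
    (hG : #G ≤ Order.succ μ)
    (hcof : ∃ E : O → O, ∀ δ ∉ T, IsLim δ → (∀ b < δ, E b < δ) →
      Order.cof (Set.Iio δ) = μ.ord.cof) : False := by
  classical
  let Θ := μ.ord.ToType
  have hΘ : #Θ = μ := Cardinal.mk_ord_toType μ
  have hΘlt : ∀ j : Θ, #(Set.Iio j) < μ := fun j =>
    (Cardinal.mk_Iio_lt j (by simp [Θ])).trans_eq hΘ
  have hΘcof : Order.cof Θ = μ := by rw [Ordinal.cof_toType, hreg]
  have hmax : NoMaxOrder Θ := Cardinal.noMaxOrder hμ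
  obtain ⟨E, hE⟩ := h.exists_fun_ladder hμ hO hT (Θ := Θ) (by rwa [hΘ]) (by
    obtain ⟨E, hE⟩ := hcof
    exact ⟨E, fun δ h1 h2 h3 => by rw [hE δ h1 h2 h3, hreg, hΘ]⟩)
  obtain ⟨δ, hδT, hδl, hδE⟩ := h.stationary E
  obtain ⟨s, c, hlad⟩ := hE δ hδT hδl hδE
  obtain ⟨B, hB, hBd, hBspan, hBc, -⟩ := hlad.exists_basis h hδl
  obtain ⟨δ', hδ'⟩ := hO.exists_gt_elem hμ δ
  have hLH : N δ ≤ N δ' := h.mono hδ'.le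
  obtain ⟨φ, hφ⟩ := exists_not_extending hleast hLH (h.free _ (h.card _))
    (Order.lt_succ_of_le (h.card δ')) (h.not_relFree δ hδT δ' hδ')
  let BB : Set G := ⋃ j, B j
  have hBN : ∀ m ∈ BB, m ∈ N δ := fun m hm => hBspan ▸ Submodule.subset_span hm
  have hjj : ∀ m : BB, ∃ j, (m : G) ∈ B j := fun m => Set.mem_iUnion.1 m.2
  choose jj hjj using hjj
  let D : GlueData ((Θ → Bool) × BB) ((Σ j : Θ, Set.Iic j → Bool) × BB) PUnit.{u + 1}
      (Θ → Bool) G :=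
    { dl := fun r => r.1
      b := fun r => r.2
      nd := fun r => (⟨jj r.2, fun i => r.1 i⟩, r.2)
      w := fun r => Finsupp.single ((⟨jj r.2, fun i => r.1 i⟩, r.2), PUnit.unit) 1
      lead := fun _ => PUnit.unit
      indep := by
        intro η
        have h1 : LinearIndependent ℤ (fun b : BB => (b : G)) := hB
        have : Function.Injective
            (fun r : {r : (Θ → Bool) × BB | r.1 = η} => r.1.2) := by
          rintro ⟨⟨a, b⟩, ha⟩ ⟨⟨a', b'⟩, ha'⟩ hab
          exact Subtype.ext (Prod.ext (ha.trans ha'.symm) hab)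
        exact h1.comp _ this
      inj := by
        rintro ⟨a, b⟩ ⟨a', b'⟩ h1 h2
        exact Prod.ext h1 (Prod.ext_iff.1 h2).2
      supp := by
        intro r p hp
        by_contra hne
        exact hp (Finsupp.single_eq_of_ne fun he => hne (congrArg Prod.fst he))
      coeff := fun r => Finsupp.single_eq_same }
  have hBcard : #BB ≤ μ := (Cardinal.mk_le_mk_of_subset hBN).trans (h.card δ)
  have hX : #((Σ j : Θ, Set.Iic j → Bool) × BB) ≤ μ := by
    have h1 : #(Σ j : Θ, Set.Iic j → Bool) ≤ μ := by
      rw [Cardinal.mk_sigma]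
      refine (Cardinal.sum_le_mk_mul_iSup _).trans ?_
      rw [hΘ]
      refine (mul_le_mul' le_rfl (ciSup_le' fun j => ?_)).trans (Cardinal.mul_eq_self hμ).le
      have : #(Set.Iic j → Bool) = 2 ^ #(Set.Iic j) := by simp
      rw [this]
      refine power_le_of_lt_of_lt gch hμ ((Cardinal.natCast_lt_aleph0 (n := 2)).trans_le hμ) ?_
      · obtain ⟨j', hj'⟩ := exists_gt j
        exact (Cardinal.mk_le_mk_of_subset fun x (hx : x ≤ j) => hx.trans_lt hj').trans_lt
          (hΘlt j')
    rw [Cardinal.mk_prod, Cardinal.lift_id, Cardinal.lift_id]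
    exact (mul_le_mul' h1 hBcard).trans (Cardinal.mul_eq_self hμ).le
  have hU : #(Θ → Bool) = Order.succ μ := by
    rw [← gch μ hμ]
    simp [hΘ]
  have hκ : ℵ₀ < Order.succ μ := Order.lt_succ_of_le hμ
  have hfree : ∀ P ≤ GlueData.box Set.univ (fun _ : Θ → Bool => N δ'), #P < Order.succ μ →
      RelFree D.K P := by
    intro P hP hPc
    have hPμ : #P ≤ μ := Order.lt_succ_iff.1 hPc
    let U' : Set (Θ → Bool) := ⋃ p : P, (p.1.2.support : Set (Θ → Bool))
    have hU' : #U' ≤ μ := by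
      refine (Cardinal.mk_iUnion_le _).trans ((mul_le_mul' hPμ (ciSup_le' fun p => ?_)).trans
        (Cardinal.mul_eq_self hμ).le)
      exact (Cardinal.lt_aleph0_of_finite _).le.trans hμ
    let J := (#U').ord.ToType
    obtain ⟨e⟩ : Nonempty (J ≃ U') := Cardinal.eq.1 (Cardinal.mk_ord_toType _)
    have hJ : ∀ j : J, #(Set.Iio j) < μ := fun j =>
      ((Cardinal.mk_Iio_lt j (by simp [J])).trans_eq (Cardinal.mk_ord_toType _)).trans_le hU'
    let Q₁ : (Θ → Bool) → Submodule ℤ G := fun η => if η ∈ U' then N δ' else ⊥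
    have hQ₁ : ∀ j, Q₁ (e j) = N δ' := fun j => if_pos (e j).2
    have hcl : D.Closed ∅ (fun _ => ⊥) := by
      intro a η ha hm r hr
      have := linearIndepOn_iff.1 (D.indep η) a ((Finsupp.mem_supported ℤ _).2 fun r hr => ha r hr) hm
      rw [this] at hr
      simp at hr
    have hbase := D.relFree_base (d := fun j => (e j : Θ → Bool))
      (Subtype.val_injective.comp e.injective) hcl (Q₁ := Q₁) (fun η => bot_le) (fun η hη => by
        have : η ∉ U' := fun hU => hη (e.symm ⟨η, hU⟩) (by simp)
        exact (if_neg this).le)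
      (fun j a _ _ r _ => by rw [hQ₁]; exact hLH (hBN _ r.2.2)) (fun j => by
        rw [hQ₁, bot_sup_eq]
        have hd : ∀ i : Set.Iio j, ∃ g, (e i.1 : Θ → Bool) g ≠ (e j : Θ → Bool) g := by
          intro i
          by_contra! hcon
          exact i.2.ne (e.injective (Subtype.ext (funext hcon)))
        choose dg hdg using hd
        obtain ⟨g, hg⟩ := exists_gt_of_mk_lt_cof (s := Set.range dg)
          (by rw [hΘcof]; exact Cardinal.mk_range_le.trans_lt (hJ j))
        refine relFree_of_basis_subset (K := ⋃ j, ⋃ (_ : j < g), B j) hB ?_ ?_ ?_ ?_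
        · rintro _ ⟨r, ⟨hr1, hr2⟩, rfl⟩
          rcases hr2 with hr2 | ⟨i, hi, r', hr1', -, hr3⟩
          · exact hr2.elim
          refine Set.mem_iUnion₂.2 ⟨jj r.2, ?_, hjj _⟩
          by_contra hlt
          apply hdg ⟨i, hi⟩
          obtain ⟨η, m⟩ := r
          obtain ⟨η', m'⟩ := r'
          change η = e j at hr1
          change η' = e i at hr1'
          obtain ⟨h1, rfl⟩ := Prod.ext_iff.1 hr3
          have h2 := congr_fun (eq_of_heq (Sigma.mk.inj h1).2)
            ⟨dg ⟨i, hi⟩, (hg _ ⟨_, rfl⟩).le.trans (not_lt.1 hlt)⟩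
          change η' _ = η _ at h2
          rw [hr1, hr1'] at h2
          exact h2
        · exact Set.iUnion₂_subset fun j _ => Set.subset_iUnion B j
        · rw [hBc]
          exact h.mono (((hlad.lt g).trans (hlad.lt_top g)).le.trans hδ'.le)
        · rw [hBc]
          exact h.relFree _ (hlad.mem g) _ (h.card _)) Set.univ
    have hb0 : D.K ⊔ GlueData.box ∅ (fun _ => ⊥) = D.K :=
      sup_eq_left.2 (GlueData.box_le (fun n hn => hn.elim) fun η q hq => by
        rw [(Submodule.mem_bot ℤ).1 hq, Finsupp.single_zero]; exact zero_mem _)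
    rw [hb0] at hbase
    refine hbase.mono fun p hp => Submodule.mem_sup_right (Submodule.mem_sup_right ?_)
    refine ⟨fun _ _ => trivial, fun η => ?_⟩
    by_cases hη : η ∈ U'
    · rw [show Q₁ η = N δ' from if_pos hη]
      exact (hP hp).2 η
    · have : p.2 η = 0 := by
        by_contra hne
        exact hη (Set.mem_iUnion.2 ⟨⟨p, hp⟩, by simpa using hne⟩)
      rw [this]
      exact zero_mem _
  have hsol := fun C : (Θ → Bool) → Bool => D.exists_extension hκ hall (fun _ => N δ')
    (fun r => hLH (hBN _ r.2.2)) (hX.trans (Order.le_succ μ)) (by simpa using hκ.le.trans' one_le_aleph0)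
    hU.le hG hfree (fun r => if C r.1 then φ ⟨r.2, hBN _ r.2.2⟩ else 0)
  choose f u hu using hsol
  have hinj : Function.Injective fun C (x : (Σ j : Θ, Set.Iic j → Bool) × BB) =>
      ULift.up.{u} (f C (Finsupp.single (x, PUnit.unit) 1)) := by
    have key : ∀ C C', (∀ x, f C (Finsupp.single (x, PUnit.unit) 1) =
        f C' (Finsupp.single (x, PUnit.unit) 1)) → ∀ η, C η = true → C' η = true := by
      intro C C' hCC η hη
      by_contra hη'
      refine hφ (u C η - u C' η) fun x hx => ?_
      have h1 : ∀ y ∈ Submodule.span ℤ BB, ∀ hy : y ∈ N δ,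
          (u C η - u C' η) ⟨y, hLH hy⟩ = φ ⟨y, hy⟩ := by
        intro y hy
        induction hy using Submodule.span_induction with
        | mem m hm =>
          intro hy
          have h2 := hu C (η, ⟨m, hm⟩)
          have h3 := hu C' (η, ⟨m, hm⟩)
          have h4 := hCC (⟨jj ⟨m, hm⟩, fun i => η i⟩, ⟨m, hm⟩)
          change u C η ⟨m, _⟩ = (if C η then φ ⟨m, _⟩ else 0) + f C (Finsupp.single _ 1) at h2
          change u C' η ⟨m, _⟩ = (if C' η then φ ⟨m, _⟩ else 0) + f C' (Finsupp.single _ 1) at h3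
          rw [if_pos hη, h4] at h2
          rw [if_neg hη'] at h3
          rw [LinearMap.sub_apply, h2, h3]
          abel
        | zero => intro hy; exact (map_zero (u C η - u C' η)).trans (map_zero φ).symm
        | add a b ha hb iha ihb =>
          intro hy
          have ha' : a ∈ N δ := hBspan ▸ ha
          have hb' : b ∈ N δ := hBspan ▸ hb
          have := congrArg₂ (· + ·) (iha ha') (ihb hb')
          simp only [← map_add] at this
          exact this
        | smul n a ha iha =>
          intro hy
          have ha' : a ∈ N δ := hBspan ▸ ha
          have := congrArg (n • ·) (iha ha')
          simp only [← map_smul] at this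
          exact this
      exact h1 x (hBspan.symm ▸ hx) hx
    intro C C' hCC
    have h1 : ∀ x, f C (Finsupp.single (x, PUnit.unit) 1) =
        f C' (Finsupp.single (x, PUnit.unit) 1) := fun x => ULift.up.inj (congr_fun hCC x)
    funext η
    exact Bool.eq_iff_iff.2 ⟨key C C' h1 η, key C' C (fun x => (h1 x).symm) η⟩
  have h1 := Cardinal.mk_le_of_injective hinj
  have h2 : #((Θ → Bool) → Bool) = 2 ^ Order.succ μ := by rw [← hU]; simp
  have h3 : #(((Σ j : Θ, Set.Iic j → Bool) × BB) → ULift.{u} ℤ) ≤ Order.succ μ := by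
    rw [← gch μ hμ, ← Cardinal.power_self_eq hμ, ← Cardinal.power_def]
    exact (Cardinal.power_le_power_right (by simpa using hμ)).trans
      (Cardinal.power_le_power_left (Cardinal.aleph0_pos.trans_le hμ).ne' hX)
  rw [h2] at h1
  exact (Cardinal.cantor _).not_ge (h1.trans h3)

end RegularCase

section Closure

theorem exists_closure {Ω : Type u} {θ : Cardinal.{u}} (hθ : ℵ₀ ≤ θ) (F : Ω → Ω → Set Ω)
    (hF : ∀ x y, #(F x y) ≤ θ) :
    ∃ cl : Set Ω → Set Ω, (∀ X, X ⊆ cl X) ∧ Monotone cl ∧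
      (∀ X P, X ⊆ P → (∀ x ∈ P, ∀ y ∈ P, F x y ⊆ P) → cl X ⊆ P) ∧
      (∀ X, ∀ x ∈ cl X, ∀ y ∈ cl X, F x y ⊆ cl X) ∧ ∀ X, #(cl X) ≤ max #X θ := by
  let step : Set Ω → Set Ω := fun A => A ∪ ⋃ p : A × A, F p.1 p.2
  let A : Set Ω → ℕ → Set Ω := fun X n => step^[n] X
  have hA : ∀ X n, A X (n + 1) = step (A X n) := fun X n => Function.iterate_succ_apply' step n X
  have hmono : ∀ X, Monotone (A X) := fun X => monotone_nat_of_le_succ fun n => by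
    rw [hA]; exact Set.subset_union_left
  have hle : ∀ X P, X ⊆ P → (∀ x ∈ P, ∀ y ∈ P, F x y ⊆ P) → ∀ n, A X n ⊆ P := by
    intro X P hX hP n
    induction n with
    | zero => exact hX
    | succ n ih =>
      rw [hA]
      exact Set.union_subset ih (Set.iUnion_subset fun p => hP _ (ih p.1.2) _ (ih p.2.2))
  have hcl : ∀ X, ∀ x ∈ ⋃ n, A X n, ∀ y ∈ ⋃ n, A X n, F x y ⊆ ⋃ n, A X n := by
    intro X x hx y hy z hz
    obtain ⟨n, hn⟩ := Set.mem_iUnion.1 hx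
    obtain ⟨m, hm⟩ := Set.mem_iUnion.1 hy
    refine Set.mem_iUnion.2 ⟨max n m + 1, ?_⟩
    rw [hA]
    exact Or.inr (Set.mem_iUnion.2 ⟨(⟨x, hmono X (le_max_left _ _) hn⟩,
      ⟨y, hmono X (le_max_right _ _) hm⟩), hz⟩)
  have h0 : ∀ X, X ⊆ ⋃ n, A X n := fun X => Set.subset_iUnion (A X) 0
  have hmin : ∀ X P, X ⊆ P → (∀ x ∈ P, ∀ y ∈ P, F x y ⊆ P) → (⋃ n, A X n) ⊆ P :=
    fun X P hX hP => Set.iUnion_subset (hle X P hX hP)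
  refine ⟨fun X => ⋃ n, A X n, h0, fun X X' hXX => hmin _ _ (hXX.trans (h0 X')) (hcl X'), hmin,
    hcl, fun X => ?_⟩
  have hm : ℵ₀ ≤ max #X θ := hθ.trans (le_max_right _ _)
  have hcard : ∀ n, #(A X n) ≤ max #X θ := by
    intro n
    induction n with
    | zero => exact le_max_left _ _
    | succ n ih =>
      rw [hA]
      refine (Cardinal.mk_union_le _ _).trans (Cardinal.add_le_of_le hm ih ?_)
      refine (Cardinal.mk_iUnion_le _).trans ((mul_le_mul' ?_ (ciSup_le' fun p =>
        (hF _ _).trans (le_max_right _ _))).trans (Cardinal.mul_eq_self hm).le)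
      rw [← Cardinal.mul_def]
      exact (mul_le_mul' ih ih).trans (Cardinal.mul_eq_self hm).le
  have := Cardinal.mk_iUnion_le_lift.{u, 0} (fun n => A X n)
  simp only [Cardinal.lift_uzero, Cardinal.mk_eq_aleph0, Cardinal.lift_aleph0] at this
  exact this.trans ((mul_le_mul' hm (ciSup_le' hcard)).trans (Cardinal.mul_eq_self hm).le)

end Closure

section Pieces

/-- A system of ladders in a filtration: the index `δ` has the ladder `c δ` below `pt δ`, with
histories `t δ j`, together with adapted bases. -/
structure LadderSystem {G O : Type u} [AddCommGroup G] [LinearOrder O] (N : O → Submodule ℤ G)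
    (T : Set O) (Θ Nd U : Type u) [LinearOrder Θ] where
  /-- the limit of the ladder -/
  pt : U → O
  /-- the ladder -/
  c : U → Θ → O
  /-- the history of a ladder -/
  t : U → Θ → Nd
  /-- the values in a history -/
  vals : Nd → Set O
  /-- the pieces of the basis -/
  B : U → Θ → Set G
  pt_inj : Function.Injective pt
  c_mem : ∀ δ j, c δ j ∈ T
  c_lt : ∀ δ j, c δ j < pt δ
  c_mem_vals : ∀ δ i j, i ≤ j → c δ i ∈ vals (t δ j)
  vals_le : ∀ δ j, ∀ v ∈ vals (t δ j), v ≤ pt δ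
  vals_card : ∀ n, #(vals n) ≤ #Θ
  sep : ∀ δ δ', δ ≠ δ' → ∃ g, ∀ j j', t δ j = t δ' j' → j < g
  indep : ∀ δ, LinearIndepOn ℤ id (⋃ j, B δ j)
  span_eq : ∀ δ, Submodule.span ℤ (⋃ j, B δ j) = N (pt δ)
  span_lt : ∀ δ g, Submodule.span ℤ (⋃ j, ⋃ (_ : j < g), B δ j) = N (c δ g)

variable {G O Nd : Type u}

/-- The ordinals of a piece. -/
def oset (R : Set (O ⊕ (G ⊕ Nd))) : Set O := {β | Sum.inl β ∈ R}

/-- The group elements of a piece. -/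
def gset (R : Set (O ⊕ (G ⊕ Nd))) : Set G := {g | Sum.inr (Sum.inl g) ∈ R}

/-- The histories of a piece. -/
def tset (R : Set (O ⊕ (G ⊕ Nd))) : Set Nd := {n | Sum.inr (Sum.inr n) ∈ R}

/-- The group elements of a list of pieces. -/
def gUnion (l : List (Set (O ⊕ (G ⊕ Nd)))) : Set G := {g | ∃ S ∈ l, g ∈ gset S}

theorem gset_mono {R R' : Set (O ⊕ (G ⊕ Nd))} (h : R ⊆ R') : gset R ⊆ gset R' := fun _ hg => h hg

theorem gUnion_cons (R : Set (O ⊕ (G ⊕ Nd))) (l : List (Set (O ⊕ (G ⊕ Nd)))) :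
    gUnion (R :: l) = gset R ∪ gUnion l := by
  ext g
  simp [gUnion]

variable [AddCommGroup G]

theorem exists_finite_gset {L : Submodule ℤ G} {A : Set G} {R : Set (O ⊕ (G ⊕ Nd))} {g : G}
    (h : g ∈ L ⊔ Submodule.span ℤ (A ∩ gset R)) :
    ∃ W ⊆ R, W.Finite ∧ g ∈ L ⊔ Submodule.span ℤ (A ∩ gset W) := by
  obtain ⟨y, hy, z, hz, rfl⟩ := Submodule.mem_sup.1 h
  obtain ⟨F, hF, hzF⟩ := Submodule.mem_span_finite_of_mem_span hz
  refine ⟨(fun g => Sum.inr (Sum.inl g)) '' (F : Set G), ?_, F.finite_toSet.image _, ?_⟩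
  · rintro _ ⟨g, hg, rfl⟩
    exact (hF hg).2
  · refine add_mem (Submodule.mem_sup_left hy) (Submodule.mem_sup_right ?_)
    refine Submodule.span_mono (fun g hg => ?_) hzF
    exact ⟨(hF hg).1, ⟨g, hg, rfl⟩⟩

theorem mem_sup_span_mono {L : Submodule ℤ G} {A : Set G} {R R' : Set (O ⊕ (G ⊕ Nd))} {g : G}
    (hR : R ⊆ R') (h : g ∈ L ⊔ Submodule.span ℤ (A ∩ gset R)) :
    g ∈ L ⊔ Submodule.span ℤ (A ∩ gset R') :=
  (sup_le_sup_left (Submodule.span_mono (Set.inter_subset_inter_right A (gset_mono hR))) L :) h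

namespace LadderSystem

variable [LinearOrder O] {N : O → Submodule ℤ G} {T : Set O} {Θ U : Type u} [LinearOrder Θ]

variable (Λ : LadderSystem N T Θ Nd U) (α : O) (Y : O → Set G)

/-- One step of closing off a piece relative to a list of pieces. -/
structure Step (l : List (Set (O ⊕ (G ⊕ Nd)))) (x y : O ⊕ (G ⊕ Nd)) (W : Set (O ⊕ (G ⊕ Nd))) :
    Prop where
  top : α ∈ oset W
  zero : (0 : G) ∈ gset W
  sub : ∀ g h, x = Sum.inr (Sum.inl g) → y = Sum.inr (Sum.inl h) → g - h ∈ gset W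
  rank : ∀ g, x = Sum.inr (Sum.inl g) → g ≠ 0 → ∃ σ ∈ oset W, g ∉ N σ ∧ ∀ b, σ < b → g ∈ N b
  nodes : ∀ δ, x = Sum.inl (Λ.pt δ) → ∀ j, Λ.t δ j ∈ tset W ∧ Λ.c δ j ∈ oset W
  vals : ∀ n, x = Sum.inr (Sum.inr n) → Λ.vals n ⊆ oset W
  compl : ∀ γ ∈ T, ∀ g, x = Sum.inl γ → y = Sum.inr (Sum.inl g) →
    g ∈ N γ ⊔ Submodule.span ℤ (Y γ ∩ gset W)
  basis : ∀ δ g, x = Sum.inl (Λ.pt δ) → y = Sum.inr (Sum.inl g) → g ∈ N (Λ.pt δ) →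
    g ∈ Submodule.span ℤ ((⋃ j, Λ.B δ j) ∩ gset W)
  dist : ∀ β g, x = Sum.inl β → y = Sum.inr (Sum.inl g) → ∀ l', l'.Sublist l →
    g ∈ N β ⊔ Submodule.span ℤ (gUnion l') →
    g ∈ N β ⊔ Submodule.span ℤ (gUnion l' ∩ gset W)

variable {Λ α Y}

theorem Step.mono {l : List (Set (O ⊕ (G ⊕ Nd)))} {x y : O ⊕ (G ⊕ Nd)}
    {W W' : Set (O ⊕ (G ⊕ Nd))} (h : Λ.Step α Y l x y W) (hW : W ⊆ W') : Λ.Step α Y l x y W' where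
  top := hW h.top
  zero := hW h.zero
  sub := fun g k hx hy => hW (h.sub g k hx hy)
  rank := fun g hx hg => by
    obtain ⟨σ, h1, h2⟩ := h.rank g hx hg
    exact ⟨σ, hW h1, h2⟩
  nodes := fun δ hx j => ⟨hW (h.nodes δ hx j).1, hW (h.nodes δ hx j).2⟩
  vals := fun n hx v hv => hW (h.vals n hx hv)
  compl := fun γ hγ g hx hy => mem_sup_span_mono hW (h.compl γ hγ g hx hy)
  basis := fun δ g hx hy hg => Submodule.span_mono
    (Set.inter_subset_inter_right _ (gset_mono hW)) (h.basis δ g hx hy hg)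
  dist := fun β g hx hy l' hl hg => mem_sup_span_mono hW (h.dist β g hx hy l' hl hg)

theorem Step.exists_small (hΘ : ℵ₀ ≤ #Θ) {l : List (Set (O ⊕ (G ⊕ Nd)))} {x y : O ⊕ (G ⊕ Nd)}
    {R : Set (O ⊕ (G ⊕ Nd))} (h : Λ.Step α Y l x y R) :
    ∃ W ⊆ R, #W ≤ #Θ ∧ Λ.Step α Y l x y W := by
  classical
  have hfin : ∀ {W : Set (O ⊕ (G ⊕ Nd))}, W.Finite → #W ≤ #Θ := fun hW =>
    (Cardinal.lt_aleph0_iff_set_finite.2 hW).le.trans hΘ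
  have hrank : ∃ W ⊆ R, W.Finite ∧ ∀ g, x = Sum.inr (Sum.inl g) → g ≠ 0 →
      ∃ σ ∈ oset W, g ∉ N σ ∧ ∀ b, σ < b → g ∈ N b := by
    by_cases hx : ∃ g, x = Sum.inr (Sum.inl g) ∧ g ≠ 0
    · obtain ⟨g, rfl, hg⟩ := hx
      obtain ⟨σ, h1, h2⟩ := h.rank g rfl hg
      refine ⟨{Sum.inl σ}, Set.singleton_subset_iff.2 h1, Set.finite_singleton _, fun g' hg' _ => ?_⟩
      obtain rfl := Sum.inl.inj (Sum.inr.inj hg')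
      exact ⟨σ, rfl, h2⟩
    · exact ⟨∅, Set.empty_subset _, Set.finite_empty, fun g h1 h2 => (hx ⟨g, h1, h2⟩).elim⟩
  have hcompl : ∃ W ⊆ R, W.Finite ∧ ∀ γ ∈ T, ∀ g, x = Sum.inl γ → y = Sum.inr (Sum.inl g) →
      g ∈ N γ ⊔ Submodule.span ℤ (Y γ ∩ gset W) := by
    by_cases hx : ∃ γ ∈ T, ∃ g, x = Sum.inl γ ∧ y = Sum.inr (Sum.inl g)
    · obtain ⟨γ, hγ, g, rfl, rfl⟩ := hx
      obtain ⟨W, hW, hWf, hg⟩ := exists_finite_gset (h.compl γ hγ g rfl rfl)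
      refine ⟨W, hW, hWf, fun γ' _ g' hx hy => ?_⟩
      obtain rfl := Sum.inl.inj hx
      obtain rfl := Sum.inl.inj (Sum.inr.inj hy)
      exact hg
    · exact ⟨∅, Set.empty_subset _, Set.finite_empty, fun γ h1 g h2 h3 =>
        (hx ⟨γ, h1, g, h2, h3⟩).elim⟩
  have hbasis : ∃ W ⊆ R, W.Finite ∧ ∀ δ g, x = Sum.inl (Λ.pt δ) → y = Sum.inr (Sum.inl g) →
      g ∈ N (Λ.pt δ) → g ∈ Submodule.span ℤ ((⋃ j, Λ.B δ j) ∩ gset W) := by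
    by_cases hx : ∃ δ g, x = Sum.inl (Λ.pt δ) ∧ y = Sum.inr (Sum.inl g) ∧ g ∈ N (Λ.pt δ)
    · obtain ⟨δ, g, rfl, rfl, hg⟩ := hx
      obtain ⟨W, hW, hWf, hg⟩ := exists_finite_gset (L := ⊥)
        (A := ⋃ j, Λ.B δ j) (R := R) (g := g) (by rw [bot_sup_eq]; exact h.basis δ g rfl rfl hg)
      refine ⟨W, hW, hWf, fun δ' g' hx hy _ => ?_⟩
      obtain rfl := Λ.pt_inj (Sum.inl.inj hx)
      obtain rfl := Sum.inl.inj (Sum.inr.inj hy)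
      rwa [bot_sup_eq] at hg
    · exact ⟨∅, Set.empty_subset _, Set.finite_empty, fun δ g h1 h2 h3 =>
        (hx ⟨δ, g, h1, h2, h3⟩).elim⟩
  have hdist : ∀ l', ∃ W ⊆ R, W.Finite ∧ ∀ β g, x = Sum.inl β → y = Sum.inr (Sum.inl g) →
      l'.Sublist l → g ∈ N β ⊔ Submodule.span ℤ (gUnion l') →
      g ∈ N β ⊔ Submodule.span ℤ (gUnion l' ∩ gset W) := by
    intro l'
    by_cases hx : ∃ β g, x = Sum.inl β ∧ y = Sum.inr (Sum.inl g) ∧ l'.Sublist l ∧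
        g ∈ N β ⊔ Submodule.span ℤ (gUnion l')
    · obtain ⟨β, g, rfl, rfl, hl, hg⟩ := hx
      obtain ⟨W, hW, hWf, hg⟩ := exists_finite_gset (h.dist β g rfl rfl l' hl hg)
      refine ⟨W, hW, hWf, fun β' g' hx hy _ _ => ?_⟩
      obtain rfl := Sum.inl.inj hx
      obtain rfl := Sum.inl.inj (Sum.inr.inj hy)
      exact hg
    · exact ⟨∅, Set.empty_subset _, Set.finite_empty, fun β g h1 h2 h3 h4 =>
        (hx ⟨β, g, h1, h2, h3, h4⟩).elim⟩
  choose W8 hW8 hW8f hW8d using hdist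
  obtain ⟨W4, hW4, hW4f, hW4d⟩ := hrank
  obtain ⟨W6, hW6, hW6f, hW6d⟩ := hcompl
  obtain ⟨W7, hW7, hW7f, hW7d⟩ := hbasis
  let W1 : Set (O ⊕ (G ⊕ Nd)) := {Sum.inl α, Sum.inr (Sum.inl 0)}
  let W3 : Set (O ⊕ (G ⊕ Nd)) :=
    {z | ∃ g h, x = Sum.inr (Sum.inl g) ∧ y = Sum.inr (Sum.inl h) ∧ z = Sum.inr (Sum.inl (g - h))}
  have hW3f : W3.Subsingleton := by
    rintro _ ⟨g, k, h1, h2, rfl⟩ _ ⟨g', k', h1', h2', rfl⟩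
    obtain rfl := Sum.inl.inj (Sum.inr.inj (h1.symm.trans h1'))
    obtain rfl := Sum.inl.inj (Sum.inr.inj (h2.symm.trans h2'))
    rfl
  let Wt : Set (O ⊕ (G ⊕ Nd)) :=
    {z | ∃ δ, x = Sum.inl (Λ.pt δ) ∧ ∃ j, z = Sum.inr (Sum.inr (Λ.t δ j)) ∨ z = Sum.inl (Λ.c δ j)}
  have hWt : #Wt ≤ #Θ := by
    by_cases hx : ∃ δ, x = Sum.inl (Λ.pt δ)
    · obtain ⟨δ, rfl⟩ := hx
      have : Wt ⊆ Set.range (fun j => (Sum.inr (Sum.inr (Λ.t δ j)) : O ⊕ (G ⊕ Nd))) ∪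
          Set.range (fun j => (Sum.inl (Λ.c δ j) : O ⊕ (G ⊕ Nd))) := by
        rintro _ ⟨δ', h1, j, h2⟩
        obtain rfl := Λ.pt_inj (Sum.inl.inj h1)
        rcases h2 with rfl | rfl
        · exact Or.inl ⟨j, rfl⟩
        · exact Or.inr ⟨j, rfl⟩
      exact (Cardinal.mk_le_mk_of_subset this).trans ((Cardinal.mk_union_le _ _).trans
        (Cardinal.add_le_of_le hΘ Cardinal.mk_range_le Cardinal.mk_range_le))
    · exact hfin ((Set.finite_empty).subset fun z ⟨δ, h1, _⟩ => hx ⟨δ, h1⟩)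
  let Wv : Set (O ⊕ (G ⊕ Nd)) :=
    {z | ∃ n, x = Sum.inr (Sum.inr n) ∧ ∃ v ∈ Λ.vals n, z = Sum.inl v}
  have hWv : #Wv ≤ #Θ := by
    by_cases hx : ∃ n, x = Sum.inr (Sum.inr n)
    · obtain ⟨n, rfl⟩ := hx
      have : Wv ⊆ Sum.inl '' Λ.vals n := by
        rintro _ ⟨n', h1, v, hv, rfl⟩
        obtain rfl := Sum.inr.inj (Sum.inr.inj h1)
        exact ⟨v, hv, rfl⟩
      exact (Cardinal.mk_le_mk_of_subset this).trans (Cardinal.mk_image_le.trans (Λ.vals_card n))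
    · exact hfin ((Set.finite_empty).subset fun z ⟨n, h1, _⟩ => hx ⟨n, h1⟩)
  let W9 : Set (O ⊕ (G ⊕ Nd)) := ⋃ l' ∈ l.sublists, W8 l'
  have hW9f : W9.Finite := Set.Finite.biUnion (List.finite_toSet l.sublists) fun l' _ => hW8f l'
  let V : Set (O ⊕ (G ⊕ Nd)) := (W1 ∪ W3) ∪ (W4 ∪ W6) ∪ (W7 ∪ W9)
  have hVf : V.Finite := (((Set.toFinite W1).union hW3f.finite).union (hW4f.union hW6f)).union
    (hW7f.union hW9f)
  have hsub : ∀ z, z ∈ V → z ∈ V ∪ (Wt ∪ Wv) := fun z => Or.inl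
  have h1 : W1 ⊆ V ∪ (Wt ∪ Wv) := fun z hz => Or.inl (Or.inl (Or.inl (Or.inl hz)))
  have h3 : W3 ⊆ V ∪ (Wt ∪ Wv) := fun z hz => Or.inl (Or.inl (Or.inl (Or.inr hz)))
  have h4 : W4 ⊆ V ∪ (Wt ∪ Wv) := fun z hz => Or.inl (Or.inl (Or.inr (Or.inl hz)))
  have h6 : W6 ⊆ V ∪ (Wt ∪ Wv) := fun z hz => Or.inl (Or.inl (Or.inr (Or.inr hz)))
  have h7 : W7 ⊆ V ∪ (Wt ∪ Wv) := fun z hz => Or.inl (Or.inr (Or.inl hz))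
  have h9 : W9 ⊆ V ∪ (Wt ∪ Wv) := fun z hz => Or.inl (Or.inr (Or.inr hz))
  refine ⟨V ∪ (Wt ∪ Wv), ?_, ?_, ?_⟩
  · refine Set.union_subset (Set.union_subset (Set.union_subset (Set.union_subset ?_ ?_)
      (Set.union_subset hW4 hW6)) (Set.union_subset hW7 (Set.iUnion₂_subset fun l' _ => hW8 l')))
      (Set.union_subset ?_ ?_)
    · rintro _ (rfl | rfl)
      · exact h.top
      · exact h.zero
    · rintro _ ⟨g, k, h1, h2, rfl⟩
      exact h.sub g k h1 h2
    · rintro _ ⟨δ, h1, j, rfl | rfl⟩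
      · exact (h.nodes δ h1 j).1
      · exact (h.nodes δ h1 j).2
    · rintro _ ⟨n, h1, v, hv, rfl⟩
      exact h.vals n h1 hv
  · exact (Cardinal.mk_union_le _ _).trans (Cardinal.add_le_of_le hΘ (hfin hVf)
      ((Cardinal.mk_union_le _ _).trans (Cardinal.add_le_of_le hΘ hWt hWv)))
  · exact
      { top := h1 (Or.inl rfl)
        zero := h1 (Or.inr rfl)
        sub := fun g k hx hy => h3 ⟨g, k, hx, hy, rfl⟩
        rank := fun g hx hg => by
          obtain ⟨σ, hσ, h2⟩ := hW4d g hx hg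
          exact ⟨σ, h4 hσ, h2⟩
        nodes := fun δ hx j => ⟨Or.inr (Or.inl ⟨δ, hx, j, Or.inl rfl⟩),
          Or.inr (Or.inl ⟨δ, hx, j, Or.inr rfl⟩)⟩
        vals := fun n hx v hv => Or.inr (Or.inr ⟨n, hx, v, hv, rfl⟩)
        compl := fun γ hγ g hx hy => mem_sup_span_mono h6 (hW6d γ hγ g hx hy)
        basis := fun δ g hx hy hg => Submodule.span_mono
          (Set.inter_subset_inter_right _ (gset_mono h7)) (hW7d δ g hx hy hg)
        dist := fun β g hx hy l' hl hg => mem_sup_span_mono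
          ((Set.subset_biUnion_of_mem (u := W8) (List.mem_sublists.2 hl)).trans h9) (hW8d l' β g hx hy hl hg) }

end LadderSystem

end Pieces

namespace LadderSystem

section Closed

variable {G O Nd Θ U : Type u} [AddCommGroup G] [LinearOrder O] [LinearOrder Θ]
  {N : O → Submodule ℤ G} {T : Set O}
  (Λ : LadderSystem N T Θ Nd U) (α : O) (Y : O → Set G)

/-- A piece is closed relative to a list of pieces. -/
structure IsClosed (l : List (Set (O ⊕ (G ⊕ Nd)))) (R : Set (O ⊕ (G ⊕ Nd))) : Prop where
  le : ∀ β ∈ oset R, β ≤ α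
  gset_subset : gset R ⊆ N α
  nonempty : R.Nonempty
  step : ∀ x ∈ R, ∀ y ∈ R, Λ.Step α Y l x y R

/-- A list of pieces each of which is closed relative to the following ones. -/
def Adm : List (Set (O ⊕ (G ⊕ Nd))) → Prop
  | [] => True
  | R :: l => Λ.IsClosed α Y l R ∧ Adm l

variable {Λ α Y} {l l' : List (Set (O ⊕ (G ⊕ Nd)))} {R R' : Set (O ⊕ (G ⊕ Nd))}

theorem IsClosed.sublist (h : Λ.IsClosed α Y l R) (hl : l'.Sublist l) : Λ.IsClosed α Y l' R where
  le := h.le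
  gset_subset := h.gset_subset
  nonempty := h.nonempty
  step := fun x hx y hy =>
    { h.step x hx y hy with
      dist := fun β g h1 h2 l'' hl'' => (h.step x hx y hy).dist β g h1 h2 l'' (hl''.trans hl) }

theorem Adm.sublist (h : Λ.Adm α Y l) (hl : l'.Sublist l) : Λ.Adm α Y l' := by
  induction hl with
  | slnil => trivial
  | cons R hl ih => exact ih h.2
  | cons_cons R hl ih => exact ⟨h.1.sublist hl, ih h.2⟩

theorem Adm.exists_isClosed (h : Λ.Adm α Y l) (hR : R ∈ l) : ∃ l', Λ.IsClosed α Y l' R := by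
  induction l with
  | nil => simp at hR
  | cons S l ih =>
    rcases List.mem_cons.1 hR with rfl | hR
    · exact ⟨l, h.1⟩
    · exact ih h.2 hR

theorem IsClosed.top_mem (h : Λ.IsClosed α Y l R) : α ∈ oset R := by
  obtain ⟨x, hx⟩ := h.nonempty
  exact (h.step x hx x hx).top

theorem IsClosed.mem_span_iff (h : Λ.IsClosed α Y l R) {g : G} :
    g ∈ Submodule.span ℤ (gset R) ↔ g ∈ gset R := by
  obtain ⟨x, hx⟩ := h.nonempty
  have h0 := (h.step x hx x hx).zero
  have hsub : ∀ a ∈ gset R, ∀ b ∈ gset R, a - b ∈ gset R := fun a ha b hb =>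
    (h.step _ ha _ hb).sub a b rfl rfl
  refine ⟨fun hg => ?_, fun hg => Submodule.subset_span hg⟩
  let A : AddSubgroup G := AddSubgroup.ofSub (gset R) ⟨0, h0⟩ fun {a} ha {b} hb => by
    simpa [sub_eq_add_neg] using hsub a ha b hb
  exact (Submodule.span_le (p := AddSubgroup.toIntSubmodule A)).2 (fun a ha => ha) hg

theorem IsClosed.cons (h : Λ.IsClosed α Y l R) (hR' : Λ.IsClosed α Y l R') (hRR : R' ⊆ R) :
    Λ.IsClosed α Y (R' :: l) R where
  le := h.le
  gset_subset := h.gset_subset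
  nonempty := h.nonempty
  step := fun x hx y hy =>
    { h.step x hx y hy with
      dist := by
        rintro β g rfl rfl l' hl' hg
        rcases List.sublist_cons_iff.1 hl' with hl' | ⟨l'', rfl, hl''⟩
        · exact (h.step _ hx _ hy).dist β g rfl rfl l' hl' hg
        · rw [gUnion_cons, Submodule.span_union, sup_left_comm] at hg
          obtain ⟨q, hq, z, hz, rfl⟩ := Submodule.mem_sup.1 hg
          have hqR := gset_mono hRR (hR'.mem_span_iff.1 hq)
          have hzR : z ∈ gset R := by
            have := (h.step _ hy _ hqR).sub _ _ rfl rfl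
            rwa [add_sub_cancel_left] at this
          have := (h.step _ hx _ hzR).dist β z rfl rfl l'' hl'' hz
          rw [gUnion_cons]
          refine add_mem (Submodule.mem_sup_right (Submodule.subset_span
            ⟨Or.inl (hR'.mem_span_iff.1 hq), hqR⟩)) ?_
          exact (sup_le_sup_left (Submodule.span_mono (Set.inter_subset_inter_left _
            Set.subset_union_right)) (N β) :) this }

theorem IsClosed.iUnion {J : Type*} [LinearOrder J] {P : J → Set (O ⊕ (G ⊕ Nd))} (hP : Monotone P)
    {s : Set J} (hs : s.Nonempty) (h : ∀ i ∈ s, Λ.IsClosed α Y l (P i)) :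
    Λ.IsClosed α Y l (⋃ i ∈ s, P i) where
  le := fun β hβ => by
    obtain ⟨i, hi, hβ⟩ := Set.mem_iUnion₂.1 hβ
    exact (h i hi).le β hβ
  gset_subset := fun β hβ => by
    obtain ⟨i, hi, hβ⟩ := Set.mem_iUnion₂.1 hβ
    exact (h i hi).gset_subset hβ
  nonempty := by
    obtain ⟨i, hi⟩ := hs
    obtain ⟨x, hx⟩ := (h i hi).nonempty
    exact ⟨x, Set.mem_iUnion₂.2 ⟨i, hi, hx⟩⟩
  step := fun x hx y hy => by
    obtain ⟨i, hi, hx⟩ := Set.mem_iUnion₂.1 hx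
    obtain ⟨j, hj, hy⟩ := Set.mem_iUnion₂.1 hy
    have hij : max i j ∈ s := by rcases max_choice i j with h | h <;> rw [h] <;> assumption
    exact ((h _ hij).step x (hP (le_max_left i j) hx) y (hP (le_max_right i j) hy)).mono
      (Set.subset_biUnion_of_mem (u := P) hij)

theorem IsClosed.exists_skolem (hΘ : ℵ₀ ≤ #Θ) (h : Λ.IsClosed α Y l R) :
    ∃ F : O ⊕ (G ⊕ Nd) → O ⊕ (G ⊕ Nd) → Set (O ⊕ (G ⊕ Nd)), (∀ x y, #(F x y) ≤ #Θ) ∧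
      (∀ x y, F x y ⊆ R) ∧
      ∀ S ⊆ R, S.Nonempty → (∀ x ∈ S, ∀ y ∈ S, F x y ⊆ S) → Λ.IsClosed α Y l S := by
  have : ∀ x y, ∃ W ⊆ R, #W ≤ #Θ ∧ (x ∈ R → y ∈ R → Λ.Step α Y l x y W) := by
    intro x y
    by_cases hxy : x ∈ R ∧ y ∈ R
    · obtain ⟨W, h1, h2, h3⟩ := (h.step x hxy.1 y hxy.2).exists_small hΘ
      exact ⟨W, h1, h2, fun _ _ => h3⟩
    · exact ⟨∅, Set.empty_subset _, by simp, fun h1 h2 => (hxy ⟨h1, h2⟩).elim⟩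
  choose F hF1 hF2 hF3 using this
  refine ⟨F, hF2, hF1, fun S hS hne hcl => ⟨fun β hβ => h.le β (hS hβ),
    (gset_mono hS).trans h.gset_subset, hne, fun x hx y hy => ?_⟩⟩
  exact (hF3 x y (hS hx) (hS hy)).mono (hcl x hx y hy)

theorem Adm.mem_span_of_mem [WellFoundedLT O] (hN : Monotone N) (h : Λ.Adm α Y l) {β : O} {x : G}
    (hx : x ∈ N β) (hxl : x ∈ Submodule.span ℤ (gUnion l)) :
    x ∈ Submodule.span ℤ (gUnion l ∩ N β) := by
  rcases le_or_gt α β with hβ | hβ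
  · refine Submodule.span_mono (s := gUnion l) (fun g hg => Set.mem_inter hg ?_) hxl
    obtain ⟨S, hS, hg⟩ := hg
    obtain ⟨_, hS'⟩ := h.exists_isClosed hS
    exact hN hβ (hS'.gset_subset hg)
  induction l generalizing x with
  | nil => simpa [gUnion] using hxl
  | cons R l ih =>
    obtain ⟨hR, hl⟩ := h
    rw [gUnion_cons, Submodule.span_union] at hxl
    obtain ⟨r, hr, y, hy, rfl⟩ := Submodule.mem_sup.1 hxl
    rw [hR.mem_span_iff] at hr
    let m : O := wellFounded_lt.min {b | b ∈ oset R ∧ β ≤ b} ⟨α, hR.top_mem, hβ.le⟩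
    have hm : m ∈ oset R ∧ β ≤ m :=
      wellFounded_lt.min_mem {b | b ∈ oset R ∧ β ≤ b} ⟨α, hR.top_mem, hβ.le⟩
    have hmin : ∀ b ∈ oset R, β ≤ b → m ≤ b := fun b h1 h2 =>
      not_lt.1 (wellFounded_lt.not_lt_min {b | b ∈ oset R ∧ β ≤ b} ⟨h1, h2⟩)
    have h1 : r ∈ N m ⊔ Submodule.span ℤ (gUnion l) := by
      have : r = (r + y) - y := by abel
      rw [this]
      exact sub_mem (Submodule.mem_sup_left (hN hm.2 hx)) (Submodule.mem_sup_right hy)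
    obtain ⟨n, hn, z, hz, hnz⟩ := Submodule.mem_sup.1
      ((hR.step _ hm.1 _ hr).dist m r rfl rfl l (List.Sublist.refl l) h1)
    have hzR : z ∈ gset R :=
      hR.mem_span_iff.1 (Submodule.span_mono Set.inter_subset_right hz)
    have hnR : n ∈ gset R := by
      have := (hR.step _ hr _ hzR).sub _ _ rfl rfl
      rwa [← hnz, add_sub_cancel_right] at this
    have hnβ : n ∈ N β := by
      by_cases hn0 : n = 0
      · rw [hn0]; exact zero_mem _
      obtain ⟨σ, hσ, h2, h3⟩ := (hR.step _ hnR _ hnR).rank n rfl hn0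
      refine h3 β (lt_of_not_ge fun h4 => h2 (hN (hmin σ hσ h4) hn))
    have hzl : z ∈ Submodule.span ℤ (gUnion l) := Submodule.span_mono Set.inter_subset_left hz
    have h2 := ih hl (x := z + y) (by
      have : z + y = (r + y) - n := by rw [← hnz]; abel
      rw [this]
      exact sub_mem hx hnβ) (add_mem hzl hy)
    have h3 : r + y = n + (z + y) := by rw [← hnz]; abel
    rw [h3, gUnion_cons]
    exact add_mem (Submodule.subset_span ⟨Or.inl hnR, hnβ⟩)
      (Submodule.span_mono (Set.inter_subset_inter_left _ Set.subset_union_right) h2)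

/-- The list of the pieces containing the limit of a ladder. -/
noncomputable def at' (Λ : LadderSystem N T Θ Nd U) (l : List (Set (O ⊕ (G ⊕ Nd)))) (δ : U) :
    List (Set (O ⊕ (G ⊕ Nd))) :=
  open Classical in l.filter fun S => Λ.pt δ ∈ oset S

theorem mem_gUnion_at {δ : U} {g : G} :
    g ∈ gUnion (Λ.at' l δ) ↔ ∃ S ∈ l, Λ.pt δ ∈ oset S ∧ g ∈ gset S := by
  simp [gUnion, at', and_assoc]

theorem Adm.mem_span_basis [WellFoundedLT O] (hN : Monotone N) (h : Λ.Adm α Y l) {δ : U} {x : G}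
    (hx : x ∈ N (Λ.pt δ)) (hxl : x ∈ Submodule.span ℤ (gUnion (Λ.at' l δ))) :
    x ∈ Submodule.span ℤ ((⋃ j, Λ.B δ j) ∩ gUnion (Λ.at' l δ)) := by
  classical
  refine Submodule.span_le.2 ?_ ((h.sublist List.filter_sublist).mem_span_of_mem hN hx hxl)
  rintro g ⟨hg, hgN⟩
  obtain ⟨S, hS, hδ, hgS⟩ := mem_gUnion_at.1 hg
  obtain ⟨_, hS'⟩ := h.exists_isClosed hS
  refine Submodule.span_mono ?_ ((hS'.step _ hδ _ hgS).basis δ g rfl rfl hgN)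
  exact Set.inter_subset_inter_right _ fun m hm => mem_gUnion_at.2 ⟨S, hS, hδ, hm⟩

end Closed

end LadderSystem

namespace LadderSystem

section Good

variable {G O Nd Θ U : Type u} [AddCommGroup G] [LinearOrder O] [LinearOrder Θ]
  {N : O → Submodule ℤ G} {T : Set O}
  (Λ : LadderSystem N T Θ Nd U) {α : O} {Y : O → Set G} (s : O → O)

/-- The copies of subgroups determined by a list of pieces. -/
noncomputable def copies (l : List (Set (O ⊕ (G ⊕ Nd)))) (δ : U) : Submodule ℤ G :=
  Submodule.span ℤ (gUnion (Λ.at' l δ) ∩ N (s (Λ.pt δ)))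

/-- The nodes determined by a list of pieces. -/
def nodeSet (l : List (Set (O ⊕ (G ⊕ Nd)))) : Set (Nd × G) :=
  {p | ∃ S ∈ l, p.1 ∈ tset S ∧ p.2 ∈ gset S}

variable {R I : Type*} (D : GlueData R (Nd × G) I U G)

/-- The subgroup determined by a list of pieces. -/
noncomputable def part (l : List (Set (O ⊕ (G ⊕ Nd)))) :
    Submodule ℤ ((((Nd × G) × I) →₀ ℤ) × (U →₀ G)) :=
  D.K ⊔ GlueData.box (nodeSet l) (Λ.copies s l)

/-- The relations of the glueing data are the elements of the bases of the ladder system. -/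
structure Compat : Prop where
  nd_eq : ∀ r, ∃ j, D.b r ∈ Λ.B (D.dl r) j ∧ D.nd r = (Λ.t (D.dl r) j, D.b r)
  exists_eq : ∀ δ, ∀ m ∈ ⋃ j, Λ.B δ j, ∃ r, D.dl r = δ ∧ D.b r = m

variable {Λ s D} {l l' : List (Set (O ⊕ (G ⊕ Nd)))} {P Q : Set (O ⊕ (G ⊕ Nd))}

theorem at_mono (h : ∀ S ∈ l, ∃ S' ∈ l', S ⊆ S') (δ : U) :
    gUnion (Λ.at' l δ) ⊆ gUnion (Λ.at' l' δ) := by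
  intro g hg
  obtain ⟨S, hS, hδ, hgS⟩ := mem_gUnion_at.1 hg
  obtain ⟨S', hS', hSS⟩ := h S hS
  exact mem_gUnion_at.2 ⟨S', hS', hSS hδ, hSS hgS⟩

theorem copies_mono (h : ∀ S ∈ l, ∃ S' ∈ l', S ⊆ S') : Λ.copies s l ≤ Λ.copies s l' :=
  fun δ => Submodule.span_mono (Set.inter_subset_inter_left _ (at_mono h δ))

theorem part_mono (h : ∀ S ∈ l, ∃ S' ∈ l', S ⊆ S') : Λ.part s D l ≤ Λ.part s D l' := by
  refine sup_le_sup_left (GlueData.box_mono ?_ (copies_mono h)) _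
  rintro p ⟨S, hS, h1, h2⟩
  obtain ⟨S', hS', hSS⟩ := h S hS
  exact ⟨S', hS', hSS h1, hSS h2⟩

theorem part_cons_cons (h : Q ⊆ P) : Λ.part s D (P :: Q :: l) = Λ.part s D (P :: l) := by
  refine le_antisymm (part_mono fun S hS => ?_) (part_mono fun S hS => ?_)
  · simp only [List.mem_cons] at hS
    rcases hS with rfl | rfl | hS
    · exact ⟨S, by simp, subset_rfl⟩
    · exact ⟨P, by simp, h⟩
    · exact ⟨S, by simp [hS], subset_rfl⟩
  · refine ⟨S, ?_, subset_rfl⟩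
    simp only [List.mem_cons] at hS ⊢
    tauto

theorem part_iUnion_le {J : Type*} [LinearOrder J] {A : J → Set (O ⊕ (G ⊕ Nd))} (hA : Monotone A)
    (t : Set J) {M : Submodule ℤ ((((Nd × G) × I) →₀ ℤ) × (U →₀ G))} (h0 : Λ.part s D l ≤ M)
    (h : ∀ i ∈ t, Λ.part s D (A i :: l) ≤ M) : Λ.part s D ((⋃ i ∈ t, A i) :: l) ≤ M := by
  have hmax : ∀ i ∈ t, ∀ j ∈ t, max i j ∈ t := fun i hi j hj => by
    rcases max_choice i j with h | h <;> rw [h] <;> assumption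
  refine sup_le (le_sup_left.trans h0) (GlueData.box_le ?_ ?_)
  · rintro n ⟨S, hS, h1, h2⟩ ξ
    rcases List.mem_cons.1 hS with rfl | hS
    · obtain ⟨i, hi, h1⟩ := Set.mem_iUnion₂.1 h1
      obtain ⟨j, hj, h2⟩ := Set.mem_iUnion₂.1 h2
      have hn : n ∈ nodeSet (A (max i j) :: l) :=
        ⟨_, List.mem_cons_self, hA (le_max_left i j) h1, hA (le_max_right i j) h2⟩
      exact h _ (hmax i hi j hj) (Submodule.mem_sup_right (GlueData.single_mem_box_left _ hn ξ))
    · have hn : n ∈ nodeSet l := ⟨S, hS, h1, h2⟩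
      exact h0 (Submodule.mem_sup_right (GlueData.single_mem_box_left _ hn ξ))
  · intro δ q hq
    have : Λ.copies s ((⋃ i ∈ t, A i) :: l) δ ≤
        M.comap (LinearMap.inr ℤ _ _ ∘ₗ Finsupp.lsingle δ) := by
      refine Submodule.span_le.2 ?_
      rintro g ⟨hg, hgN⟩
      change (0, Finsupp.single δ g) ∈ M
      obtain ⟨S, hS, hδ, hgS⟩ := mem_gUnion_at.1 hg
      rcases List.mem_cons.1 hS with rfl | hS
      · obtain ⟨i, hi, h1⟩ := Set.mem_iUnion₂.1 hδ
        obtain ⟨j, hj, h2⟩ := Set.mem_iUnion₂.1 hgS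
        exact h _ (hmax i hi j hj) (Submodule.mem_sup_right (GlueData.single_mem_box_right _
          (Submodule.subset_span ⟨mem_gUnion_at.2 ⟨_, List.mem_cons_self,
            hA (le_max_left i j) h1, hA (le_max_right i j) h2⟩, hgN⟩)))
      · exact h0 (Submodule.mem_sup_right (GlueData.single_mem_box_right _
          (Submodule.subset_span ⟨mem_gUnion_at.2 ⟨S, hS, hδ, hgS⟩, hgN⟩)))
    exact this hq

theorem relFree_part_of_small [WellFoundedLT O] (hΘ : ℵ₀ ≤ #Θ)
    (hbase : ∀ (P : Set (O ⊕ (G ⊕ Nd))) (l : List (Set (O ⊕ (G ⊕ Nd)))), #P ≤ #Θ → Λ.Adm α Y (P :: l) →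
      RelFree (Λ.part s D l) (Λ.part s D (P :: l))) :
    ∀ (κ : Cardinal.{u}) (P : Set (O ⊕ (G ⊕ Nd))) (l : List (Set (O ⊕ (G ⊕ Nd)))),
      #P = κ → Λ.Adm α Y (P :: l) →
      RelFree (Λ.part s D l) (Λ.part s D (P :: l)) := by
  intro κ
  induction κ using WellFoundedLT.induction with
  | _ κ ih =>
  intro P l hPκ hP
  rcases le_or_gt #P #Θ with hle | hlt
  · exact hbase P l hle hP
  obtain ⟨F, hF1, hF2, hF3⟩ := hP.1.exists_skolem hΘ
  obtain ⟨cl, hcl1, hcl2, hcl3, hcl4, hcl5⟩ := exists_closure hΘ F hF1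
  let Z := κ.ord.ToType
  have hZ : #Z = #P := by simp [Z, hPκ]
  obtain ⟨e⟩ := Cardinal.eq.1 hZ
  have hℵ : ℵ₀ ≤ κ := hPκ ▸ hΘ.trans hlt.le
  have : NoMaxOrder Z := Cardinal.noMaxOrder hℵ
  let A : Z → Set (O ⊕ (G ⊕ Nd)) := fun j => cl ((fun i => (e i : O ⊕ (G ⊕ Nd))) '' Set.Iic j)
  have hA : Monotone A := fun i j hij => hcl2 (Set.image_mono (Set.Iic_subset_Iic.2 hij))
  have hAP : ∀ j, A j ⊆ P := fun j => hcl3 _ _ (by rintro _ ⟨i, _, rfl⟩; exact (e i).2)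
    fun x _ y _ => hF2 x y
  have hAcl : ∀ j, Λ.IsClosed α Y l (A j) := fun j => hF3 _ (hAP j)
    ⟨_, hcl1 _ ⟨j, Set.mem_Iic.2 le_rfl, rfl⟩⟩ (hcl4 _)
  have hAcard : ∀ j, #(A j) < κ := fun j => by
    refine (hcl5 _).trans_lt (max_lt (Cardinal.mk_image_le.trans_lt ?_) (hlt.trans_eq hPκ))
    obtain ⟨k, hk⟩ := exists_gt j
    refine (Cardinal.mk_le_mk_of_subset (t := Set.Iio k) fun i hi =>
      lt_of_le_of_lt hi hk).trans_lt ?_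
    exact (Cardinal.mk_Iio_lt k (by simp [Z])).trans_eq (hZ.trans hPκ)
  have hPA : P = ⋃ j ∈ Set.univ, A j := by
    refine subset_antisymm (fun x hx => ?_) (Set.iUnion₂_subset fun j _ => hAP j)
    exact Set.mem_iUnion₂.2 ⟨e.symm ⟨x, hx⟩, trivial, hcl1 _ ⟨e.symm ⟨x, hx⟩, Set.mem_Iic.2 le_rfl,
      by simp⟩⟩
  refine (relFree_iSup_chain (Λ.part s D l) (fun j => Λ.part s D (A j :: l)) fun j => ?_).mono ?_
  · have hle0 : ∀ i, Λ.part s D l ≤ Λ.part s D (A i :: l) := fun i =>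
      part_mono fun S hS => ⟨S, List.mem_cons_of_mem _ hS, subset_rfl⟩
    by_cases hj : (Set.Iio j).Nonempty
    · let B : Set (O ⊕ (G ⊕ Nd)) := ⋃ i ∈ Set.Iio j, A i
      have hB : Λ.IsClosed α Y l B := IsClosed.iUnion hA hj fun i _ => hAcl i
      have hBA : B ⊆ A j := Set.iUnion₂_subset fun i hi => hA (le_of_lt hi)
      have h1 := ih _ (hAcard j) (A j) (B :: l) rfl ⟨(hAcl j).cons hB hBA, hB, hP.2⟩
      rw [part_cons_cons hBA] at h1
      have h2 : Λ.part s D (B :: l) =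
          Λ.part s D l ⊔ ⨆ i, ⨆ (_ : i < j), Λ.part s D (A i :: l) := by
        refine le_antisymm (part_iUnion_le hA _ le_sup_left fun i hi => ?_) (sup_le ?_
          (iSup₂_le fun i hi => part_mono fun S hS => ?_))
        · exact (le_iSup₂ (f := fun i (_ : i < j) => Λ.part s D (A i :: l)) i hi).trans le_sup_right
        · exact part_mono fun S hS => ⟨S, List.mem_cons_of_mem _ hS, subset_rfl⟩
        · rcases List.mem_cons.1 hS with rfl | hS
          · exact ⟨B, List.mem_cons_self, Set.subset_biUnion_of_mem (u := A) hi⟩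
          · exact ⟨S, List.mem_cons_of_mem _ hS, subset_rfl⟩
      rwa [h2] at h1
    · have h1 := ih _ (hAcard j) (A j) l rfl ⟨hAcl j, hP.2⟩
      have h2 : (⨆ i, ⨆ (_ : i < j), Λ.part s D (A i :: l)) = ⊥ :=
        le_bot_iff.1 (iSup₂_le fun i hi => (hj ⟨i, hi⟩).elim)
      rwa [h2, sup_bot_eq]
  · rw [hPA]
    have : Nonempty Z := by
      rw [← Cardinal.mk_ne_zero_iff, hZ]
      exact (Cardinal.aleph0_pos.trans_le (hΘ.trans hlt.le)).ne'
    obtain ⟨j⟩ := this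
    refine part_iUnion_le hA _ le_sup_left fun i _ => ?_
    exact (le_iSup (fun j => Λ.part s D (A j :: l)) i).trans le_sup_right

theorem Adm.mem_of_linearCombination [WellFoundedLT O] (hN : Monotone N) (hD : Λ.Compat D)
    (h : Λ.Adm α Y l) {c : R →₀ ℤ} {δ : U} (hc : ∀ r ∈ c.support, D.dl r = δ)
    (hm : Finsupp.linearCombination ℤ D.b c ∈ Λ.copies s l δ) :
    ∀ r ∈ c.support, D.b r ∈ gUnion (Λ.at' l δ) := by
  have hx : Finsupp.linearCombination ℤ D.b c ∈ N (Λ.pt δ) := by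
    rw [Finsupp.linearCombination_apply]
    refine Submodule.sum_mem _ fun r hr => Submodule.smul_mem _ _ ?_
    obtain ⟨j, hj, _⟩ := hD.nd_eq r
    rw [hc r hr] at hj
    rw [← Λ.span_eq]
    exact Submodule.subset_span (Set.mem_iUnion.2 ⟨j, hj⟩)
  have h1 := h.mem_span_basis hN hx (Submodule.span_mono Set.inter_subset_left hm)
  have h2 : ((⋃ j, Λ.B δ j) ∩ gUnion (Λ.at' l δ)) ⊆
      D.b '' {r | D.dl r = δ ∧ D.b r ∈ gUnion (Λ.at' l δ)} := by
    rintro m ⟨hm1, hm2⟩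
    obtain ⟨r, hr, rfl⟩ := hD.exists_eq δ m hm1
    exact ⟨r, ⟨hr, hm2⟩, rfl⟩
  obtain ⟨c', hc', he⟩ := (Finsupp.mem_span_image_iff_linearCombination ℤ).1
    (Submodule.span_mono h2 h1)
  have h3 : c = c' := by
    rw [← sub_eq_zero]
    refine linearIndepOn_iff.1 (D.indep δ) _ (sub_mem ((Finsupp.mem_supported ℤ c).2 hc)
      (Finsupp.supported_mono (fun r hr => hr.1) hc')) ?_
    rw [map_sub, he, sub_self]
  subst h3
  intro r hr
  exact ((Finsupp.mem_supported ℤ c).1 hc' hr).2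

theorem Adm.closed [WellFoundedLT O] (hN : Monotone N) (hD : Λ.Compat D) (h : Λ.Adm α Y l) :
    D.Closed (nodeSet l) (Λ.copies s l) := by
  intro c δ hc hm r hr
  obtain ⟨S, hS, hδ, hrS⟩ := mem_gUnion_at.1 (h.mem_of_linearCombination hN hD hc hm r hr)
  obtain ⟨j, hj, hnd⟩ := hD.nd_eq r
  rw [hnd, hc r hr]
  obtain ⟨_, hS'⟩ := h.exists_isClosed hS
  exact ⟨S, hS, ((hS'.step _ hδ _ hδ).nodes δ rfl j).1, hrS⟩

end Good

end LadderSystem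

theorem relFree_congr_inf {A : Type*} [AddCommGroup A] {N N' M : Submodule ℤ A}
    (h : ∀ p ∈ M, p ∈ N' ↔ p ∈ N) : RelFree N' M ↔ RelFree N M := by
  have := relFree_map_iff (N := N) (P := M) (N' := N') LinearMap.id h
  rwa [Submodule.map_id] at this

theorem relFree_sup_span {A : Type*} [AddCommGroup A] {N : Submodule ℤ A} {B J : Set A}
    (hB : LinearIndepOn ℤ id B) (hN : Disjoint N (Submodule.span ℤ B)) (hJ : J ⊆ B) :
    RelFree (N ⊔ Submodule.span ℤ J) (N ⊔ Submodule.span ℤ B) := by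
  have h1 : Submodule.span ℤ J ⊔ Submodule.span ℤ (B \ J) = Submodule.span ℤ B := by
    rw [← Submodule.span_union, Set.union_sdiff_cancel hJ]
  refine relFree_of_compl (C := Submodule.span ℤ (B \ J))
    (free_span_of_linearIndepOn (hB.mono Set.sdiff_subset)) ?_ ?_
  · have h2 : Disjoint (Submodule.span ℤ J) (Submodule.span ℤ (B \ J)) :=
      hB.disjoint_span hJ Set.sdiff_subset Set.disjoint_sdiff_right
    rw [Submodule.disjoint_def] at h2 hN ⊢
    intro x hx hx'
    obtain ⟨n, hn, j, hj, rfl⟩ := Submodule.mem_sup.1 hx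
    have hn0 : n = 0 := by
      refine hN n hn ?_
      have : n = (n + j) - j := by abel
      rw [this]
      exact sub_mem (Submodule.span_mono Set.sdiff_subset hx') (Submodule.span_mono hJ hj)
    rw [hn0, zero_add] at hx' ⊢
    exact h2 j hj hx'
  · have h3 := Submodule.span_mono (R := ℤ) hJ
    rw [sup_assoc, h1]
    exact (sup_eq_right.2 (sup_le_sup_left h3 N)).symm

namespace LadderSystem

section Base

variable {G O Nd Θ U : Type u} [AddCommGroup G] [LinearOrder O] [LinearOrder Θ]
  {N : O → Submodule ℤ G} {T : Set O}
  {Λ : LadderSystem N T Θ Nd U} {α : O} {Y : O → Set G} {s : O → O}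
  {l l' : List (Set (O ⊕ (G ⊕ Nd)))} {P Q : Set (O ⊕ (G ⊕ Nd))}

theorem B_subset (δ : U) : (⋃ j, Λ.B δ j) ⊆ N (Λ.pt δ) := fun _ hm => by
  rw [SetLike.mem_coe, ← Λ.span_eq]
  exact Submodule.subset_span hm

theorem Adm.relFree_copies [WellFoundedLT O] (hN : Monotone N) (hs : ∀ a b, a < b ↔ s a ≤ b)
    (hY : ∀ γ ∈ T, γ ≤ α → LinearIndepOn ℤ id (Y γ) ∧ Disjoint (N γ) (Submodule.span ℤ (Y γ)) ∧
      N γ ⊔ Submodule.span ℤ (Y γ) = N α)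
    (h : Λ.Adm α Y (P :: l)) {δ : U} (hδ : Λ.pt δ ≤ α) (hl' : l'.Sublist l) {g : Θ}
    (hg : ∀ S ∈ l', Λ.c δ g ∈ oset S) (hl'' : ∀ S ∈ l, Λ.pt δ ∈ oset S → S ∈ l') {b : Set G}
    (hb : b ⊆ ⋃ j, Λ.B δ j) (hb1 : b ⊆ (⋃ j, ⋃ (_ : j < g), Λ.B δ j) ∪ gUnion l')
    (hb2 : (⋃ j, Λ.B δ j) ∩ gUnion (Λ.at' l δ) ⊆ b) :
    RelFree (Λ.copies s l δ ⊔ Submodule.span ℤ b) (Λ.copies s (P :: l) δ) := by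
  obtain ⟨hP, hl⟩ := h
  have hadm' := hl.sublist hl'
  have hγα : Λ.c δ g ≤ α := (Λ.c_lt δ g).le.trans hδ
  obtain ⟨hY1, hY2, hY3⟩ := hY _ (Λ.c_mem δ g) hγα
  have hat : gUnion (Λ.at' l δ) ⊆ gUnion l' := fun m hm => by
    obtain ⟨S, hS, hδS, hm⟩ := mem_gUnion_at.1 hm
    exact ⟨S, hl'' S hS hδS, hm⟩
  have hlt : Λ.pt δ < s (Λ.pt δ) := (hs _ _).2 le_rfl
  have hspan_b : Submodule.span ℤ b ≤ N (Λ.pt δ) := Submodule.span_le.2 (hb.trans (B_subset δ))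
  let V := N (Λ.c δ g) ⊔ Submodule.span ℤ (gUnion l')
  let Z := Λ.copies s l δ ⊔ Submodule.span ℤ b
  let W := Λ.copies s (P :: l) δ
  have hV : V = N (Λ.c δ g) ⊔ Submodule.span ℤ (Y (Λ.c δ g) ∩ gUnion l') := by
    refine le_antisymm (sup_le le_sup_left (Submodule.span_le.2 ?_))
      (sup_le_sup_left (Submodule.span_mono Set.inter_subset_right) _)
    rintro m ⟨S, hS, hm⟩
    obtain ⟨_, hS'⟩ := hadm'.exists_isClosed hS
    have := (hS'.step _ (hg S hS) _ hm).compl _ (Λ.c_mem δ g) m rfl rfl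
    have hsub : gset S ⊆ gUnion l' := fun k hk => ⟨S, hS, hk⟩
    exact (sup_le_sup_left (Submodule.span_mono (Set.inter_subset_inter_right _ hsub))
      (N (Λ.c δ g)) :) this
  have hVα : RelFree V (N α) := by
    rw [hV, ← hY3]
    exact relFree_sup_span hY1 hY2 Set.inter_subset_left
  have hW : W ≤ N α := by
    refine Submodule.span_le.2 ?_
    rintro m ⟨hm, -⟩
    obtain ⟨S, hS, -, hm⟩ := mem_gUnion_at.1 hm
    obtain ⟨_, hS'⟩ := Adm.exists_isClosed (l := P :: l) ⟨hP, hl⟩ hS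
    exact hS'.gset_subset hm
  have hZV : Z ≤ V := by
    refine sup_le (Submodule.span_le.2 fun m hm => ?_) (Submodule.span_le.2 fun m hm => ?_)
    · exact Submodule.mem_sup_right (Submodule.subset_span (hat hm.1))
    · rcases hb1 hm with hm | hm
      · refine Submodule.mem_sup_left ?_
        rw [← Λ.span_lt]
        exact Submodule.subset_span hm
      · exact Submodule.mem_sup_right (Submodule.subset_span hm)
  have hZN : RelFree Z (N (Λ.pt δ)) := by
    have h1 : RelFree (Submodule.span ℤ b) (N (Λ.pt δ)) :=
      relFree_of_basis_subset (Λ.indep δ) hb subset_rfl (Λ.span_eq δ).le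
        (relFree_of_le (Λ.span_eq δ).ge)
    refine (relFree_congr_inf fun p hp => ⟨fun hpZ => ?_, fun h => Submodule.mem_sup_right h⟩).2 h1
    obtain ⟨q, hq, z, hz, rfl⟩ := Submodule.mem_sup.1 hpZ
    refine add_mem ?_ hz
    have hqN : q ∈ N (Λ.pt δ) := by
      have : q = (q + z) - z := by abel
      rw [this]
      exact sub_mem hp (hspan_b hz)
    exact Submodule.span_mono hb2
      (hl.mem_span_basis hN hqN (Submodule.span_mono Set.inter_subset_left hq))
  have hWV : W ⊓ V ≤ Z ⊔ N (Λ.pt δ) := by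
    rintro x ⟨hxW, hxV⟩
    have hxs : x ∈ N (s (Λ.pt δ)) :=
      (Submodule.span_le.2 Set.inter_subset_right : W ≤ N (s (Λ.pt δ))) hxW
    obtain ⟨n, hn, y, hy, rfl⟩ := Submodule.mem_sup.1 hxV
    have hn' : n ∈ N (Λ.pt δ) := hN (Λ.c_lt δ g).le hn
    have hys : y ∈ N (s (Λ.pt δ)) := by
      have : y = (n + y) - n := by abel
      rw [this]
      exact sub_mem hxs (hN hlt.le hn')
    refine add_mem (Submodule.mem_sup_right hn') ?_
    refine Submodule.span_le.2 ?_ (hadm'.mem_span_of_mem hN hys hy)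
    rintro m ⟨⟨S, hS, hm⟩, hms⟩
    by_cases hδS : Λ.pt δ ∈ oset S
    · exact Submodule.mem_sup_left (Submodule.mem_sup_left
        (Submodule.subset_span ⟨mem_gUnion_at.2 ⟨S, hl'.subset hS, hδS, hm⟩, hms⟩))
    · refine Submodule.mem_sup_right ?_
      by_cases hm0 : m = 0
      · rw [hm0]; exact zero_mem _
      obtain ⟨_, hS'⟩ := hadm'.exists_isClosed hS
      obtain ⟨σ, hσ, h1, h2⟩ := (hS'.step _ hm _ hm).rank m rfl hm0
      refine h2 _ (lt_of_le_of_ne ?_ fun h => hδS (h ▸ hσ))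
      by_contra h3
      exact h1 (hN ((hs _ _).1 (not_le.1 h3)) hms)
  have h1 : RelFree Z (W ⊓ V) := hZN.mono hWV
  have h2 : RelFree (Z ⊔ W ⊓ V) W := by
    refine (relFree_congr_inf (N := V) fun p hp => ⟨fun h => ?_, fun h => ?_⟩).2
      (hVα.mono (hW.trans le_sup_right))
    · exact (sup_le hZV inf_le_right : Z ⊔ W ⊓ V ≤ V) h
    · exact Submodule.mem_sup_right ⟨hp, h⟩
  have h3 := h1.trans h2
  rwa [sup_eq_right.2 inf_le_left] at h3

theorem Adm.relFree_part_base {R I : Type*} {D : GlueData R (Nd × G) I U G} [WellFoundedLT O]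
    (hN : Monotone N) (hs : ∀ a b, a < b ↔ s a ≤ b) (hΘ : Order.cof Θ = #Θ) (hΘ' : ℵ₀ ≤ #Θ)
    (hD : Λ.Compat D)
    (hY : ∀ γ ∈ T, γ ≤ α → LinearIndepOn ℤ id (Y γ) ∧ Disjoint (N γ) (Submodule.span ℤ (Y γ)) ∧
      N γ ⊔ Submodule.span ℤ (Y γ) = N α)
    (hP : #P ≤ #Θ) (h : Λ.Adm α Y (P :: l)) :
    RelFree (Λ.part s D l) (Λ.part s D (P :: l)) := by
  classical
  let A : Set U := {δ | Λ.pt δ ∈ oset P}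
  have hA : #A ≤ #Θ := by
    refine le_trans ?_ hP
    refine Cardinal.mk_le_of_injective (f := fun δ : A => (⟨Sum.inl (Λ.pt δ), δ.2⟩ : P)) ?_
    intro δ δ' h
    exact Subtype.ext (Λ.pt_inj (Sum.inl.inj (Subtype.ext_iff.1 h)))
  let Jt := (#A).ord.ToType
  have hJ : #Jt = #A := by simp [Jt]
  obtain ⟨e⟩ := Cardinal.eq.1 hJ
  let d : Jt → U := fun j => e j
  have hd : Function.Injective d := Subtype.val_injective.comp e.injective
  have hmono : Λ.copies s l ≤ Λ.copies s (P :: l) :=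
    copies_mono fun S hS => ⟨S, List.mem_cons_of_mem _ hS, subset_rfl⟩
  have hdmem : ∀ j, ∀ r, D.dl r = d j → D.b r ∈ ⋃ i, Λ.B (d j) i := fun j r hr => by
    obtain ⟨i, hi, -⟩ := hD.nd_eq r
    rw [hr] at hi
    exact Set.mem_iUnion.2 ⟨i, hi⟩
  refine D.relFree_base hd (h.2.closed hN hD) hmono ?_ ?_ ?_ _
  · intro δ hδ
    refine Submodule.span_mono ?_
    rintro m ⟨hm, hm'⟩
    refine ⟨?_, hm'⟩
    obtain ⟨S, hS, hδS, hm⟩ := mem_gUnion_at.1 hm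
    rcases List.mem_cons.1 hS with rfl | hS
    · exact (hδ (e.symm ⟨δ, hδS⟩) (by simp [d])).elim
    · exact mem_gUnion_at.2 ⟨S, hS, hδS, hm⟩
  · intro j c hc hm r hr
    refine Submodule.subset_span ⟨h.mem_of_linearCombination hN hD hc hm r hr, ?_⟩
    exact hN ((hs _ _).2 le_rfl).le (B_subset _ (hdmem j r (hc r hr)))
  · intro j
    let δ := d j
    have hδP : Λ.pt δ ∈ oset P := (e j).2
    have hJj : #(Set.Iio j) < Order.cof Θ := by
      rw [hΘ]
      exact ((Cardinal.mk_Iio_lt j (by simp [Jt])).trans_eq hJ).trans_le hA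
    have hsep : ∀ i : Set.Iio j, ∃ g, ∀ x y, Λ.t δ x = Λ.t (d i) y → x < g := fun i =>
      Λ.sep δ (d i) fun h => i.2.ne' (hd h)
    choose f hf using hsep
    obtain ⟨g₁, hg₁⟩ := exists_gt_of_mk_lt_cof (s := Set.range f)
      (Cardinal.mk_range_le.trans_lt hJj)
    let Unb : Set (O ⊕ (G ⊕ Nd)) → Prop := fun S => ∀ g, ∃ x, g ≤ x ∧ Λ.t δ x ∈ tset S
    have hbd : ∀ S, ∃ g, ¬ Unb S → ∀ x, Λ.t δ x ∈ tset S → x < g := by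
      intro S
      by_cases hS : Unb S
      · exact ⟨g₁, fun h => (h hS).elim⟩
      · simp only [Unb, not_forall, not_exists, not_and] at hS
        obtain ⟨g, hg⟩ := hS
        exact ⟨g, fun _ x hx => lt_of_not_ge fun h => hg x h hx⟩
    choose f₂ hf₂ using hbd
    obtain ⟨g₂, hg₂⟩ := exists_gt_of_mk_lt_cof (s := f₂ '' {S | S ∈ l}) (by
      rw [hΘ]
      refine lt_of_lt_of_le ?_ hΘ'
      exact Cardinal.lt_aleph0_iff_set_finite.2 ((List.finite_toSet l).image _))
    let g := max g₁ g₂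
    let l' := l.filter fun S => Λ.pt δ ∈ oset S ∨ Unb S
    refine Adm.relFree_copies (l' := l') (g := g) hN hs hY h (h.1.le _ hδP) List.filter_sublist ?_
      ?_ ?_ ?_ ?_
    · intro S hS
      simp only [l', List.mem_filter, decide_eq_true_eq] at hS
      obtain ⟨_, hS'⟩ := h.2.exists_isClosed hS.1
      rcases hS.2 with hδS | hU
      · exact ((hS'.step _ hδS _ hδS).nodes δ rfl g).2
      · obtain ⟨x, hgx, hx⟩ := hU g
        exact (hS'.step _ hx _ hx).vals _ rfl (Λ.c_mem_vals δ g x hgx)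
    · intro S hS hδS
      simp only [l', List.mem_filter, decide_eq_true_eq]
      exact ⟨hS, Or.inl hδS⟩
    · rintro _ ⟨r, ⟨hr, -⟩, rfl⟩
      exact hdmem j r hr
    · rintro _ ⟨r, ⟨hr, hor⟩, rfl⟩
      obtain ⟨x, hx, hnd⟩ := hD.nd_eq r
      rw [hr] at hx hnd
      rcases hor with hnY | ⟨i, hi, r', hr', -, hnn⟩
      · rw [hnd] at hnY
        obtain ⟨S, hS, h1, h2⟩ := hnY
        by_cases hU : Unb S
        · refine Or.inr ⟨S, ?_, h2⟩
          simp only [l', List.mem_filter, decide_eq_true_eq]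
          exact ⟨hS, Or.inr hU⟩
        · refine Or.inl (Set.mem_iUnion₂.2 ⟨x, ?_, hx⟩)
          exact (hf₂ S hU x h1).trans ((hg₂ _ ⟨S, hS, rfl⟩).trans_le (le_max_right _ _))
      · refine Or.inl (Set.mem_iUnion₂.2 ⟨x, ?_, hx⟩)
        obtain ⟨y, -, hnd'⟩ := hD.nd_eq r'
        rw [hr'] at hnd'
        rw [hnd, hnd'] at hnn
        exact (hf ⟨i, hi⟩ x y (Prod.ext_iff.1 hnn).1.symm).trans
          ((hg₁ _ ⟨_, rfl⟩).trans_le (le_max_left _ _))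
    · rintro m ⟨hm, hm'⟩
      obtain ⟨r, hr, rfl⟩ := hD.exists_eq δ m hm
      obtain ⟨S, hS, hδS, hmS⟩ := mem_gUnion_at.1 hm'
      obtain ⟨_, hS'⟩ := h.2.exists_isClosed hS
      obtain ⟨x, -, hnd⟩ := hD.nd_eq r
      refine ⟨r, ⟨hr, Or.inl ?_⟩, rfl⟩
      rw [hnd, hr]
      exact ⟨S, hS, ((hS'.step _ hδS _ hδS).nodes δ rfl x).1, hmS⟩

/-- The glued group is free below any point of the filtration. -/
theorem relFree_of_le {R I : Type*} {D : GlueData R (Nd × G) I U G} [WellFoundedLT O]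
    (hN : Monotone N) (hs : ∀ a b, a < b ↔ s a ≤ b) (hΘ : Order.cof Θ = #Θ) (hΘ' : ℵ₀ ≤ #Θ)
    (hD : Λ.Compat D)
    (hY : ∀ γ ∈ T, γ ≤ α → LinearIndepOn ℤ id (Y γ) ∧ Disjoint (N γ) (Submodule.span ℤ (Y γ)) ∧
      N γ ⊔ Submodule.span ℤ (Y γ) = N α)
    (hrank : ∀ g, g ≠ 0 → ∃ σ, g ∉ N σ ∧ ∀ b, σ < b → g ∈ N b)
    {P : Submodule ℤ ((((Nd × G) × I) →₀ ℤ) × (U →₀ G))}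
    (hP : P ≤ GlueData.box Set.univ fun δ => N (s (Λ.pt δ)))
    (hα : ∀ p ∈ P, ∀ δ, p.2 δ ≠ 0 → s (Λ.pt δ) ≤ α) : RelFree D.K P := by
  let S : Set (O ⊕ (G ⊕ Nd)) :=
    {x | (∀ β, x = Sum.inl β → β ≤ α) ∧ (∀ g, x = Sum.inr (Sum.inl g) → g ∈ N α) ∧
      ∀ n, x = Sum.inr (Sum.inr n) → Λ.vals n ⊆ Set.Iic α}
  have ho : ∀ β, β ∈ oset S ↔ β ≤ α := fun β => by simp [oset, S]
  have hg : ∀ g, g ∈ gset S ↔ g ∈ N α := fun g => by simp [gset, S]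
  have ht : ∀ n, n ∈ tset S ↔ Λ.vals n ⊆ Set.Iic α := fun n => by simp [tset, S]
  have hS : Λ.IsClosed α Y [] S :=
    { le := fun β => (ho β).1
      gset_subset := fun g => (hg g).1
      nonempty := ⟨Sum.inl α, (ho α).2 le_rfl⟩
      step := fun x hx y hy =>
        { top := (ho α).2 le_rfl
          zero := (hg 0).2 (zero_mem _)
          sub := by
            rintro g k rfl rfl
            exact (hg _).2 (sub_mem ((hg g).1 hx) ((hg k).1 hy))
          rank := by
            rintro g rfl hg0
            obtain ⟨σ, h1, h2⟩ := hrank g hg0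
            refine ⟨σ, (ho σ).2 ?_, h1, h2⟩
            by_contra h3
            exact h1 (hN (not_le.1 h3).le ((hg g).1 hx))
          nodes := by
            rintro δ rfl j
            have hδ := (ho _).1 hx
            exact ⟨(ht _).2 fun v hv => (Λ.vals_le δ j v hv).trans hδ,
              (ho _).2 ((Λ.c_lt δ j).le.trans hδ)⟩
          vals := by
            rintro n rfl v hv
            exact (ho v).2 ((ht n).1 hx hv)
          compl := by
            rintro γ hγ g rfl rfl
            have hγα := (ho γ).1 hx
            obtain ⟨-, -, h3⟩ := hY γ hγ hγα
            have hsub : Y γ ⊆ gset S := fun m hm => (hg m).2 (h3 ▸ Submodule.mem_sup_right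
              (Submodule.subset_span hm))
            rw [Set.inter_eq_left.2 hsub, h3]
            exact (hg g).1 hy
          basis := by
            rintro δ g rfl rfl hgδ
            have hsub : (⋃ j, Λ.B δ j) ⊆ gset S := fun m hm =>
              (hg m).2 (hN ((ho _).1 hx) (B_subset δ hm))
            rwa [Set.inter_eq_left.2 hsub, Λ.span_eq]
          dist := by
            rintro β g rfl rfl l' hl' hgl
            obtain rfl := List.sublist_nil.1 hl'
            have : gUnion ([] : List (Set (O ⊕ (G ⊕ Nd)))) = ∅ := by ext; simp [gUnion]
            simpa only [this, Set.empty_inter] using hgl } }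
  have hadm : Λ.Adm α Y [S] := ⟨hS, trivial⟩
  have h1 := relFree_part_of_small (s := s) (D := D) hΘ'
    (fun P l hP h => h.relFree_part_base hN hs hΘ hΘ' hD hY hP) _ S [] rfl hadm
  have h0 : Λ.part s D [] = D.K := by
    refine sup_eq_left.2 (GlueData.box_le ?_ ?_)
    · rintro n ⟨_, h, -⟩
      simp at h
    · intro δ q hq
      have : Λ.copies s [] δ = ⊥ := by
        refine Submodule.span_eq_bot.2 ?_
        rintro g ⟨hg, -⟩
        obtain ⟨_, h, -⟩ := mem_gUnion_at.1 hg
        simp at h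
      rw [this, Submodule.mem_bot] at hq
      rw [hq, Finsupp.single_zero]
      exact zero_mem _
  have h2 := D.relFree_box_nodes (hadm.closed (s := s) hN hD) Set.univ
  rw [h0] at h1
  have hK : D.K ⊔ Λ.part s D [S] = Λ.part s D [S] := sup_eq_right.2 le_sup_left
  have h3 := h1.trans (P := D.K ⊔ GlueData.box Set.univ (Λ.copies s [S])) (by rwa [hK])
  refine h3.mono fun p hp => ?_
  refine Submodule.mem_sup_right (Submodule.mem_sup_right (Submodule.mem_sup_right
    ⟨fun z _ => trivial, fun δ => ?_⟩))
  by_cases hpδ : p.2 δ = 0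
  · rw [hpδ]; exact zero_mem _
  have hsα := hα p hp δ hpδ
  have hpN := (hP hp).2 δ
  refine Submodule.subset_span ⟨mem_gUnion_at.2 ⟨S, List.mem_singleton_self S, ?_, ?_⟩, hpN⟩
  · exact (ho _).2 (((hs _ _).2 le_rfl).le.trans hsα)
  · exact (hg _).2 (hN hsα hpN)

end Base

end LadderSystem

section Histories

theorem mk_fun_int_lt_of_singular
    (gch : ∀ μ : Cardinal.{u}, ℵ₀ ≤ μ → (2 : Cardinal.{u}) ^ μ = Order.succ μ) {μ : Cardinal.{u}}
    (hμ : ℵ₀ ≤ μ) (hsing : μ.ord.cof < μ) {A : Type u} (hA : #A < μ) : #(A → ℤ) < μ := by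
  have hμ' : ℵ₀ < μ := hμ.lt_of_ne fun h => by
    rw [← h, Cardinal.isRegular_aleph0.cof_ord] at hsing
    exact hsing.false
  have hm : max #A ℵ₀ < μ := max_lt hA hμ'
  have h1 : #(A → ℤ) ≤ Order.succ (max #A ℵ₀) := by
    have e : #(A → ℤ) = ℵ₀ ^ #A := by simp
    rw [e, ← gch _ (le_max_right _ _), ← Cardinal.power_self_eq (le_max_right #A ℵ₀)]
    exact (Cardinal.power_le_power_right (le_max_right _ _)).trans
      (Cardinal.power_le_power_left (Cardinal.aleph0_pos.trans_le (le_max_right _ _)).ne'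
        (le_max_left _ _))
  refine (h1.trans (Order.succ_le_of_lt hm)).lt_of_ne fun h => ?_
  have h2 : Order.succ (max #A ℵ₀) = μ := le_antisymm (Order.succ_le_of_lt hm) (h ▸ h1)
  have h3 := (Cardinal.isRegular_succ (le_max_right #A ℵ₀)).cof_ord
  rw [h2] at h3
  exact hsing.ne h3

/-- The values of a ladder up to some index. -/
def LadderNode (Θ O : Type u) [Preorder Θ] : Type u := Σ j : Θ, Set.Iic j → O × O

/-- The last successor value. -/
def LadderNode.top {Θ O : Type u} [Preorder Θ] (n : LadderNode Θ O) : O := (n.2 ⟨n.1, le_rfl⟩).1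

theorem IsGoodFiltration.exists_rank {G O : Type u} [AddCommGroup G] [LinearOrder O]
    [WellFoundedLT O] {μ : Cardinal.{u}} {N : O → Submodule ℤ G} {T : Set O}
    (h : IsGoodFiltration μ N T) (g : G) (hg : g ≠ 0) :
    ∃ σ, g ∉ N σ ∧ ∀ b, σ < b → g ∈ N b := by
  let a := wellFounded_lt.min {a | g ∈ N a} (h.cover g)
  have ha : g ∈ N a := wellFounded_lt.min_mem {a | g ∈ N a} (h.cover g)
  have hmin : ∀ b < a, g ∉ N b := fun b hb hgb =>
    hb.not_ge (wellFounded_lt.min_le (s := {a | g ∈ N a}) hgb)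
  by_cases hl : IsLim a
  · by_cases hm : ∃ b, b < a
    · obtain ⟨b, hb⟩ := hm
      obtain ⟨c, hc, hgc⟩ := h.exists_mem_of_lim hl hb ha
      exact (hmin c hc hgc).elim
    · rw [h.eq_bot_of_isMin (not_exists.1 hm)] at ha
      exact (hg ha).elim
  · unfold IsLim at hl
    push Not at hl
    obtain ⟨σ, hσ, hs⟩ := hl
    exact ⟨σ, hmin σ hσ, fun b hb => h.mono (le_of_not_gt fun hba => (hs b hba).not_gt hb) ha⟩

theorem IsGoodFiltration.exists_ladderSystem {G O Θ : Type u} [AddCommGroup G] [LinearOrder O]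
    [WellFoundedLT O] [LinearOrder Θ] [WellFoundedLT Θ] [NoMaxOrder Θ]
    {μ : Cardinal.{u}} {N : O → Submodule ℤ G} {T : Set O}
    (h : IsGoodFiltration μ N T) (hΘ' : ∀ j : Θ, #(Set.Iio j) < #Θ) {U : Set O}
    (hU : ∀ δ ∈ U, IsLim δ ∧ ∃ s c : Θ → O, IsLadder N T δ s c) :
    ∃ Λ : LadderSystem N T Θ (LadderNode Θ O) U, (∀ δ, Λ.pt δ = δ) ∧
      (∀ δ j, (Λ.t δ j).top < δ ∧
        ∀ i, ((Λ.t δ j).2 i).1 ≤ (Λ.t δ j).top ∧ ((Λ.t δ j).2 i).2 ≤ (Λ.t δ j).top) ∧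
      ∀ δ j, Λ.B δ j ⊆ N (Λ.t δ j).top := by
  have hU' := fun δ : U => (hU δ δ.2).2
  choose s c hlad using hU'
  have hB := fun δ : U => (hlad δ).exists_basis h (hU δ δ.2).1
  choose B hB hBd hBspan hBlt hBs using hB
  refine ⟨{
    pt := Subtype.val
    c := c
    t := fun δ j => ⟨j, fun i => (s δ i, c δ i)⟩
    vals := fun n => Set.range fun i => (n.2 i).2
    B := B
    pt_inj := Subtype.val_injective
    c_mem := fun δ => (hlad δ).mem
    c_lt := fun δ j => ((hlad δ).lt j).trans ((hlad δ).lt_top j)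
    c_mem_vals := fun δ i j hij => ⟨⟨i, hij⟩, rfl⟩
    vals_le := ?_
    vals_card := fun n => ?_
    sep := fun δ δ' hne => ?_
    indep := hB
    span_eq := hBspan
    span_lt := hBlt }, fun δ => rfl, fun δ j => ⟨(hlad δ).lt_top j, fun i => ?_⟩,
    fun δ j => hBs δ j⟩
  · rintro δ j _ ⟨i, rfl⟩
    exact (((hlad δ).lt i).trans ((hlad δ).lt_top i)).le
  · refine Cardinal.mk_range_le.trans ?_
    obtain ⟨j', hj'⟩ := exists_gt n.1
    exact (Cardinal.mk_le_mk_of_subset fun x (hx : x ≤ n.1) => hx.trans_lt hj').trans (hΘ' j').le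
  · have hd : ∃ g, s δ g ≠ s δ' g := by
      by_contra! hcon
      rcases lt_or_gt_of_ne (fun h => hne (Subtype.ext h) : (δ : O) ≠ δ') with hlt | hlt
      · obtain ⟨j, hj⟩ := (hlad δ').cofinal _ hlt
        exact hj.not_gt (hcon j ▸ (hlad δ).lt_top j)
      · obtain ⟨j, hj⟩ := (hlad δ).cofinal _ hlt
        exact hj.not_gt (hcon j ▸ (hlad δ').lt_top j)
    obtain ⟨g, hg⟩ := hd
    refine ⟨g, fun j j' hjj => ?_⟩
    by_contra hlt
    obtain rfl : j = j' := congrArg Sigma.fst hjj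
    have h2 := congr_fun (eq_of_heq (Sigma.mk.inj hjj).2) ⟨g, not_lt.1 hlt⟩
    exact hg (congrArg Prod.fst h2)
  · have hi := (hlad δ).strictMono.monotone i.2
    exact ⟨hi, ((hlad δ).lt i).le.trans hi⟩

/-- The nodes whose values lie in a set of size at most `μ` number at most `μ`. -/
theorem mk_ladderNode_le {Θ O : Type u} [LinearOrder Θ] [NoMaxOrder Θ]
    (gch : ∀ μ : Cardinal.{u}, ℵ₀ ≤ μ → (2 : Cardinal.{u}) ^ μ = Order.succ μ) {μ : Cardinal.{u}}
    (hμ : ℵ₀ ≤ μ) (hΘ : #Θ ≤ μ.ord.cof) (hΘ' : ∀ j : Θ, #(Set.Iio j) < #Θ) (hO : #O ≤ μ) :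
    #(LadderNode Θ O) ≤ μ := by
  unfold LadderNode
  rw [Cardinal.mk_sigma]
  refine (Cardinal.sum_le_mk_mul_iSup _).trans ?_
  have hcof : μ.ord.cof ≤ μ := Ordinal.cof_ord_le μ
  refine (mul_le_mul' (hΘ.trans hcof) (ciSup_le' fun j => ?_)).trans (Cardinal.mul_eq_self hμ).le
  refine mk_fun_le_of_lt_cof gch hμ ?_ ?_
  · obtain ⟨j', hj'⟩ := exists_gt j
    exact (Cardinal.mk_le_mk_of_subset fun x (hx : x ≤ j) => hx.trans_lt hj').trans_lt
      ((hΘ' j').trans_le hΘ)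
  · rw [Cardinal.mk_prod, Cardinal.lift_id]
    exact (mul_le_mul' hO hO).trans (Cardinal.mul_eq_self hμ).le

/-- A set of size at most `μ` is a union of `cf μ` sets of size less than `μ`. -/
theorem exists_pieces {μ : Cardinal.{u}} (hμ : ℵ₀ ≤ μ) {Θ O : Type u} (hΘ : #Θ = μ.ord.cof)
    (s : Set O) (hs : #s ≤ μ) : ∃ a : Θ → Set O, (∀ i, #(a i) < μ) ∧ ∀ x ∈ s, ∃ i, x ∈ a i := by
  let I := μ.ord.ToType
  have hI : #I = μ := Cardinal.mk_ord_toType μ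
  have hmax : NoMaxOrder I := Cardinal.noMaxOrder hμ
  obtain ⟨t, ht, htc⟩ := Order.exists_cof_eq I
  have e1 : #Θ = #t := by rw [hΘ, htc, Ordinal.cof_toType]
  obtain ⟨e⟩ := Cardinal.eq.1 e1
  have e2 : Nonempty (s ↪ I) := by rwa [← Cardinal.le_def, hI]
  obtain ⟨ι⟩ := e2
  refine ⟨fun i => Subtype.val '' {x : s | ι x ≤ e i}, fun i => ?_, fun x hx => ?_⟩
  · obtain ⟨z, hz⟩ := exists_gt (e i : I)
    refine Cardinal.mk_image_le.trans_lt (lt_of_le_of_lt ?_ ((Cardinal.mk_Iio_lt z (by simp [I])).trans_eq hI))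
    rw [← Cardinal.mk_image_eq ι.injective]
    refine Cardinal.mk_le_mk_of_subset ?_
    rintro _ ⟨x, hx, rfl⟩
    exact lt_of_le_of_lt hx hz
  · obtain ⟨y, hy, hxy⟩ := ht (ι ⟨x, hx⟩)
    refine ⟨e.symm ⟨y, hy⟩, ⟨x, hx⟩, ?_, rfl⟩
    simpa using hxy

theorem linearMap_eq_of_span {A : Type*} [AddCommGroup A] {S : Set A} {L H : Submodule ℤ A}
    (hS : Submodule.span ℤ S = L) (hLH : L ≤ H) (u : H →ₗ[ℤ] ℤ) (φ : L →ₗ[ℤ] ℤ)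
    (h : ∀ x (hx : x ∈ L), x ∈ S → u ⟨x, hLH hx⟩ = φ ⟨x, hx⟩) (x : A) (hx : x ∈ L) :
    u ⟨x, hLH hx⟩ = φ ⟨x, hx⟩ := by
  subst hS
  have : u ∘ₗ Submodule.inclusion hLH = φ :=
    LinearMap.ext_on Submodule.span_span_coe_preimage fun y hy => h y y.2 hy
  exact LinearMap.congr_fun this ⟨x, hx⟩

end Histories

section SingularCase

theorem exists_ne_of_mk_lt {O I : Type u} {A : Set O} (hA : #(A → ℤ) < #I) (F : O → I → ℤ) :
    ∃ ξ ζ : I, ξ ≠ ζ ∧ ∀ ε ∈ A, F ε ξ = F ε ζ := by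
  have hn : ¬ Function.Injective fun (ξ : I) (ε : A) => F ε ξ := fun hinj =>
    (Cardinal.mk_le_of_injective hinj).not_gt hA
  obtain ⟨ξ, ζ, h, hne⟩ := Function.not_injective_iff.1 hn
  exact ⟨ξ, ζ, hne, fun ε hε => congr_fun h ⟨ε, hε⟩⟩

variable {G O Θ Nd U I : Type u} [AddCommGroup G] [LinearOrder O] [LinearOrder Θ]
  {N : O → Submodule ℤ G} {T : Set O}

/-- The gluing in which a basis element is attached to a difference of two labels of its node. -/
noncomputable def LadderSystem.glue (Λ : LadderSystem N T Θ Nd U)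
    (jj : (Σ δ, (⋃ j, Λ.B δ j : Set G)) → Θ) (ξ ζ : (Σ δ, (⋃ j, Λ.B δ j : Set G)) → I)
    (hne : ∀ r, ξ r ≠ ζ r) : GlueData (Σ δ, (⋃ j, Λ.B δ j : Set G)) (Nd × G) I U G where
  dl r := r.1
  b r := r.2
  nd r := (Λ.t r.1 (jj r), r.2)
  w r := Finsupp.single ((Λ.t r.1 (jj r), (r.2 : G)), ξ r) (1 : ℤ) -
    Finsupp.single ((Λ.t r.1 (jj r), (r.2 : G)), ζ r) (1 : ℤ)
  lead := ξ
  indep := by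
    intro δ
    have h1 : LinearIndependent ℤ (fun b : (⋃ j, Λ.B δ j : Set G) => (b : G)) := Λ.indep δ
    have h2 : ∀ r : {r : Σ δ, (⋃ j, Λ.B δ j : Set G) | r.1 = δ},
        (r.1.2 : G) ∈ ⋃ j, Λ.B δ j := by
      rintro ⟨⟨_, b⟩, rfl⟩
      exact b.2
    refine h1.comp (fun r => ⟨r.1.2, h2 r⟩) ?_
    rintro ⟨⟨a, b⟩, rfl⟩ ⟨⟨a', b'⟩, ha'⟩ hab
    obtain rfl : a' = a := ha'
    exact Subtype.ext (Sigma.ext rfl (heq_of_eq (Subtype.ext (Subtype.ext_iff.1 hab))))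
  inj := by
    rintro ⟨a, b⟩ ⟨a', b'⟩ h1 h2
    obtain rfl : a = a' := h1
    exact Sigma.ext rfl (heq_of_eq (Subtype.ext (Prod.ext_iff.1 h2).2))
  supp := by
    intro r p hp
    by_contra hn
    refine hp ?_
    rw [Finsupp.sub_apply, Finsupp.single_eq_of_ne fun he => hn (congrArg Prod.fst he),
      Finsupp.single_eq_of_ne fun he => hn (congrArg Prod.fst he), sub_zero]
  coeff r := by
    rw [Finsupp.sub_apply, Finsupp.single_eq_same,
      Finsupp.single_eq_of_ne fun he => hne r (congrArg Prod.snd he), sub_zero]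

theorem LadderSystem.compat_glue (Λ : LadderSystem N T Θ Nd U)
    (jj : (Σ δ, (⋃ j, Λ.B δ j : Set G)) → Θ) (hjj : ∀ r, (r.2 : G) ∈ Λ.B r.1 (jj r))
    (ξ ζ : (Σ δ, (⋃ j, Λ.B δ j : Set G)) → I) (hne : ∀ r, ξ r ≠ ζ r) :
    Λ.Compat (Λ.glue jj ξ ζ hne) where
  nd_eq r := ⟨jj r, hjj r, rfl⟩
  exists_eq δ m hm := ⟨⟨δ, ⟨m, hm⟩⟩, rfl, rfl⟩

theorem LadderSystem.relFree_of_mk_le [WellFoundedLT O] {μ : Cardinal.{u}} (hμ : ℵ₀ ≤ μ)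
    (h : IsGoodFiltration μ N T) (hO : IsSuccOrderType O μ) {s : O → O}
    (hs : ∀ a b, a < b ↔ s a ≤ b) (hΘ : Order.cof Θ = #Θ) (hΘ' : ℵ₀ ≤ #Θ)
    (Λ : LadderSystem N T Θ Nd U) {R : Type u} {D : GlueData R (Nd × G) I U G} (hD : Λ.Compat D)
    {P : Submodule ℤ ((((Nd × G) × I) →₀ ℤ) × (U →₀ G))}
    (hP : P ≤ GlueData.box Set.univ fun δ => N (s (Λ.pt δ))) (hPμ : #P ≤ μ) : RelFree D.K P := by
  let U' : Set U := ⋃ p : P, (p.1.2.support : Set U)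
  have hU' : #U' ≤ μ := by
    refine (Cardinal.mk_iUnion_le _).trans ((mul_le_mul' hPμ (ciSup_le' fun p => ?_)).trans
      (Cardinal.mul_eq_self hμ).le)
    exact (Cardinal.lt_aleph0_of_finite _).le.trans hμ
  obtain ⟨α, hα⟩ := hO.exists_gt ((fun δ => s (Λ.pt δ)) '' U') (Cardinal.mk_image_le.trans hU')
  have hY : ∀ γ, ∃ Y : Set G, γ ∈ T → γ ≤ α → LinearIndepOn ℤ id Y ∧
      Disjoint (N γ) (Submodule.span ℤ Y) ∧ N γ ⊔ Submodule.span ℤ Y = N α := by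
    intro γ
    by_cases hγ : γ ∈ T ∧ γ ≤ α
    · obtain ⟨C, -, hfree, hdis, hsup⟩ := (h.relFree γ hγ.1 _ (h.card α)).exists_compl
      obtain ⟨Y, hY, rfl⟩ := exists_basis_set hfree
      exact ⟨Y, fun _ _ => ⟨hY, hdis, hsup.trans (sup_eq_right.2 (h.mono hγ.2))⟩⟩
    · exact ⟨∅, fun h1 h2 => (hγ ⟨h1, h2⟩).elim⟩
  choose Y hY using hY
  exact LadderSystem.relFree_of_le h.mono hs hΘ hΘ' hD hY h.exists_rank hP fun p hp δ hδ =>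
    (hα _ ⟨δ, Set.mem_iUnion.2 ⟨⟨p, hp⟩, by simpa using hδ⟩, rfl⟩).le

theorem IsGoodFiltration.false_of_singular [WellFoundedLT O] {μ : Cardinal.{u}}
    (gch : ∀ μ : Cardinal.{u}, ℵ₀ ≤ μ → (2 : Cardinal.{u}) ^ μ = Order.succ μ) (hμ : ℵ₀ ≤ μ)
    (hsing : μ.ord.cof < μ)
    (hleast : ∀ lam : Cardinal.{u}, ℵ₀ < lam ∧ ExistsKappaFreeWhiteheadNonfree lam →
      Order.succ μ ≤ lam)
    (hall : ∀ (G : Type u) (inst : AddCommGroup G),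
      #G = Order.succ μ → @IsKappaFree (Order.succ μ) G inst → @IsWhitehead G inst)
    (h : IsGoodFiltration μ N T) (hO : IsSuccOrderType O μ) (hO' : #O = Order.succ μ)
    (hT : ∀ a, ∃ b ∈ T, a < b) (hG : #G ≤ Order.succ μ)
    (hcof : ∃ E : O → O, ∀ δ ∉ T, IsLim δ → (∀ b < δ, E b < δ) →
      Order.cof (Set.Iio δ) = μ.ord.cof) : False := by
  let Θ := μ.ord.cof.ord.ToType
  have hΘ : #Θ = μ.ord.cof := Cardinal.mk_ord_toType _
  have hΘlt : ∀ j : Θ, #(Set.Iio j) < #Θ := fun j => Cardinal.mk_Iio_lt j (by simp [Θ])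
  have hcofμ : ℵ₀ ≤ μ.ord.cof := 
    Ordinal.aleph0_le_cof_iff.2 (Ordinal.one_lt_cof_iff.2 (Cardinal.isSuccLimit_ord hμ))
  have hΘcof : Order.cof Θ = #Θ := by
    rw [hΘ, Ordinal.cof_toType]
    exact Ordinal.cof_ord_cof _
  have hmaxΘ : NoMaxOrder Θ := Cardinal.noMaxOrder hcofμ
  obtain ⟨E, hE⟩ := h.exists_fun_ladder hμ hO hT (Θ := Θ) hΘlt (by rwa [hΘ])
  let U : Set O := {δ | δ ∉ T ∧ IsLim δ ∧ ∀ b < δ, E b < δ}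
  obtain ⟨Λ, hpt, htop, hBtop⟩ := h.exists_ladderSystem hΘlt (U := U)
    fun δ hδ => ⟨hδ.2.1, hE δ hδ.1 hδ.2.1 hδ.2.2⟩
  obtain ⟨s, hs⟩ := exists_succ_fun (hO.exists_gt_elem hμ)
  have hlt : ∀ a, a < s a := fun a => (hs a _).2 le_rfl
  let I := μ.ord.ToType
  have hI : #I = μ := Cardinal.mk_ord_toType μ
  have hpieces := fun δ : U => exists_pieces hμ hΘ (Set.Iio (δ : O)) (hO.mk_Iio_le δ)
  choose a ha hacov using hpieces
  have hLH : ∀ δ : U, N δ ≤ N (s δ) := fun δ => h.mono (hlt δ).le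
  have hφ := fun δ : U => exists_not_extending hleast (hLH δ) (h.free _ (h.card _))
    (Order.lt_succ_of_le (h.card (s δ))) (h.not_relFree δ δ.2.1 _ (hlt δ))
  choose φ hφ using hφ
  have hΘΘ : #(Θ → Θ) ≤ μ := by
    have e : #(Θ → Θ) = #Θ ^ #Θ := by simp
    rw [e, hΘ]
    exact power_le_of_lt_of_lt gch hμ hsing hsing
  have hcode : ∀ b, Nonempty (((Θ → Θ) × N b → I → ℤ) ↪ O) := fun b => by
    rw [← Cardinal.le_def, hO']
    refine mk_fun_int_le gch hμ ?_ hI.le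
    rw [Cardinal.mk_prod, Cardinal.lift_id, Cardinal.lift_id]
    exact (mul_le_mul' hΘΘ (h.card b)).trans (Cardinal.mul_eq_self hμ).le
  let code : ∀ b, ((Θ → Θ) × N b → I → ℤ) ↪ O := fun b => (hcode b).some
  let dec : ∀ b, O → (Θ → Θ) × N b → I → ℤ := fun b => Function.invFun (code b)
  have hdec : ∀ b F, dec b (code b F) = F := fun b F =>
    Function.leftInverse_invFun (code b).injective F
  have hjj : ∀ r : (Σ δ, (⋃ j, Λ.B δ j : Set G)), ∃ j, (r.2 : G) ∈ Λ.B r.1 j :=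
    fun r => Set.mem_iUnion.1 r.2.2
  choose jj hjj using hjj
  have hlab := fun (ν : Θ → Θ) (r : Σ δ, (⋃ j, Λ.B δ j : Set G)) =>
    exists_ne_of_mk_lt (I := I) (A := a r.1 (ν (jj r)))
      (hI.symm ▸ mk_fun_int_lt_of_singular gch hμ hsing (ha _ _))
      fun ε => dec _ ε (ν, ⟨r.2, hBtop _ _ (hjj r)⟩)
  choose ξ ζ hne hlab using hlab
  have hκ : ℵ₀ < Order.succ μ := Order.lt_succ_of_le hμ
  have hNd : #(LadderNode Θ O) ≤ Order.succ μ := by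
    refine mk_ladderNode_le gch hκ.le ?_ hΘlt hO'.le
    rw [(Cardinal.isRegular_succ hμ).cof_ord, hΘ]
    exact hsing.le.trans (Order.le_succ μ)
  have hptH : ∀ δ : U, N δ = N (Λ.pt δ) := fun δ => by rw [hpt]
  have hbN : ∀ r : (Σ δ, (⋃ j, Λ.B δ j : Set G)), (r.2 : G) ∈ N r.1 := fun r => by
    rw [hptH, ← Λ.span_eq]
    exact Submodule.subset_span r.2.2
  have hsol := fun ν : Θ → Θ =>
    (Λ.glue jj (ξ ν) (ζ ν) (hne ν)).exists_extension hκ hall (fun δ => N (s δ))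
      (fun r => hLH r.1 (hbN r)) (by
        rw [Cardinal.mk_prod, Cardinal.lift_id, Cardinal.lift_id]
        exact (mul_le_mul' hNd hG).trans (Cardinal.mul_eq_self hκ.le).le)
      (hI.le.trans (Order.le_succ μ)) ((Cardinal.mk_set_le U).trans hO'.le) hG
      (fun P hP hPc => Λ.relFree_of_mk_le hμ h hO hs hΘcof (hΘ.symm ▸ hcofμ)
        (Λ.compat_glue jj hjj _ _ _) (by simpa only [hpt] using hP) (Order.lt_succ_iff.1 hPc))
      (fun r => φ r.1 ⟨r.2, hbN r⟩)
  choose f u hu using hsol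
  let e : LadderNode Θ O → O := fun n => code n.top fun q i =>
    f q.1 (Finsupp.single ((n, (q.2 : G)), i) 1)
  have hbd : ∀ b, ∃ b', ∀ n : LadderNode Θ O,
      (∀ i, (n.2 i).1 ≤ b ∧ (n.2 i).2 ≤ b) → e n < b' := by
    intro b
    obtain ⟨b₁, hb₁⟩ := hO.exists_gt_elem hμ b
    let q : LadderNode Θ (Set.Iio b₁) → LadderNode Θ O := fun n =>
      ⟨n.1, fun i => ((n.2 i).1, (n.2 i).2)⟩
    obtain ⟨b', hb'⟩ := hO.exists_gt (Set.range fun n => e (q n)) (Cardinal.mk_range_le.trans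
      (mk_ladderNode_le gch hμ hΘ.le hΘlt (hO.mk_Iio_le b₁)))
    exact ⟨b', fun n hn => hb' _ ⟨⟨n.1, fun i => (⟨_, (hn i).1.trans_lt hb₁⟩,
      ⟨_, (hn i).2.trans_lt hb₁⟩)⟩, rfl⟩⟩
  choose E' hE' using hbd
  obtain ⟨δ, hδT, hδl, hδE⟩ := h.stationary fun b => max (E b) (E' b)
  let d : U := ⟨δ, hδT, hδl, fun b hb => (le_max_left _ _).trans_lt (hδE b hb)⟩
  have hed : ∀ j, ∃ i, e (Λ.t d j) ∈ a d i := fun j => hacov d _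
    ((hE' _ _ (htop d j).2).trans ((le_max_right _ _).trans_lt (hδE _ (htop d j).1)))
  choose ν hν using hed
  refine hφ d (u ν d) fun x hx => linearMap_eq_of_span
    (by rw [Λ.span_eq, ← hptH]) (hLH d) (u ν d) (φ d) (fun m hm hmB => ?_) x hx
  let r : (Σ δ, (⋃ j, Λ.B δ j : Set G)) := ⟨d, m, hmB⟩
  have h1 := hu ν r
  have h2 := hlab ν r (e (Λ.t d (jj r))) (hν _)
  rw [hdec] at h2
  have h3 : f ν ((Λ.glue jj (ξ ν) (ζ ν) (hne ν)).w r) = 0 := by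
    refine (map_sub (f ν) _ _).trans (sub_eq_zero.2 h2)
  rw [h3, add_zero] at h1
  exact h1

end SingularCase

theorem not_succ_of_whitehead
    (gch : ∀ μ : Cardinal.{u}, ℵ₀ ≤ μ → (2 : Cardinal.{u}) ^ μ = Order.succ μ)
    {μ : Cardinal.{u}} (hμ : ℵ₀ ≤ μ)
    (hleast : ∀ lam : Cardinal.{u}, ℵ₀ < lam ∧ ExistsKappaFreeWhiteheadNonfree lam →
      Order.succ μ ≤ lam)
    (hall : ∀ (G : Type u) (inst : AddCommGroup G),
      #G = Order.succ μ → @IsKappaFree (Order.succ μ) G inst → @IsWhitehead G inst) :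
    ¬ ExistsKappaFreeWhiteheadNonfree (Order.succ μ) := by
  rintro ⟨G, inst, hG, hfree, hW, hnot⟩
  let O := (Order.succ μ).ord.ToType
  have hO : IsSuccOrderType O μ := isSuccOrderType_ord hμ
  have hOc : #O = Order.succ μ := Cardinal.mk_ord_toType _
  obtain ⟨g⟩ := Cardinal.eq.1 (hOc.trans hG.symm)
  obtain ⟨N, T, h⟩ := exists_goodFiltration hμ hO g g.surjective
    (fun M hM => hfree M.toAddSubgroup (Order.lt_succ_of_le hM)) hnot
  obtain ⟨Sol, hSol⟩ := h.exists_solution hμ (Order.lt_succ μ) hleast (hO.exists_gt_elem hμ) hW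
  have hT := h.exists_mem_gt gch hμ hO Sol hSol
  have hcof := h.exists_fun_cof_eq gch hμ hO Sol hSol
  rcases (Ordinal.cof_ord_le μ).lt_or_eq with hsing | hreg
  · exact h.false_of_singular gch hμ hsing hleast hall hO hOc hT hG.le hcof
  · exact h.false_of_regular gch hμ hreg hleast hall hO hT hG.le hcof

theorem stmt1
    (gch : ∀ μ : Cardinal.{u}, Cardinal.aleph0 ≤ μ → (2 : Cardinal.{u}) ^ μ = Order.succ μ)
    (κ : Cardinal.{u})
    (hκ : Cardinal.aleph0 < κ ∧ ExistsKappaFreeWhiteheadNonfree κ)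
    (hleast : ∀ lam : Cardinal.{u},
      Cardinal.aleph0 < lam ∧ ExistsKappaFreeWhiteheadNonfree lam → κ ≤ lam)
    (hall : ∀ (G : Type u) (inst : AddCommGroup G),
      Cardinal.mk G = κ → @IsKappaFree κ G inst → @IsWhitehead G inst) :
    κ.IsInaccessible := by
  have hsucc : ∀ μ : Cardinal.{u}, ℵ₀ ≤ μ → Order.succ μ ≠ κ := by
    rintro μ hμ rfl
    exact not_succ_of_whitehead gch hμ hleast hall hκ.2
  refine ⟨hκ.1, ?_, ?_⟩
  · by_contra hsing
    obtain ⟨G, inst, hG, hfree, -, hnot⟩ := hκ.2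
    exact hnot (free_of_singular hκ.1 hG (fun M hM => hfree M.toAddSubgroup hM) (not_le.1 hsing))
  · intro x hx
    rcases lt_or_ge x ℵ₀ with h | h
    · exact (Cardinal.power_lt_aleph0 (Cardinal.natCast_lt_aleph0 (n := 2)) h).trans hκ.1
    · rw [gch x h]
      exact (Order.succ_le_of_lt hx).lt_of_ne (hsucc x h)
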